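/- arXiv:1603.05430 — 4 statements merged into one kernel-verified Lean document; each statement's English description precedes it below -/
import Mathlib

section
/- The set {f ∈ Σ_{4,4} : ℓ(f) = 5} of quaternary quartic sums of squares whose sum of squares length is exactly 5 is an open and dense subset of Σ_{4,4} (in the subspace topology induced from ℝ[x_1,x_2,x_3,x_4]_4). -/
open MvPolynomial

noncomputable section

/-- `f` is a sum of `r` squares of forms of degree `d` in `n` variables. -/
def IsSOS (n d r : ℕ) (f : MvPolynomial (Fin n) ℝ) : Prop :=
  ∃ p : Fin r → MvPolynomial (Fin n) ℝ,
    (∀ i, (p i).IsHomogeneous d) ∧ f = ∑ i, p i ^ 2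

/-- `f` lies in `Σ_{n,2d}`: it is a sum of squares of forms of degree `d`. -/
def InSigma (n d : ℕ) (f : MvPolynomial (Fin n) ℝ) : Prop :=
  ∃ r, IsSOS n d r f

/-- The sum of squares length `ℓ(f)`. -/
def sosLength (n d : ℕ) (f : MvPolynomial (Fin n) ℝ) : ℕ :=
  sInf {r | IsSOS n d r f}

/-- The coefficientwise topology on polynomials; on each finite-dimensional
subspace of forms of fixed degree it induces the standard topology. -/
instance (n : ℕ) : TopologicalSpace (MvPolynomial (Fin n) ℝ) :=
  TopologicalSpace.induced (fun f (m : Fin n →₀ ℕ) => MvPolynomial.coeff m f) inferInstance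

/-- The cone `Σ_{4,4}` as a subset of the space `ℝ[x₁,…,x₄]₄` of quartic forms. -/
def SigmaSet44 : Set (MvPolynomial.homogeneousSubmodule (Fin 4) ℝ 4) :=
  {f | InSigma 4 2 (f : MvPolynomial (Fin 4) ℝ)}


/-- The real polynomial ring in four variables. -/
abbrev R4 := MvPolynomial (Fin 4) ℝ

/-- `g` is a nonzerodivisor modulo `I`. -/
def NZ (g : R4) (I : Ideal R4) : Prop := ∀ u, g * u ∈ I → u ∈ I

/-- `I` is stable under taking homogeneous components. -/
def HomI (I : Ideal R4) : Prop := ∀ p ∈ I, ∀ n, homogeneousComponent n p ∈ I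

/-- The socle modulo `I` is at most one dimensional. -/
def Soc1 (I : Ideal R4) : Prop := ∀ a b : R4, (∀ k, X k * a ∈ I) → (∀ k, X k * b ∈ I) →
  ∃ s t : ℝ, (s ≠ 0 ∨ t ≠ 0) ∧ C s * a + C t * b ∈ I

/-- All forms of degree at least `n` lie in `I`. -/
def DegB (I : Ideal R4) (n : ℕ) : Prop := ∀ d, n ≤ d → ∀ a : R4, a.IsHomogeneous d → a ∈ I

lemma mem_supS {I : Ideal R4} {g x : R4} :
    x ∈ I ⊔ Ideal.span {g} ↔ ∃ v, x - g * v ∈ I := by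
  constructor
  · intro h
    obtain ⟨i, hi, j, hj, rfl⟩ := Submodule.mem_sup.1 h
    obtain ⟨v, rfl⟩ := Ideal.mem_span_singleton'.1 hj
    exact ⟨v, by convert hi using 1; ring⟩
  · rintro ⟨v, hv⟩
    have : x = (x - g * v) + v * g := by ring
    rw [this]
    exact Submodule.add_mem_sup hv (Ideal.mem_span_singleton'.2 ⟨v, rfl⟩)

lemma NZ_swap {I : Ideal R4} {c g : R4} (hc : NZ c I) (hg : NZ g (I ⊔ Ideal.span {c})) :
    NZ c (I ⊔ Ideal.span {g}) := by
  intro u hu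
  obtain ⟨v, hv⟩ := mem_supS.1 hu
  have h1 : g * v ∈ I ⊔ Ideal.span {c} := by
    refine mem_supS.2 ⟨u, ?_⟩
    have := I.neg_mem hv
    convert this using 1; ring
  obtain ⟨w, hw⟩ := mem_supS.1 (hg v h1)
  refine mem_supS.2 ⟨w, hc _ ?_⟩
  have := I.add_mem hv (I.mul_mem_left g hw)
  convert this using 1; ring

lemma Soc1_exchange {I : Ideal R4} {b : R4} {k : Fin 4} (hb : NZ b I) (hc : NZ (X k) I)
    (h : Soc1 (I ⊔ Ideal.span {X k})) : Soc1 (I ⊔ Ideal.span {b}) := by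
  have key : ∀ a, (∀ j, X j * a ∈ I ⊔ Ideal.span {b}) → ∃ e, X k * a - b * e ∈ I ∧
      ∀ j, X j * e ∈ I ⊔ Ideal.span {X k} := by
    intro a ha
    obtain ⟨e, he⟩ := mem_supS.1 (ha k)
    refine ⟨e, he, fun j => ?_⟩
    obtain ⟨m, hm⟩ := mem_supS.1 (ha j)
    refine mem_supS.2 ⟨m, hb _ ?_⟩
    have := I.sub_mem (I.mul_mem_left (X k) hm) (I.mul_mem_left (X j) he)
    convert this using 1; ring
  intro a a' ha ha'
  obtain ⟨e, he, he1⟩ := key a ha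
  obtain ⟨e', he', he1'⟩ := key a' ha'
  obtain ⟨s, t, hst, hm⟩ := h e e' he1 he1'
  obtain ⟨w, hw⟩ := mem_supS.1 hm
  refine ⟨s, t, hst, mem_supS.2 ⟨w, hc _ ?_⟩⟩
  have := I.add_mem (I.add_mem (I.mul_mem_left (C s) he) (I.mul_mem_left (C t) he'))
    (I.mul_mem_left b hw)
  convert this using 1; ring

lemma hc_mul {b : R4} {m : ℕ} (hb : b.IsHomogeneous m) (u : R4) (n : ℕ) :
    homogeneousComponent (m + n) (b * u) = b * homogeneousComponent n u := by
  conv_lhs => rw [← sum_homogeneousComponent u]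
  rw [Finset.mul_sum, map_sum]
  have : ∀ i, homogeneousComponent (m + n) (b * homogeneousComponent i u) =
      if i = n then b * homogeneousComponent n u else 0 := by
    intro i
    rw [homogeneousComponent_of_mem (hb.mul (homogeneousComponent_isHomogeneous i u))]
    by_cases h : i = n
    · simp [h]
    · simp [h, Ne.symm h]
  simp only [this]
  rw [Finset.sum_ite_eq']
  split_ifs with h
  · rfl
  · rw [homogeneousComponent_eq_zero]
    · simp
    · simpa using h

lemma hc_mul_lt {b : R4} {m : ℕ} (hb : b.IsHomogeneous m) (u : R4) (n : ℕ) (h : n < m) :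
    homogeneousComponent n (b * u) = 0 := by
  conv_lhs => rw [← sum_homogeneousComponent u]
  rw [Finset.mul_sum, map_sum]
  refine Finset.sum_eq_zero fun i _ => ?_
  rw [homogeneousComponent_of_mem (hb.mul (homogeneousComponent_isHomogeneous i u))]
  rw [if_neg (by omega)]

lemma HomI_sup {I : Ideal R4} (hI : HomI I) {b : R4} {m : ℕ} (hb : b.IsHomogeneous m) :
    HomI (I ⊔ Ideal.span {b}) := by
  intro p hp n
  obtain ⟨v, hv⟩ := mem_supS.1 hp
  by_cases h : n < m
  · refine mem_supS.2 ⟨0, ?_⟩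
    have := hI _ hv n
    rw [map_sub, hc_mul_lt hb _ _ h] at this
    simpa using this
  · obtain ⟨d, rfl⟩ := Nat.exists_eq_add_of_le (not_lt.1 h)
    refine mem_supS.2 ⟨homogeneousComponent d v, ?_⟩
    have := hI _ hv (m + d)
    rwa [map_sub, hc_mul hb] at this

lemma HomI_bot : HomI ⊥ := by
  intro p hp n
  simp only [Ideal.mem_bot] at hp
  simp [hp]

/-- the part of degree `d` of the ideal, as a subspace of the forms of degree `d` -/
def degPart (I : Ideal R4) (d : ℕ) : Submodule ℝ (homogeneousSubmodule (Fin 4) ℝ d) :=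
  (I.restrictScalars ℝ).comap (homogeneousSubmodule (Fin 4) ℝ d).subtype

instance (d : ℕ) : FiniteDimensional ℝ (homogeneousSubmodule (Fin 4) ℝ d) :=
  Module.Finite.iff_fg.2 (homogeneousSubmodule_fg (Fin 4) ℝ d)

/-- multiplication by a form -/
def mulMap {b : R4} {m : ℕ} (hb : b.IsHomogeneous m) (d : ℕ) :
    homogeneousSubmodule (Fin 4) ℝ d →ₗ[ℝ] homogeneousSubmodule (Fin 4) ℝ (m + d) :=
  ((LinearMap.mulLeft ℝ b).comp (homogeneousSubmodule (Fin 4) ℝ d).subtype).codRestrict _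
    (fun u => hb.mul u.2)

lemma mulMap_le (I : Ideal R4) {b : R4} {m : ℕ} (hb : b.IsHomogeneous m) (d : ℕ) :
    degPart I d ≤ (degPart I (m + d)).comap (mulMap hb d) := by
  intro u hu
  exact I.mul_mem_left b hu

/-- multiplication by a form on the graded pieces of the quotient -/
def mulQ (I : Ideal R4) {b : R4} {m : ℕ} (hb : b.IsHomogeneous m) (d : ℕ) :
    (homogeneousSubmodule (Fin 4) ℝ d ⧸ degPart I d) →ₗ[ℝ]
      (homogeneousSubmodule (Fin 4) ℝ (m + d) ⧸ degPart I (m + d)) :=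
  (degPart I d).mapQ (degPart I (m + d)) (mulMap hb d) (mulMap_le I hb d)

lemma mulQ_inj {I : Ideal R4} {b : R4} {m : ℕ} (hb : b.IsHomogeneous m) (h : NZ b I) (d : ℕ) :
    Function.Injective (mulQ I hb d) := by
  rw [← LinearMap.ker_eq_bot, LinearMap.ker_eq_bot']
  intro x hx
  obtain ⟨u, rfl⟩ := Submodule.Quotient.mk_surjective _ x
  rw [mulQ, Submodule.mapQ_apply, Submodule.Quotient.mk_eq_zero] at hx
  rw [Submodule.Quotient.mk_eq_zero]
  exact h _ hx

lemma mulQ_surj_iff {I : Ideal R4} (hI : HomI I) {b : R4} {m : ℕ} (hb : b.IsHomogeneous m) (d : ℕ) :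
    Function.Surjective (mulQ I hb d) ↔
      ∀ a : R4, a.IsHomogeneous (m + d) → a ∈ I ⊔ Ideal.span {b} := by
  constructor
  · intro h a ha
    obtain ⟨x, hx⟩ := h (Submodule.Quotient.mk ⟨a, ha⟩)
    obtain ⟨u, rfl⟩ := Submodule.Quotient.mk_surjective _ x
    rw [mulQ, Submodule.mapQ_apply, Submodule.Quotient.eq] at hx
    refine mem_supS.2 ⟨u, ?_⟩
    have h2 : b * u - a ∈ I := hx
    have := I.neg_mem h2
    convert this using 1; ring
  · intro h x
    obtain ⟨⟨a, ha⟩, rfl⟩ := Submodule.Quotient.mk_surjective _ x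
    obtain ⟨v, hv⟩ := mem_supS.1 (h a ha)
    have := hI _ hv (m + d)
    rw [map_sub, hc_mul hb, homogeneousComponent_eq_self ha] at this
    refine ⟨Submodule.Quotient.mk ⟨homogeneousComponent d v,
      homogeneousComponent_isHomogeneous d v⟩, ?_⟩
    rw [mulQ, Submodule.mapQ_apply, Submodule.Quotient.eq]
    change b * homogeneousComponent d v - a ∈ I
    have := I.neg_mem this
    convert this using 1; ring

lemma DegB_exchange {I : Ideal R4} (hI : HomI I) {b : R4} (hb2 : b.IsHomogeneous 2) {k : Fin 4}
    (hb : NZ b I) (hc : NZ (X k) I) {n : ℕ} (hn : 1 ≤ n)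
    (h : DegB (I ⊔ Ideal.span {X k}) n) : DegB (I ⊔ Ideal.span {b}) (n + 1) := by
  intro d hd a ha
  obtain ⟨e, rfl⟩ : ∃ e, d = 2 + e := ⟨d - 2, by omega⟩
  have hX : (X k : R4).IsHomogeneous 1 := isHomogeneous_X ℝ k
  have hr : ∀ e, n ≤ e + 1 →
      Module.finrank ℝ (homogeneousSubmodule (Fin 4) ℝ e ⧸ degPart I e) =
      Module.finrank ℝ (homogeneousSubmodule (Fin 4) ℝ (1 + e) ⧸ degPart I (1 + e)) := by
    intro e he
    refine LinearEquiv.finrank_eq (LinearEquiv.ofBijective (mulQ I hX e) ⟨mulQ_inj hX hc e, ?_⟩)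
    exact (mulQ_surj_iff hI hX e).2 (fun a ha => h _ (by omega) a ha)
  have h2 : Module.finrank ℝ (homogeneousSubmodule (Fin 4) ℝ e ⧸ degPart I e) =
      Module.finrank ℝ (homogeneousSubmodule (Fin 4) ℝ (2 + e) ⧸ degPart I (2 + e)) := by
    rw [hr e (by omega), hr (1 + e) (by omega), show 1 + (1 + e) = 2 + e by ring]
  have hs := (LinearMap.injective_iff_surjective_of_finrank_eq_finrank h2).1 (mulQ_inj hb2 hb e)
  exact (mulQ_surj_iff hI hb2 e).1 hs a ha

lemma avoid (W : Submodule ℝ R4) (hW : ∀ k, X k ∈ (Ideal.span (W : Set R4)).radical)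
    (S : Set (Ideal R4)) (hS : S.Finite) (h : ∀ I ∈ S, ∃ k : Fin 4, NZ (X k) I) :
    ∃ g ∈ W, ∀ I ∈ S, NZ g I := by
  classical
  let P : Set (Ideal R4) := ⋃ I ∈ S, associatedPrimes R4 (R4 ⧸ I)
  have hP : P.Finite := hS.biUnion fun I _ => associatedPrimes.finite R4 (R4 ⧸ I)
  let T : Ideal R4 → Submodule ℝ W := fun p => (p.restrictScalars ℝ).comap W.subtype
  have htop : (⊤ : Submodule ℝ W) ∉ (hP.toFinset.image T) := by
    intro ht
    obtain ⟨p, hp, hpt⟩ := Finset.mem_image.1 ht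
    rw [Set.Finite.mem_toFinset] at hp
    obtain ⟨I, hI, hpI⟩ := Set.mem_iUnion₂.1 hp
    obtain ⟨k, hk⟩ := h I hI
    have hprime : p.IsPrime := hpI.1
    have hWp : Ideal.span (W : Set R4) ≤ p := by
      rw [Ideal.span_le]
      intro w hw
      have : (⟨w, hw⟩ : W) ∈ T p := by rw [hpt]; trivial
      exact this
    have hXp : X k ∈ p := (hprime.radical_le_iff.2 hWp) (hW k)
    have hz : X k ∈ ⋃ p ∈ associatedPrimes R4 (R4 ⧸ I), (p : Set R4) :=
      Set.mem_iUnion₂.2 ⟨p, hpI, hXp⟩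
    rw [biUnion_associatedPrimes_eq_zero_divisors] at hz
    obtain ⟨x, hx0, hx⟩ := hz
    obtain ⟨u, rfl⟩ := Ideal.Quotient.mk_surjective x
    apply hx0
    rw [Ideal.Quotient.eq_zero_iff_mem]
    apply hk
    rw [← Ideal.Quotient.eq_zero_iff_mem, map_mul]
    exact hx
  have hne := Subspace.biUnion_ne_univ_of_top_notMem htop
  obtain ⟨w, hw⟩ := (Set.ne_univ_iff_exists_notMem _).1 hne
  refine ⟨w, w.2, fun I hI u hu => ?_⟩
  by_contra hcon
  have hz : (w : R4) ∈ ⋃ p ∈ associatedPrimes R4 (R4 ⧸ I), (p : Set R4) := by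
    rw [biUnion_associatedPrimes_eq_zero_divisors]
    refine ⟨Ideal.Quotient.mk I u, ?_, ?_⟩
    · rwa [Ne, Ideal.Quotient.eq_zero_iff_mem]
    · change Ideal.Quotient.mk I (w * u) = 0
      rwa [Ideal.Quotient.eq_zero_iff_mem]
  obtain ⟨p, hp, hwp⟩ := Set.mem_iUnion₂.1 hz
  apply hw
  refine Set.mem_iUnion₂.2 ⟨T p, ?_, hwp⟩
  exact Finset.mem_image.2 ⟨p, hP.mem_toFinset.2 (Set.mem_iUnion₂.2 ⟨I, hI, hp⟩), rfl⟩

lemma NZ_X (s : Set (Fin 4)) (k : Fin 4) (hk : k ∉ s) :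
    NZ (X k) (Ideal.span ((X : Fin 4 → R4) '' s)) := by
  intro u hu
  rw [mem_ideal_span_X_image] at hu ⊢
  intro m hm
  have h1 : (Finsupp.single k 1 + m) ∈ (X k * u).support := by
    rw [mem_support_iff, add_comm, mul_comm, coeff_mul_X]
    exact mem_support_iff.1 hm
  obtain ⟨i, hi, h⟩ := hu _ h1
  refine ⟨i, hi, ?_⟩
  have : k ≠ i := fun h => hk (h ▸ hi)
  simpa [Finsupp.single_apply, this] using h

lemma NZ_congr {g : R4} {I J : Ideal R4} (h : NZ g I) (e : I = J) : NZ g J := e ▸ h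

lemma alg_exists (W : Submodule ℝ R4) (hW2 : ∀ w ∈ W, w.IsHomogeneous 2)
    (hW : ∀ k, X k ∈ (Ideal.span (W : Set R4)).radical) :
    ∃ g0 ∈ W, ∃ g1 ∈ W, ∃ g2 ∈ W, ∃ g3 ∈ W, ∃ J : Ideal R4,
      J = Ideal.span {g0} ⊔ Ideal.span {g1} ⊔ Ideal.span {g2} ⊔ Ideal.span {g3} ∧
      HomI J ∧ Soc1 J ∧ DegB J 5 := by
  let s : R4 → Ideal R4 := fun g => Ideal.span {g}
  let c : Fin 4 → R4 := X
  have c3 : NZ (c 3) ⊥ := NZ_congr (NZ_X ∅ 3 (by simp)) (by simp)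
  have c2 : NZ (c 2) (s (c 3)) := NZ_congr (NZ_X {3} 2 (by simp)) (by simp [s, c])
  have c1 : NZ (c 1) (s (c 3) ⊔ s (c 2)) :=
    NZ_congr (NZ_X {3, 2} 1 (by simp)) (by simp [s, c, Set.image_insert_eq, Ideal.span_insert])
  have c0 : NZ (c 0) (s (c 3) ⊔ s (c 2) ⊔ s (c 1)) :=
    NZ_congr (NZ_X {3, 2, 1} 0 (by simp))
      (by simp [s, c, Set.image_insert_eq, Ideal.span_insert, sup_assoc])
  -- choice of g0
  obtain ⟨g0, hg0, h0⟩ := avoid W hW {s (c 3) ⊔ s (c 2) ⊔ s (c 1), s (c 3) ⊔ s (c 2), s (c 3)}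
    (by simp) (by
      simp only [Set.mem_insert_iff, Set.mem_singleton_iff, forall_eq_or_imp, forall_eq]
      exact ⟨⟨0, c0⟩, ⟨1, c1⟩, ⟨2, c2⟩⟩)
  simp only [Set.mem_insert_iff, Set.mem_singleton_iff, forall_eq_or_imp, forall_eq] at h0
  obtain ⟨h0a, h0b, h0c⟩ := h0
  have c1' : NZ (c 1) (s (c 3) ⊔ s (c 2) ⊔ s g0) := NZ_swap c1 h0a
  have c2' : NZ (c 2) (s (c 3) ⊔ s g0) := NZ_swap c2 h0b
  have c3' : NZ (c 3) (s g0) :=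
    NZ_congr (NZ_swap c3 (NZ_congr h0c (by simp [s]))) (by simp [s])
  -- choice of g1
  obtain ⟨g1, hg1, h1⟩ := avoid W hW {s (c 3) ⊔ s (c 2) ⊔ s g0, s (c 3) ⊔ s g0}
    (by simp) (by
      simp only [Set.mem_insert_iff, Set.mem_singleton_iff, forall_eq_or_imp, forall_eq]
      exact ⟨⟨1, c1'⟩, ⟨2, c2'⟩⟩)
  simp only [Set.mem_insert_iff, Set.mem_singleton_iff, forall_eq_or_imp, forall_eq] at h1
  obtain ⟨h1a, h1b⟩ := h1
  have c2'' : NZ (c 2) (s (c 3) ⊔ s g0 ⊔ s g1) :=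
    NZ_swap c2' (NZ_congr h1a (sup_right_comm _ _ _))
  have c3'' : NZ (c 3) (s g0 ⊔ s g1) := NZ_swap c3' (NZ_congr h1b (sup_comm _ _))
  -- choice of g2
  obtain ⟨g2, hg2, h2⟩ := avoid W hW {s (c 3) ⊔ s g0 ⊔ s g1}
    (by simp) (by
      simp only [Set.mem_singleton_iff, forall_eq]
      exact ⟨2, c2''⟩)
  simp only [Set.mem_singleton_iff, forall_eq] at h2
  have c3''' : NZ (c 3) (s g0 ⊔ s g1 ⊔ s g2) :=
    NZ_swap c3'' (NZ_congr h2 (by rw [sup_assoc, sup_comm]))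
  -- choice of g3
  obtain ⟨g3, hg3, h3⟩ := avoid W hW {s g0 ⊔ s g1 ⊔ s g2}
    (by simp) (by
      simp only [Set.mem_singleton_iff, forall_eq]
      exact ⟨3, c3'''⟩)
  simp only [Set.mem_singleton_iff, forall_eq] at h3
  have hX : ∀ k, (c k).IsHomogeneous 1 := fun k => isHomogeneous_X ℝ k
  have hs : ∀ g m, g.IsHomogeneous m → HomI (s g) := by
    intro g m hg
    have := HomI_sup HomI_bot hg
    rwa [bot_sup_eq] at this
  have q0 := hW2 _ hg0
  have q1 := hW2 _ hg1
  have q2 := hW2 _ hg2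
  have q3 := hW2 _ hg3
  -- the maximal ideal
  have hm : s (c 3) ⊔ s (c 2) ⊔ s (c 1) ⊔ s (c 0) = Ideal.span ((X : Fin 4 → R4) '' {3, 2, 1, 0}) := by
    simp [s, c, Set.image_insert_eq, Ideal.span_insert, sup_assoc]
  have hmem : ∀ a : R4, coeff 0 a = 0 → a ∈ s (c 3) ⊔ s (c 2) ⊔ s (c 1) ⊔ s (c 0) := by
    intro a ha
    rw [hm, mem_ideal_span_X_image]
    intro m hm'
    have hm0 : m ≠ 0 := by
      rintro rfl
      exact (mem_support_iff.1 hm') ha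
    obtain ⟨i, hi⟩ := Finsupp.ne_iff.1 hm0
    exact ⟨i, by fin_cases i <;> simp, hi⟩
  have S0 : Soc1 (s (c 3) ⊔ s (c 2) ⊔ s (c 1) ⊔ s (c 0)) := by
    intro a a' _ _
    by_cases h : coeff 0 a = 0
    · exact ⟨1, 0, by simp, hmem _ (by simp [h])⟩
    · exact ⟨- coeff 0 a', coeff 0 a, Or.inr h, hmem _ (by simp [coeff_C_mul]; ring)⟩
  have D0 : DegB (s (c 3) ⊔ s (c 2) ⊔ s (c 1) ⊔ s (c 0)) 1 := by
    intro d hd a ha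
    apply hmem
    by_contra hcon
    have := ha hcon
    simp at this
    omega
  have I0 : HomI (s (c 3) ⊔ s (c 2) ⊔ s (c 1)) :=
    HomI_sup (HomI_sup (hs _ _ (hX 3)) (hX 2)) (hX 1)
  have S1 := Soc1_exchange h0a c0 S0
  have D1 := DegB_exchange I0 q0 h0a c0 le_rfl D0
  have e1 : s (c 3) ⊔ s (c 2) ⊔ s (c 1) ⊔ s g0 = s (c 3) ⊔ s (c 2) ⊔ s g0 ⊔ s (c 1) :=
    sup_right_comm _ _ _
  have S1' : Soc1 (s (c 3) ⊔ s (c 2) ⊔ s g0 ⊔ s (c 1)) := e1 ▸ S1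
  have D1' : DegB (s (c 3) ⊔ s (c 2) ⊔ s g0 ⊔ s (c 1)) 2 := e1 ▸ D1
  have I1 : HomI (s (c 3) ⊔ s (c 2) ⊔ s g0) :=
    HomI_sup (HomI_sup (hs _ _ (hX 3)) (hX 2)) q0
  have S2 := Soc1_exchange h1a c1' S1'
  have D2 := DegB_exchange I1 q1 h1a c1' (by norm_num) D1'
  have e2 : s (c 3) ⊔ s (c 2) ⊔ s g0 ⊔ s g1 = s (c 3) ⊔ s g0 ⊔ s g1 ⊔ s (c 2) := by
    rw [sup_right_comm (s (c 3)), sup_right_comm]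
  have S2' : Soc1 (s (c 3) ⊔ s g0 ⊔ s g1 ⊔ s (c 2)) := e2 ▸ S2
  have D2' : DegB (s (c 3) ⊔ s g0 ⊔ s g1 ⊔ s (c 2)) 3 := e2 ▸ D2
  have I2 : HomI (s (c 3) ⊔ s g0 ⊔ s g1) :=
    HomI_sup (HomI_sup (hs _ _ (hX 3)) q0) q1
  have S3 := Soc1_exchange h2 c2'' S2'
  have D3 := DegB_exchange I2 q2 h2 c2'' (by norm_num) D2'
  have e3 : s (c 3) ⊔ s g0 ⊔ s g1 ⊔ s g2 = s g0 ⊔ s g1 ⊔ s g2 ⊔ s (c 3) := by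
    ac_rfl
  have S3' : Soc1 (s g0 ⊔ s g1 ⊔ s g2 ⊔ s (c 3)) := e3 ▸ S3
  have D3' : DegB (s g0 ⊔ s g1 ⊔ s g2 ⊔ s (c 3)) 4 := e3 ▸ D3
  have I3 : HomI (s g0 ⊔ s g1 ⊔ s g2) :=
    HomI_sup (HomI_sup (hs _ _ q0) q1) q2
  have S4 := Soc1_exchange h3 c3''' S3'
  have D4 := DegB_exchange I3 q3 h3 c3''' (by norm_num) D3'
  exact ⟨g0, hg0, g1, hg1, g2, hg2, g3, hg3, _, rfl, HomI_sup I3 q3, S4, D4⟩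

lemma J_comp {g0 g1 g2 g3 : R4} (q0 : g0.IsHomogeneous 2) (q1 : g1.IsHomogeneous 2)
    (q2 : g2.IsHomogeneous 2) (q3 : g3.IsHomogeneous 2) {a : R4} {d : ℕ}
    (ha : a.IsHomogeneous (2 + d))
    (h : a ∈ Ideal.span {g0} ⊔ Ideal.span {g1} ⊔ Ideal.span {g2} ⊔ Ideal.span {g3}) :
    ∃ u0 u1 u2 u3 : R4, u0.IsHomogeneous d ∧ u1.IsHomogeneous d ∧ u2.IsHomogeneous d ∧
      u3.IsHomogeneous d ∧ a = g0 * u0 + g1 * u1 + g2 * u2 + g3 * u3 := by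
  obtain ⟨v3, h⟩ := mem_supS.1 h
  obtain ⟨v2, h⟩ := mem_supS.1 h
  obtain ⟨v1, h⟩ := mem_supS.1 h
  obtain ⟨v0, h⟩ := Ideal.mem_span_singleton'.1 h
  refine ⟨_, _, _, _, homogeneousComponent_isHomogeneous d v0,
    homogeneousComponent_isHomogeneous d v1, homogeneousComponent_isHomogeneous d v2,
    homogeneousComponent_isHomogeneous d v3, ?_⟩
  rw [← hc_mul q0, ← hc_mul q1, ← hc_mul q2, ← hc_mul q3, ← map_add, ← map_add, ← map_add]
  rw [← homogeneousComponent_eq_self ha]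
  congr 1
  linear_combination -h

/-- The key algebraic input: structure of a functional killing the degree 4 part of the ideal. -/
lemma alg_main (W : Submodule ℝ R4) (hW2 : ∀ w ∈ W, w.IsHomogeneous 2)
    (hW : ∀ k, X k ∈ (Ideal.span (W : Set R4)).radical)
    (L : R4 →ₗ[ℝ] ℝ) (hL : ∀ w ∈ W, ∀ r : R4, r.IsHomogeneous 2 → L (w * r) = 0)
    (a : R4) (ha : a.IsHomogeneous 4) (hLa : L a ≠ 0) :
    ∃ g0 ∈ W, ∃ g1 ∈ W, ∃ g2 ∈ W, ∃ g3 ∈ W,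
      (∀ q ∈ W, q ∈ Submodule.span ℝ {g0, g1, g2, g3}) ∧
      (∀ a' : R4, a'.IsHomogeneous 4 → L a' = 0 → ∃ u0 u1 u2 u3 : R4,
        u0.IsHomogeneous 2 ∧ u1.IsHomogeneous 2 ∧ u2.IsHomogeneous 2 ∧ u3.IsHomogeneous 2 ∧
        a' = g0 * u0 + g1 * u1 + g2 * u2 + g3 * u3) := by
  obtain ⟨g0, hg0, g1, hg1, g2, hg2, g3, hg3, J, hJ, hH, hS, hD⟩ := alg_exists W hW2 hW
  have q0 := hW2 _ hg0
  have q1 := hW2 _ hg1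
  have q2 := hW2 _ hg2
  have q3 := hW2 _ hg3
  have hJ4 : ∀ b : R4, b.IsHomogeneous 4 → b ∈ J → L b = 0 := by
    intro b hb hbJ
    rw [hJ] at hbJ
    obtain ⟨u0, u1, u2, u3, p0, p1, p2, p3, rfl⟩ := J_comp q0 q1 q2 q3 (d := 2) hb hbJ
    simp [hL _ hg0 _ p0, hL _ hg1 _ p1, hL _ hg2 _ p2, hL _ hg3 _ p3]
  have hsoc4 : ∀ b : R4, b.IsHomogeneous 4 → ∀ k, X k * b ∈ J := by
    intro b hb k
    exact hD 5 le_rfl _ ((isHomogeneous_X ℝ k).mul hb)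
  have hC : ∀ (b : R4) (n : ℕ) (t : ℝ), b.IsHomogeneous n → (C t * b).IsHomogeneous n := by
    intro b n t hb
    simpa using (isHomogeneous_C (Fin 4) t).mul hb
  have hCJ : ∀ (b : R4) (t : ℝ), t ≠ 0 → C t * b ∈ J → b ∈ J := by
    intro b t ht hb
    have := J.mul_mem_left (C t⁻¹) hb
    rw [← mul_assoc, ← C_mul, inv_mul_cancel₀ ht] at this
    simpa using this
  have haJ : a ∉ J := fun h => hLa (hJ4 a ha h)
  -- lower degree socle vanishes
  have hlow : ∀ (b : R4) (n : ℕ), b.IsHomogeneous n → n ≠ 4 → (∀ k, X k * b ∈ J) → b ∈ J := by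
    intro b n hb hn hk
    obtain ⟨s, t, hst, hm⟩ := hS a b (hsoc4 a ha) hk
    have h4 := hH _ hm 4
    have hn' := hH _ hm n
    rw [map_add, homogeneousComponent_of_mem (hC a 4 s ha),
      homogeneousComponent_of_mem (hC b n t hb)] at h4 hn'
    rw [if_pos rfl, if_neg (Ne.symm hn), add_zero] at h4
    rw [if_neg hn, if_pos rfl, zero_add] at hn'
    have hs : s = 0 := by
      by_contra hs
      exact haJ (hCJ _ _ hs h4)
    exact hCJ _ _ (by tauto) hn'
  refine ⟨g0, hg0, g1, hg1, g2, hg2, g3, hg3, ?_, ?_⟩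
  · intro q hq
    have hq2 := hW2 q hq
    have hqJ : q ∈ J := by
      refine hlow q 2 hq2 (by norm_num) fun k => ?_
      have hk := (isHomogeneous_X ℝ k).mul hq2
      refine hlow _ 3 hk (by norm_num) fun l => ?_
      have hl := (isHomogeneous_X ℝ l).mul hk
      have hL0 : L (X l * (X k * q)) = 0 := by
        have := hL q hq (X l * X k) ((isHomogeneous_X ℝ l).mul (isHomogeneous_X ℝ k))
        rw [← this]; congr 1; ring
      obtain ⟨s, t, hst, hm⟩ := hS a _ (hsoc4 a ha) (hsoc4 _ hl)
      have h0 := hJ4 _ ((hC a 4 s ha).add (hC _ 4 t hl)) hm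
      rw [map_add, ← smul_eq_C_mul, ← smul_eq_C_mul, map_smul, map_smul, hL0] at h0
      have hs : s = 0 := by simpa [hLa] using h0
      subst hs
      refine hCJ _ t (by tauto) ?_
      simpa using hm
    rw [hJ] at hqJ
    obtain ⟨u0, u1, u2, u3, p0, p1, p2, p3, rfl⟩ := J_comp q0 q1 q2 q3 (d := 0) hq2 hqJ
    have hu : ∀ u : R4, u.IsHomogeneous 0 → ∃ t : ℝ, u = C t := by
      intro u hu
      exact ⟨_, totalDegree_eq_zero_iff_eq_C.1 (by simpa using hu.totalDegree_le)⟩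
    obtain ⟨t0, rfl⟩ := hu _ p0
    obtain ⟨t1, rfl⟩ := hu _ p1
    obtain ⟨t2, rfl⟩ := hu _ p2
    obtain ⟨t3, rfl⟩ := hu _ p3
    have hx : ∀ g (t : ℝ), g ∈ ({g0, g1, g2, g3} : Set R4) →
        g * C t ∈ Submodule.span ℝ ({g0, g1, g2, g3} : Set R4) := by
      intro g t hg
      rw [mul_comm, ← smul_eq_C_mul]
      exact Submodule.smul_mem _ _ (Submodule.subset_span hg)
    refine Submodule.add_mem _ (Submodule.add_mem _ (Submodule.add_mem _ (hx _ _ ?_) (hx _ _ ?_))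
      (hx _ _ ?_)) (hx _ _ ?_) <;> simp
  · intro a' ha' hLa'
    obtain ⟨s, t, hst, hm⟩ := hS a a' (hsoc4 a ha) (hsoc4 a' ha')
    have h0 := hJ4 _ ((hC a 4 s ha).add (hC _ 4 t ha')) hm
    rw [map_add, ← smul_eq_C_mul, ← smul_eq_C_mul, map_smul, map_smul, hLa'] at h0
    have hs : s = 0 := by simpa [hLa] using h0
    subst hs
    have : a' ∈ J := hCJ _ t (by tauto) (by simpa using hm)
    rw [hJ] at this
    have hfin := J_comp q0 q1 q2 q3 (d := 2) ha' this
    exact hfin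

/-- Consequence for five quadrics without a common nontrivial complex zero. -/
lemma alg_five (p : Fin 5 → R4) (hp : ∀ i, (p i).IsHomogeneous 2)
    (hz : ∀ z : Fin 4 → ℂ, (∀ i, aeval z (p i) = 0) → z = 0)
    (L : R4 →ₗ[ℝ] ℝ) (hL : ∀ i, ∀ r : R4, r.IsHomogeneous 2 → L (p i * r) = 0)
    (a : R4) (ha : a.IsHomogeneous 4) (hLa : L a ≠ 0) :
    (∃ u : Fin 5 → ℝ, u ≠ 0 ∧ ∑ i, u i • p i = 0) ∧
    (∀ a' : R4, a'.IsHomogeneous 4 → L a' = 0 → ∃ h : Fin 5 → R4,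
      (∀ i, (h i).IsHomogeneous 2) ∧ a' = ∑ i, p i * h i) := by
  let W : Submodule ℝ R4 := Submodule.span ℝ (Set.range p)
  have hWmem : ∀ w ∈ W, ∃ t : Fin 5 → ℝ, ∑ i, t i • p i = w := by
    intro w hw
    exact (Submodule.mem_span_range_iff_exists_fun ℝ).1 hw
  have hW2 : ∀ w ∈ W, w.IsHomogeneous 2 := by
    intro w hw
    have : W ≤ homogeneousSubmodule (Fin 4) ℝ 2 := by
      rw [Submodule.span_le]
      rintro _ ⟨i, rfl⟩
      exact hp i
    exact this hw
  have hW : ∀ k, X k ∈ (Ideal.span (W : Set R4)).radical := by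
    intro k
    rw [← vanishingIdeal_zeroLocus_eq_radical (K := ℂ), mem_vanishingIdeal_iff]
    intro z hzz
    have : z = 0 := hz z fun i => hzz _ (Ideal.subset_span (Submodule.subset_span ⟨i, rfl⟩))
    simp [this]
  have hLW : ∀ w ∈ W, ∀ r : R4, r.IsHomogeneous 2 → L (w * r) = 0 := by
    intro w hw r hr
    obtain ⟨t, rfl⟩ := hWmem w hw
    simp [Finset.sum_mul, hL _ r hr]
  obtain ⟨g0, hg0, g1, hg1, g2, hg2, g3, hg3, h1, h2⟩ := alg_main W hW2 hW L hLW a ha hLa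
  constructor
  · by_contra hcon
    push Not at hcon
    have hli : LinearIndependent ℝ p := by
      rw [Fintype.linearIndependent_iff]
      intro t ht i
      by_contra hti
      exact hcon t (fun h => hti (by simp [h])) ht
    have hr : Module.finrank ℝ W = 5 := by
      simpa using finrank_span_eq_card hli
    have hle : W ≤ Submodule.span ℝ (Finset.image ![g0, g1, g2, g3] Finset.univ : Set R4) := by
      intro q hq
      have := h1 q hq
      refine Submodule.span_mono ?_ this
      intro x hx
      simp only [Finset.coe_image, Finset.coe_univ, Set.image_univ, Set.mem_range]
      simp only [Set.mem_insert_iff, Set.mem_singleton_iff] at hx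
      rcases hx with rfl | rfl | rfl | rfl
      exacts [⟨0, rfl⟩, ⟨1, rfl⟩, ⟨2, rfl⟩, ⟨3, rfl⟩]
    have hle' := Submodule.finrank_mono hle
    have h4 := finrank_span_finset_le_card (R := ℝ) (Finset.image ![g0, g1, g2, g3] Finset.univ)
    have h5 : (Finset.image ![g0, g1, g2, g3] Finset.univ).card ≤ 4 := by
      simpa using (Finset.card_image_le (s := Finset.univ) (f := ![g0, g1, g2, g3]))
    have h6 : Module.finrank ℝ W ≤ 4 := hle'.trans (h4.trans h5)
    omega
  · intro a' ha' hLa'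
    obtain ⟨u0, u1, u2, u3, p0, p1, p2, p3, rfl⟩ := h2 a' ha' hLa'
    obtain ⟨t0, rfl⟩ := hWmem _ hg0
    obtain ⟨t1, rfl⟩ := hWmem _ hg1
    obtain ⟨t2, rfl⟩ := hWmem _ hg2
    obtain ⟨t3, rfl⟩ := hWmem _ hg3
    refine ⟨fun i => t0 i • u0 + t1 i • u1 + t2 i • u2 + t3 i • u3, fun i => ?_, ?_⟩
    · have hsm : ∀ (t : ℝ) (u : R4), u.IsHomogeneous 2 → (t • u).IsHomogeneous 2 := fun t u hu =>
        (homogeneousSubmodule (Fin 4) ℝ 2).smul_mem t hu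
      exact (((hsm _ _ p0).add (hsm _ _ p1)).add (hsm _ _ p2)).add (hsm _ _ p3)
    · simp only [Finset.sum_mul, ← Finset.sum_add_distrib]
      refine Finset.sum_congr rfl fun i _ => ?_
      simp only [smul_eq_C_mul]
      ring

section Abstract

set_option linter.unusedSectionVars false

variable {E F : Type*} [NormedAddCommGroup E] [NormedSpace ℝ E] [FiniteDimensional ℝ E]
  [NormedAddCommGroup F] [NormedSpace ℝ F] [FiniteDimensional ℝ F]

/-- The sum of squares map attached to a bilinear map. -/
def sqMap (B : E →L[ℝ] E →L[ℝ] F) (r : ℕ) (p : Fin r → E) : F := ∑ i, B (p i) (p i)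

/-- Sums of `r` squares. -/
def SS (B : E →L[ℝ] E →L[ℝ] F) (r : ℕ) : Set F := Set.range (sqMap B r)

/-- All sums of squares. -/
def SA (B : E →L[ℝ] E →L[ℝ] F) : Set F := {f | ∃ r, f ∈ SS B r}

lemma sqMap_contDiff (B : E →L[ℝ] E →L[ℝ] F) (r : ℕ) : ContDiff ℝ ⊤ (sqMap B r) := by
  unfold sqMap
  fun_prop

lemma SS_closed (B : E →L[ℝ] E →L[ℝ] F) (r : ℕ)
    (hB : ∀ p : Fin r → E, sqMap B r p = 0 → p = 0) : IsClosed (SS B r) := by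
  have hc : Continuous (sqMap B r) := (sqMap_contDiff B r).continuous
  have hs : ∀ (t : ℝ) p, sqMap B r (t • p) = t ^ 2 • sqMap B r p := by
    intro t p
    simp [sqMap, Finset.smul_sum, smul_smul, pow_two]
  obtain ⟨c, hc0, hcl⟩ : ∃ c : ℝ, 0 < c ∧ ∀ p, c * ‖p‖ ^ 2 ≤ ‖sqMap B r p‖ := by
    by_cases hne : (Metric.sphere (0 : Fin r → E) 1).Nonempty
    · obtain ⟨x, hx, hmin⟩ := (isCompact_sphere (0 : Fin r → E) 1).exists_isMinOn hne
        (hc.norm.continuousOn)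
      have hx1 : ‖x‖ = 1 := by simpa using hx
      refine ⟨‖sqMap B r x‖, norm_pos_iff.2 fun h => ?_, fun p => ?_⟩
      · have := hB x h
        simp [this] at hx1
      · by_cases hp : p = 0
        · simp [hp]
        · have hp' : ‖p‖ ≠ 0 := norm_ne_zero_iff.2 hp
          have h1 : ‖p‖⁻¹ • p ∈ Metric.sphere (0 : Fin r → E) 1 := by
            simp [norm_smul, hp']
          have h2 := hmin h1
          simp only [Set.mem_ofPred_eq] at h2
          rw [hs, norm_smul] at h2
          have h3 : ‖(‖p‖⁻¹ ^ 2 : ℝ)‖ = (‖p‖ ^ 2)⁻¹ := by simp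
          rw [h3] at h2
          calc _ ≤ ((‖p‖ ^ 2)⁻¹ * ‖sqMap B r p‖) * ‖p‖ ^ 2 := by gcongr
            _ = _ := by field_simp
    · refine ⟨1, one_pos, fun p => ?_⟩
      by_cases hp : p = 0
      · simp [hp]
      · have hp' : ‖p‖ ≠ 0 := norm_ne_zero_iff.2 hp
        exact (hne ⟨‖p‖⁻¹ • p, by simp [norm_smul, hp']⟩).elim
  have hproper : Filter.Tendsto (sqMap B r) (Filter.cocompact _) (Bornology.cobounded F) := by
    rw [← tendsto_norm_atTop_iff_cobounded]
    have h1 : Filter.Tendsto (fun p : Fin r → E => c * ‖p‖ ^ 2) (Filter.cocompact _) Filter.atTop :=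
      ((Filter.tendsto_pow_atTop two_ne_zero).comp
        (tendsto_norm_cocompact_atTop (E := Fin r → E))).const_mul_atTop hc0
    exact Filter.tendsto_atTop_mono hcl h1
  have hcl2 : IsClosedMap (sqMap B r) := by
    refine IsProperMap.isClosedMap ?_
    rw [isProperMap_iff_tendsto_cocompact]
    exact ⟨hc, hproper.mono_right Metric.cobounded_le_cocompact⟩
  exact hcl2.isClosed_range

lemma SA_add (B : E →L[ℝ] E →L[ℝ] F) {f g : F} (hf : f ∈ SA B) (hg : g ∈ SA B) :
    f + g ∈ SA B := by
  obtain ⟨r, p, rfl⟩ := hf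
  obtain ⟨s, q, rfl⟩ := hg
  exact ⟨r + s, Fin.append p q, by simp [sqMap, Fin.sum_univ_add]⟩

lemma SA_smul (B : E →L[ℝ] E →L[ℝ] F) {f : F} (hf : f ∈ SA B) {t : ℝ} (ht : 0 ≤ t) :
    t • f ∈ SA B := by
  obtain ⟨r, p, rfl⟩ := hf
  refine ⟨r, fun i => √t • p i, ?_⟩
  simp [sqMap, Finset.smul_sum, smul_smul, ht]

lemma SA_convex (B : E →L[ℝ] E →L[ℝ] F) : Convex ℝ (SA B) := by
  intro x hx y hy a b ha hb _
  exact SA_add B (SA_smul B hx ha) (SA_smul B hy hb)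

lemma SS_mono (B : E →L[ℝ] E →L[ℝ] F) {r s : ℕ} (h : r ≤ s) : SS B r ⊆ SS B s := by
  obtain ⟨k, rfl⟩ := Nat.exists_eq_add_of_le h
  rintro _ ⟨p, rfl⟩
  exact ⟨Fin.append p (fun _ => 0), by simp [sqMap, Fin.sum_univ_add]⟩

lemma fderiv_line {ψ : E → F} {x v : E} {a b c : F} (hd : DifferentiableAt ℝ ψ x)
    (h : ∀ t : ℝ, ψ (x + t • v) = a + t • b + t ^ 2 • c) : fderiv ℝ ψ x v = b := by
  have h1 : HasDerivAt (fun t : ℝ => x + t • v) v 0 := by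
    simpa using ((hasDerivAt_id (0 : ℝ)).smul_const v).const_add x
  have hd' : HasFDerivAt ψ (fderiv ℝ ψ x) (x + (0 : ℝ) • v) := by
    simpa using hd.hasFDerivAt
  have h2 := hd'.comp_hasDerivAt (0 : ℝ) h1
  have h3 : HasDerivAt (fun t : ℝ => a + t • b + t ^ 2 • c) b 0 := by
    have := (((hasDerivAt_id (0 : ℝ)).smul_const b).const_add a).add
      (((hasDerivAt_id (0 : ℝ)).pow 2).smul_const c)
    simp only [id, one_smul, Nat.cast_ofNat, mul_one] at this
    refine (this.congr_deriv ?_).congr_of_eventuallyEq (Filter.Eventually.of_forall fun t => rfl)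
    simp
  have h4 : (ψ ∘ fun t : ℝ => x + t • v) = fun t : ℝ => a + t • b + t ^ 2 • c := funext h
  rw [h4] at h2
  exact h2.unique h3

lemma range_nhds {ψ : E → F} (hψ : ContDiff ℝ ⊤ ψ) (x : E)
    (hs : ∀ y, ∃ v, fderiv ℝ ψ x v = y) : Set.range ψ ∈ nhds (ψ x) := by
  have h1 : HasStrictFDerivAt ψ (fderiv ℝ ψ x) x :=
    hψ.contDiffAt.hasStrictFDerivAt (by simp)
  have h2 := h1.map_nhds_eq_of_surj (LinearMap.range_eq_top.2 hs)
  rw [← h2]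
  exact Filter.mem_map.2 (by simp)

/-- Openness at a tuple generating everything. -/
lemma open_of_surj (B : E →L[ℝ] E →L[ℝ] F) (hsym : ∀ x y, B x y = B y x) {r : ℕ} (p : Fin r → E)
    (hs : ∀ a, ∃ h : Fin r → E, a = ∑ i, B (p i) (h i)) : SS B r ∈ nhds (sqMap B r p) := by
  refine range_nhds (sqMap_contDiff B r) p fun y => ?_
  obtain ⟨h, hh⟩ := hs ((1 / 2 : ℝ) • y)
  refine ⟨h, ?_⟩
  have := fderiv_line (x := p) (v := h) (a := sqMap B r p) (b := y) (c := sqMap B r h)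
    ((sqMap_contDiff B r).differentiable (by simp) p) (by
      intro t
      have hy : y = ∑ i, B (p i) (h i) + ∑ i, B (p i) (h i) := by
        rw [← hh, ← add_smul]; norm_num
      rw [hy]
      simp only [sqMap, Pi.add_apply, Pi.smul_apply, map_add, map_smul,
        add_apply, smul_apply, Finset.sum_add_distrib,
        Finset.smul_sum, smul_add, smul_smul, hsym (h _) (p _), pow_two]
      abel)
  exact this

end Abstract

section Abstract2

set_option linter.unusedSectionVars false

variable {E F : Type*} [NormedAddCommGroup E] [NormedSpace ℝ E] [FiniteDimensional ℝ E]
  [NormedAddCommGroup F] [NormedSpace ℝ F] [FiniteDimensional ℝ F]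

/-- The blown up sum of squares map. -/
def blowMap (B : E →L[ℝ] E →L[ℝ] F) {r : ℕ} (p : Fin r → E) (u : Fin r → ℝ)
    (x : ℝ × (Fin r → E) × E) : F :=
  (2 : ℝ) • ∑ i, B (p i) (x.2.1 i) + B x.2.2 x.2.2
    + (2 * x.1) • B x.2.2 (∑ i, u i • x.2.1 i) + x.1 ^ 2 • ∑ i, B (x.2.1 i) (x.2.1 i)

lemma blowMap_eq (B : E →L[ℝ] E →L[ℝ] F) (hsym : ∀ x y, B x y = B y x) {r : ℕ}
    (p : Fin r → E) (u : Fin r → ℝ) (hu : ∑ i, u i ^ 2 = 1) (hup : ∑ i, u i • p i = 0)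
    (x : ℝ × (Fin r → E) × E) :
    sqMap B r (fun i => p i + x.1 ^ 2 • x.2.1 i + (x.1 * u i) • x.2.2) =
      sqMap B r p + x.1 ^ 2 • blowMap B p u x := by
  obtain ⟨e, h, q⟩ := x
  have h1 : ∑ i, (e * u i) • B (p i) q = 0 := by
    have : B (∑ i, u i • p i) q = 0 := by rw [hup]; simp
    simp only [mul_smul, ← Finset.smul_sum]
    simp only [map_sum, map_smul, sum_apply, smul_apply] at this
    rw [this, smul_zero]
  have h2 : ∑ i, (e * u i) • ((e * u i) • B q q) = e ^ 2 • B q q := by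
    have : ∑ i, (e * u i) • ((e * u i) • B q q) = (e ^ 2 * ∑ i, u i ^ 2) • B q q := by
      rw [Finset.mul_sum, Finset.sum_smul]
      refine Finset.sum_congr rfl fun i _ => ?_
      rw [smul_smul]; congr 1; ring
    rw [this, hu, mul_one]
  have h3 : ∀ i, B (p i + e ^ 2 • h i + (e * u i) • q) (p i + e ^ 2 • h i + (e * u i) • q) =
      B (p i) (p i) + (2 * e ^ 2) • B (p i) (h i) + (2 : ℝ) • (e * u i) • B (p i) q
      + (e ^ 2 * e ^ 2) • B (h i) (h i) + (e ^ 2 * (2 * e)) • (u i • B q (h i))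
      + (e * u i) • ((e * u i) • B q q) := by
    intro i
    simp only [map_add, map_smul, add_apply, smul_apply]
    rw [hsym (h i) (p i), hsym q (p i), hsym (h i) q]
    module
  simp only [sqMap, blowMap, h3, Finset.sum_add_distrib, ← Finset.smul_sum, h1, h2, map_sum,
    map_smul]
  module

/-- Openness at a tuple whose quartic span is a hyperplane. -/
lemma open_of_hyper (B : E →L[ℝ] E →L[ℝ] F) (hsym : ∀ x y, B x y = B y x) {r : ℕ} (p : Fin r → E)
    (L : F →ₗ[ℝ] ℝ) (hL0 : L ≠ 0) (hLp : ∀ i h, L (B (p i) h) = 0)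
    (hu : ∃ u : Fin r → ℝ, u ≠ 0 ∧ ∑ i, u i • p i = 0)
    (hker : ∀ a, L a = 0 → ∃ h : Fin r → E, a = ∑ i, B (p i) (h i))
    (hinn : sqMap B r p ∈ interior (SA B)) : SS B r ∈ nhds (sqMap B r p) := by
  -- normalise `u`
  obtain ⟨u, hu1, hup⟩ : ∃ u : Fin r → ℝ, ∑ i, u i ^ 2 = 1 ∧ ∑ i, u i • p i = 0 := by
    obtain ⟨u, hu0, hup⟩ := hu
    have hpos : 0 < ∑ i, u i ^ 2 := by
      obtain ⟨i, hi⟩ := Function.ne_iff.1 hu0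
      refine Finset.sum_pos' (fun i _ => sq_nonneg _) ⟨i, Finset.mem_univ _, ?_⟩
      have : u i ≠ 0 := hi
      positivity
    refine ⟨fun i => (√(∑ i, u i ^ 2))⁻¹ * u i, ?_, ?_⟩
    · simp only [mul_pow, ← Finset.mul_sum, inv_pow, Real.sq_sqrt hpos.le]
      exact inv_mul_cancel₀ hpos.ne'
    · simp only [mul_smul, ← Finset.smul_sum, hup, smul_zero]
  -- both signs occur
  have hLf : L (sqMap B r p) = 0 := by simp [sqMap, hLp]
  obtain ⟨h1, hh1⟩ : ∃ h, L h = 1 := by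
    obtain ⟨x, hx⟩ := DFunLike.ne_iff.1 hL0
    exact ⟨(L x)⁻¹ • x, by simpa using inv_mul_cancel₀ hx⟩
  have hsa : ∀ a ∈ SA B, 0 < L a → ∃ q, 0 < L (B q q) := by
    rintro a ⟨s, q, rfl⟩ ha
    simp only [sqMap, map_sum] at ha
    obtain ⟨i, _, hi⟩ := Finset.exists_lt_of_sum_lt (s := Finset.univ) (f := fun _ => (0 : ℝ))
      (g := fun i => L (B (q i) (q i))) (by simpa using ha)
    exact ⟨_, hi⟩
  have hsa' : ∀ a ∈ SA B, L a < 0 → ∃ q, L (B q q) < 0 := by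
    rintro a ⟨s, q, rfl⟩ ha
    simp only [sqMap, map_sum] at ha
    obtain ⟨i, _, hi⟩ := Finset.exists_lt_of_sum_lt (s := Finset.univ) (g := fun _ => (0 : ℝ))
      (f := fun i => L (B (q i) (q i))) (by simpa using ha)
    exact ⟨_, hi⟩
  have hev : ∀ᶠ t : ℝ in nhds 0, sqMap B r p + t • h1 ∈ SA B := by
    have hcont : Continuous fun t : ℝ => sqMap B r p + t • h1 := by fun_prop
    have := hcont.tendsto 0
    simp only [zero_smul, add_zero] at this
    exact this (mem_interior_iff_mem_nhds.1 hinn)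
  obtain ⟨δ, hδ, hball⟩ := Metric.eventually_nhds_iff.1 hev
  obtain ⟨qp, hqp⟩ := hsa _ (hball (y := δ / 2) (by simp [abs_of_pos hδ]; linarith))
    (by simp [hLf, hh1]; exact hδ)
  obtain ⟨qm, hqm⟩ := hsa' _ (hball (y := -(δ / 2)) (by simp [abs_of_pos hδ]; linarith))
    (by simp [hLf, hh1]; exact hδ)
  -- an isotropic vector
  obtain ⟨q0, hq0, hq0m⟩ : ∃ q0, L (B q0 q0) = 0 ∧ L (B q0 qm) ≠ 0 := by
    set a := L (B qp qp)
    set b := L (B qp qm) with hb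
    set c := L (B qm qm)
    have hd : 0 < b ^ 2 - a * c := by nlinarith [sq_nonneg b, mul_pos hqp (neg_pos.2 hqm)]
    have hs := Real.sq_sqrt hd.le
    have hs0 := Real.sqrt_pos.2 hd
    have hc : c ≠ 0 := hqm.ne
    refine ⟨qp + ((-b + √(b ^ 2 - a * c)) / c) • qm, ?_, ?_⟩
    · simp only [map_add, map_smul, add_apply, smul_apply, smul_eq_mul, hsym qm qp]
      change a + _ * b + (_ * (b + _ * c)) = 0
      field_simp
      nlinarith
    · simp only [map_add, map_smul, add_apply, smul_apply, smul_eq_mul]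
      change b + _ * c ≠ 0
      rw [div_mul_cancel₀ _ hc]
      simpa using hs0.ne'
  obtain ⟨h0, hh0⟩ := hker ((-1 / 2 : ℝ) • B q0 q0) (by simp [hq0])
  let G : ℝ × (Fin r → E) × E → ℝ × F := fun x => (x.1, blowMap B p u x)
  have hG : ContDiff ℝ ⊤ G := by
    unfold G blowMap
    fun_prop
  have hG0 : G (0, h0, q0) = (0, 0) := by
    simp only [G, blowMap, ← hh0]
    ext
    · simp
    · simp only [smul_smul]
      norm_num
  have hrange : Set.range G ∈ nhds (G (0, h0, q0)) := by
    have hdiff := hG.differentiable (by simp) (0, h0, q0)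
    refine range_nhds hG _ ?_
    have hdir1 : ∀ (k : Fin r → E) (s : E), fderiv ℝ G (0, h0, q0) (0, k, s) =
        (0, (2 : ℝ) • ∑ i, B (p i) (k i) + (2 : ℝ) • B q0 s) := by
      intro k s
      refine fderiv_line (a := G (0, h0, q0)) (c := (0, B s s)) hdiff fun t => ?_
      ext
      · simp [G]
      · simp only [G, blowMap, Prod.smul_mk, Prod.mk_add_mk, smul_zero, add_zero, mul_zero,
          zero_smul, map_add, map_smul, add_apply, smul_apply, Pi.add_apply, Pi.smul_apply,
          hsym s q0, ne_eq, OfNat.ofNat_ne_zero, not_false_eq_true, zero_pow,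
          Finset.sum_add_distrib, ← Finset.smul_sum]
        module
    obtain ⟨w, hw⟩ : ∃ w, fderiv ℝ G (0, h0, q0) (1, 0, 0) = (1, w) := by
      refine ⟨(2 : ℝ) • B q0 (∑ i, u i • h0 i), ?_⟩
      refine fderiv_line (a := G (0, h0, q0)) (c := (0, ∑ i, B (h0 i) (h0 i))) hdiff fun t => ?_
      ext
      · simp [G]
      · simp only [G, blowMap, Prod.smul_mk, Prod.mk_add_mk, smul_zero, add_zero, mul_zero,
          zero_smul, zero_add, smul_eq_mul, mul_one, ne_eq, OfNat.ofNat_ne_zero,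
          not_false_eq_true, zero_pow]
        module
    rintro ⟨e, y⟩
    let l : ℝ := L (y - e • w) / (2 * L (B q0 qm))
    obtain ⟨k, hk⟩ := hker ((1 / 2 : ℝ) • (y - e • w - (2 : ℝ) • B q0 (l • qm))) (by
      simp only [map_smul, map_sub, l, smul_eq_mul]
      field_simp
      ring)
    refine ⟨e • (1, 0, 0) + (0, k, l • qm), ?_⟩
    rw [map_add, map_smul, hw, hdir1, ← hk]
    ext
    · simp
    · simp only [Prod.smul_mk, Prod.mk_add_mk]
      module
  rw [hG0] at hrange
  obtain ⟨δ, hδ, hb⟩ := Metric.mem_nhds_iff.1 hrange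
  set ε : ℝ := δ / 2 with hε
  have hε0 : 0 < ε := by positivity
  refine Metric.mem_nhds_iff.2 ⟨ε ^ 2 * δ, by positivity, fun g hg => ?_⟩
  have hmem : ((ε, (ε ^ 2)⁻¹ • (g - sqMap B r p)) : ℝ × F) ∈ Metric.ball ((0, 0) : ℝ × F) δ := by
    rw [mem_ball_iff_norm] at hg ⊢
    simp only [Prod.mk_sub_mk, sub_zero, Prod.norm_mk, sup_lt_iff]
    refine ⟨by rw [Real.norm_eq_abs, abs_of_pos hε0]; linarith, ?_⟩
    rw [norm_smul, norm_inv, Real.norm_eq_abs, abs_of_pos (by positivity)]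
    rw [inv_mul_lt_iff₀ (by positivity)]
    exact hg
  obtain ⟨⟨e, h, q⟩, hx⟩ := hb hmem
  obtain ⟨he, hx2⟩ := Prod.mk.inj hx
  refine ⟨_, (blowMap_eq B hsym p u hu1 hup (e, h, q)).trans ?_⟩
  simp only at he ⊢
  rw [hx2, he, smul_smul, mul_inv_cancel₀ (by positivity)]
  simp

/-- Sums of four squares are thin for dimension reasons. -/
lemma thin_four (B : E →L[ℝ] E →L[ℝ] F) (hE : Module.finrank ℝ E = 10)
    (hF : 34 < Module.finrank ℝ F) : Dense (SS B 4)ᶜ := by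
  let T := {x : Fin 4 × Fin 10 // x.1.val ≤ x.2.val}
  let w : E ≃L[ℝ] (Fin 10 → ℝ) := ContinuousLinearEquiv.ofFinrankEq (by simp [hE])
  let P : Fin 4 → (T → ℝ) → E := fun i t =>
    w.symm fun j => if h : i.val ≤ j.val then t ⟨(i, j), h⟩ else 0
  let ψ : (T → ℝ) → F := fun t => ∑ i, B (P i t) (P i t)
  have hP : ∀ i, ContDiff ℝ ⊤ (P i) := by
    intro i
    refine w.symm.contDiff.comp (contDiff_pi.2 fun j => ?_)
    split_ifs with h
    · exact contDiff_apply _ _ _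
    · exact contDiff_const
  have hψ : ContDiff ℝ ⊤ ψ := by
    refine ContDiff.sum fun i _ => ?_
    have := hP i
    fun_prop
  have hcard : Module.finrank ℝ (T → ℝ) = 34 := by
    rw [Module.finrank_fintype_fun_eq_card]
    rfl
  have hψ1 : ContDiff ℝ 1 ψ := hψ.of_le (by simp)
  have hd := hψ1.dense_compl_range_of_finrank_lt_finrank (hcard ▸ hF)
  refine hd.mono (Set.compl_subset_compl.2 ?_)
  rintro _ ⟨p, rfl⟩
  -- QR decomposition
  let f : Fin 4 → EuclideanSpace ℝ (Fin 4) := fun j => WithLp.toLp 2 fun k =>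
    w (p k) ⟨j.val, by omega⟩
  let b := InnerProductSpace.gramSchmidtOrthonormalBasis (𝕜 := ℝ) (by simp) f
  have hbt : ∀ i j : Fin 4, i < j → inner ℝ (b j) (f i) = 0 := fun i j hij =>
    InnerProductSpace.gramSchmidtOrthonormalBasis_inv_triangular (𝕜 := ℝ) (by simp) f hij
  have hcol : ∀ k l : Fin 4, ∑ i, b i k * b i l = if k = l then 1 else 0 := by
    intro k l
    have h1 := b.sum_inner_mul_inner (EuclideanSpace.single k (1 : ℝ)) (EuclideanSpace.single l (1 : ℝ))
    simp only [EuclideanSpace.inner_single_left, EuclideanSpace.inner_single_right] at h1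
    simpa [Pi.single_apply, eq_comm] using h1
  let t : T → ℝ := fun x => w (∑ k, b x.1.1 k • p k) x.1.2
  have hPt : ∀ i, P i t = ∑ k, b i k • p k := by
    intro i
    rw [ContinuousLinearEquiv.symm_apply_eq]
    ext j
    split_ifs with h
    · rfl
    · push Not at h
      have := hbt ⟨j.val, by omega⟩ i h
      simp only [PiLp.inner_apply, f] at this
      simp only [map_sum, map_smul, Finset.sum_apply, Pi.smul_apply, smul_eq_mul]
      rw [← this]
      refine Finset.sum_congr rfl fun k _ => ?_
      simp [mul_comm]
  refine ⟨t, ?_⟩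
  simp only [ψ, hPt, sqMap, map_sum, map_smul, sum_apply, smul_apply]
  rw [Finset.sum_comm]
  refine Finset.sum_congr rfl fun k _ => ?_
  simp only [Finset.smul_sum]
  rw [Finset.sum_comm]
  simp only [smul_smul, ← Finset.sum_smul, hcol]
  simp

/-- The main deformation argument. -/
lemma main_abs (B : E →L[ℝ] E →L[ℝ] F) (hsym : ∀ x y, B x y = B y x)
    (hB : ∀ p : Fin 5 → E, sqMap B 5 p = 0 → p = 0) (Good : (Fin 5 → E) → Prop)
    (hGood : ∀ p, Good p → ∀ L : F →ₗ[ℝ] ℝ, L ≠ 0 → (∀ i h, L (B (p i) h) = 0) →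
      (∃ u : Fin 5 → ℝ, u ≠ 0 ∧ ∑ i, u i • p i = 0) ∧
      ∀ a, L a = 0 → ∃ h : Fin 5 → E, a = ∑ i, B (p i) (h i))
    (p0 : Fin 5 → E) (hp0 : ∀ a, ∃ h : Fin 5 → E, a = ∑ i, B (p0 i) (h i))
    (hD : ∀ f0, Dense {g | ∀ t : ℝ, 0 < t → ∀ p : Fin 5 → E, sqMap B 5 p = f0 + t • (g - f0) →
      sqMap B 5 p ∈ interior (SA B) → Good p}) :
    (interior (SA B)).Nonempty ∧ SA B ⊆ SS B 5 := by
  have hcl : IsClosed (SS B 5) := SS_closed B 5 hB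
  have hsub : SS B 5 ⊆ SA B := fun f hf => ⟨5, hf⟩
  have hopen0 : SS B 5 ∈ nhds (sqMap B 5 p0) := open_of_surj B hsym p0 hp0
  have hint0 : sqMap B 5 p0 ∈ interior (SA B) :=
    mem_interior_iff_mem_nhds.2 (Filter.mem_of_superset hopen0 hsub)
  have hopen : ∀ p, Good p → sqMap B 5 p ∈ interior (SA B) → SS B 5 ∈ nhds (sqMap B 5 p) := by
    intro p hp hinn
    by_cases hs : ∀ a, ∃ h : Fin 5 → E, a = ∑ i, B (p i) (h i)
    · exact open_of_surj B hsym p hs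
    · let M : (Fin 5 → E) →ₗ[ℝ] F := ∑ i, (B (p i)).toLinearMap ∘ₗ LinearMap.proj i
      have hM : ∀ h, M h = ∑ i, B (p i) (h i) := by
        intro h
        simp [M]
      have hlt : LinearMap.range M < ⊤ := by
        rw [lt_top_iff_ne_top]
        intro htop
        apply hs
        intro a
        obtain ⟨h, hh⟩ := LinearMap.range_eq_top.1 htop a
        exact ⟨h, by rw [← hM, hh]⟩
      obtain ⟨L, hL0, hL⟩ := Submodule.exists_le_ker_of_lt_top _ hlt
      have hLp : ∀ i h, L (B (p i) h) = 0 := by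
        intro i h
        have : B (p i) h = M (Pi.single i h) := by
          rw [hM, Finset.sum_eq_single i]
          · simp
          · intro j _ hj
            simp [hj]
          · simp
        rw [this]
        exact hL ⟨_, rfl⟩
      obtain ⟨hu, hk⟩ := hGood p hp L hL0 hLp
      exact open_of_hyper B hsym p L hL0 hLp hu hk hinn
  refine ⟨⟨_, hint0⟩, ?_⟩
  set f0 := sqMap B 5 p0 with hf0
  have hconv := (SA_convex B).interior
  have hinn : interior (SA B) ⊆ SS B 5 := by
    have hdense := (hD f0).open_subset_closure_inter (isOpen_interior (s := SA B))
    refine hdense.trans (closure_minimal ?_ hcl)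
    rintro g ⟨hg, hgD⟩
    have hcont : Continuous fun t : ℝ => f0 + t • (g - f0) := by fun_prop
    have hmain : Set.Icc (0 : ℝ) 1 ⊆ {t : ℝ | f0 + t • (g - f0) ∈ SS B 5} := by
      refine IsClosed.Icc_subset_of_forall_mem_nhdsWithin ?_ ?_ ?_
      · exact (hcl.preimage hcont).inter isClosed_Icc
      · simp only [Set.mem_ofPred_eq, zero_smul, add_zero]
        exact ⟨p0, rfl⟩
      · rintro t ⟨ht, ht0, ht1⟩
        refine mem_nhdsWithin_of_mem_nhds ?_
        have hn : SS B 5 ∈ nhds (f0 + t • (g - f0)) := by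
          rcases ht0.eq_or_lt with rfl | hpos
          · simpa using hopen0
          · obtain ⟨p, hp⟩ := ht
            have hin : f0 + t • (g - f0) ∈ interior (SA B) :=
              hconv.add_smul_sub_mem hint0 hg ⟨ht0, ht1.le⟩
            rw [← hp] at hin ⊢
            exact hopen p (hgD t hpos p hp hin) hin
        exact hcont.continuousAt hn
    have := hmain (Set.right_mem_Icc.2 zero_le_one)
    simpa using this
  have h1 : SA B ⊆ closure (interior (SA B)) := by
    rw [(SA_convex B).closure_interior_eq_closure_of_nonempty_interior ⟨_, hint0⟩]
    exact subset_closure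
  exact h1.trans (closure_minimal hinn hcl)

end Abstract2

section Coordinates

/-- Exponents of degree `d`. -/
abbrev TT (d : ℕ) := {m : Fin 4 →₀ ℕ // m ∈ Finset.finsuppAntidiag (Finset.univ : Finset (Fin 4)) d}

/-- Coordinate space of the forms of degree `d`. -/
abbrev NN (d : ℕ) := TT d → ℝ

lemma mem_TT {d : ℕ} {m : Fin 4 →₀ ℕ} :
    m ∈ Finset.finsuppAntidiag (Finset.univ : Finset (Fin 4)) d ↔ m.degree = d := by
  simp [Finsupp.degree_eq_sum]

lemma finrank_NN (d : ℕ) : Module.finrank ℝ (NN d) = (4 + d - 1).choose d := by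
  rw [Module.finrank_fintype_fun_eq_card, Fintype.card_coe,
    Finset.card_finsuppAntidiag_nat_eq_choose]
  simp

/-- Coefficients in degree `d`. -/
def toN (d : ℕ) : R4 →ₗ[ℝ] NN d := LinearMap.pi fun m => lcoeff ℝ m.1

lemma toN_apply (d : ℕ) (f : R4) (m : TT d) : toN d f m = coeff m.1 f := rfl

/-- The form with given coefficients. -/
def toP (d : ℕ) : NN d →ₗ[ℝ] R4 := ∑ m : TT d, (monomial m.1) ∘ₗ LinearMap.proj m

lemma toP_apply (d : ℕ) (u : NN d) : toP d u = ∑ m : TT d, monomial m.1 (u m) := by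
  simp [toP]

lemma toP_hom (d : ℕ) (u : NN d) : (toP d u).IsHomogeneous d := by
  rw [toP_apply]
  exact IsHomogeneous.sum _ _ _ fun m _ => isHomogeneous_monomial _ (mem_TT.1 m.2)

lemma coeff_toP (d : ℕ) (u : NN d) (m : Fin 4 →₀ ℕ) : coeff m (toP d u) =
    if h : m ∈ Finset.finsuppAntidiag (Finset.univ : Finset (Fin 4)) d then u ⟨m, h⟩ else 0 := by
  rw [toP_apply, coeff_sum]
  simp only [coeff_monomial]
  split_ifs with h
  · rw [Finset.sum_eq_single ⟨m, h⟩]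
    · simp
    · intro b _ hb
      rw [if_neg]
      rintro rfl
      exact hb rfl
    · simp
  · refine Finset.sum_eq_zero fun b _ => ?_
    rw [if_neg]
    rintro rfl
    exact h b.2

lemma toN_toP (d : ℕ) (u : NN d) : toN d (toP d u) = u := by
  ext m
  rw [toN_apply, coeff_toP, dif_pos m.2]

lemma toP_toN (d : ℕ) {f : R4} (hf : f.IsHomogeneous d) : toP d (toN d f) = f := by
  ext m
  rw [coeff_toP]
  split_ifs with h
  · rfl
  · exact (hf.coeff_eq_zero fun e => h (mem_TT.2 e)).symm

/-- Multiplication of quadratic forms in coordinates. -/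
def BB : NN 2 →L[ℝ] NN 2 →L[ℝ] NN 4 :=
  LinearMap.toContinuousBilinearMap
    (((LinearMap.mul ℝ R4).compl₁₂ (toP 2) (toP 2)).compr₂ (toN 4))

lemma BB_apply (u v : NN 2) : BB u v = toN 4 (toP 2 u * toP 2 v) := rfl

lemma BB_symm (u v : NN 2) : BB u v = BB v u := by
  rw [BB_apply, BB_apply, mul_comm]

lemma toP_BB (u v : NN 2) : toP 4 (BB u v) = toP 2 u * toP 2 v := by
  rw [BB_apply, toP_toN]
  exact (toP_hom 2 u).mul (toP_hom 2 v)

lemma toP_sqMap (r : ℕ) (p : Fin r → NN 2) : toP 4 (sqMap BB r p) = ∑ i, toP 2 (p i) ^ 2 := by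
  simp [sqMap, toP_BB, pow_two]

lemma toP_inj {d : ℕ} {u v : NN d} (h : toP d u = toP d v) : u = v := by
  rw [← toN_toP d u, h, toN_toP]

lemma sqMap_zero (r : ℕ) (p : Fin r → NN 2) (h : sqMap BB r p = 0) : p = 0 := by
  have h1 : ∑ i, toP 2 (p i) ^ 2 = 0 := by rw [← toP_sqMap, h, map_zero]
  ext1 i
  refine toP_inj (d := 2) ?_
  rw [Pi.zero_apply, map_zero]
  refine MvPolynomial.funext fun x => ?_
  have h2 := congrArg (eval x) h1
  simp only [map_sum, map_pow, map_zero] at h2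
  have h3 := (Finset.sum_eq_zero_iff_of_nonneg (fun i _ => sq_nonneg _)).1 h2 i (Finset.mem_univ _)
  simpa using h3

lemma isSOS_iff (r : ℕ) {f : R4} (hf : f.IsHomogeneous 4) : IsSOS 4 2 r f ↔ toN 4 f ∈ SS BB r := by
  constructor
  · rintro ⟨p, hp, rfl⟩
    refine ⟨fun i => toN 2 (p i), toP_inj ?_⟩
    rw [toP_sqMap, toP_toN 4 hf]
    simp only [toP_toN 2 (hp _)]
  · rintro ⟨p, hp⟩
    refine ⟨fun i => toP 2 (p i), fun i => toP_hom 2 _, ?_⟩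
    rw [← toP_sqMap, hp, toP_toN 4 hf]

lemma inSigma_iff {f : R4} (hf : f.IsHomogeneous 4) : InSigma 4 2 f ↔ toN 4 f ∈ SA BB :=
  exists_congr fun r => isSOS_iff r hf

/-- The coordinates on quartics, as a homeomorphism. -/
def homeo4 : homogeneousSubmodule (Fin 4) ℝ 4 ≃ₜ NN 4 where
  toFun f := toN 4 f
  invFun u := ⟨toP 4 u, toP_hom 4 u⟩
  left_inv f := Subtype.ext (toP_toN 4 f.2)
  right_inv u := toN_toP 4 u
  continuous_toFun := by
    refine continuous_pi fun m => ?_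
    have h1 : Continuous fun f : R4 => fun m => coeff m f := continuous_induced_dom
    exact ((continuous_apply m.1).comp h1).comp continuous_subtype_val
  continuous_invFun := by
    refine Continuous.subtype_mk (continuous_induced_rng.2 (continuous_pi fun m => ?_)) _
    simp only [Function.comp_apply, coeff_toP]
    split_ifs with h
    · exact continuous_apply _
    · exact continuous_const

lemma good_alg (p : Fin 5 → NN 2)
    (hz : ∀ z : Fin 4 → ℂ, (∀ i, aeval z (toP 2 (p i)) = 0) → z = 0)
    (L : NN 4 →ₗ[ℝ] ℝ) (hL0 : L ≠ 0) (hL : ∀ i h, L (BB (p i) h) = 0) :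
    (∃ u : Fin 5 → ℝ, u ≠ 0 ∧ ∑ i, u i • p i = 0) ∧
      ∀ a, L a = 0 → ∃ h : Fin 5 → NN 2, a = ∑ i, BB (p i) (h i) := by
  obtain ⟨x, hx⟩ := DFunLike.ne_iff.1 hL0
  obtain ⟨⟨u, hu, hup⟩, h2⟩ := alg_five (fun i => toP 2 (p i)) (fun i => toP_hom 2 _) hz
    (L ∘ₗ toN 4) (by
      intro i r hr
      have := hL i (toN 2 r)
      rw [BB_apply, toP_toN 2 hr] at this
      exact this) (toP 4 x) (toP_hom 4 x) (by simpa [toN_toP] using hx)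
  constructor
  · refine ⟨u, hu, toP_inj (d := 2) ?_⟩
    simpa using hup
  · intro a ha
    obtain ⟨h, hh, hs⟩ := h2 (toP 4 a) (toP_hom 4 a) (by simpa [toN_toP] using ha)
    refine ⟨fun i => toN 2 (h i), toP_inj (d := 4) ?_⟩
    rw [hs, map_sum]
    simp only [toP_BB, toP_toN 2 (hh _)]

/-- The starting tuple. -/
def start : Fin 5 → R4 := ![X 0 ^ 2, X 1 ^ 2, X 2 ^ 2, X 3 ^ 2, X 0 * X 1 + X 2 * X 3]

lemma start_hom (i : Fin 5) : (start i).IsHomogeneous 2 := by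
  have h1 : ∀ k : Fin 4, (X k ^ 2 : R4).IsHomogeneous 2 := fun k => (isHomogeneous_X ℝ k).pow 2
  have h2 : ∀ k l : Fin 4, (X k * X l : R4).IsHomogeneous 2 := fun k l =>
    (isHomogeneous_X ℝ k).mul (isHomogeneous_X ℝ l)
  fin_cases i
  exacts [h1 0, h1 1, h1 2, h1 3, (h2 0 1).add (h2 2 3)]

lemma start_surj (a : NN 4) : ∃ h : Fin 5 → NN 2, a = ∑ i, BB (toN 2 (start i)) (h i) := by
  let M : (Fin 5 → NN 2) →ₗ[ℝ] NN 4 :=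
    ∑ i, (BB (toN 2 (start i))).toLinearMap ∘ₗ LinearMap.proj i
  have hM : ∀ h, M h = ∑ i, BB (toN 2 (start i)) (h i) := by
    intro h
    simp [M]
  have hS : ∀ i (r : R4), r.IsHomogeneous 2 → toN 4 (start i * r) ∈ LinearMap.range M := by
    intro i r hr
    refine ⟨Pi.single i (toN 2 r), ?_⟩
    rw [hM, Finset.sum_eq_single i]
    · simp [BB_apply, toP_toN 2 (start_hom i), toP_toN 2 hr]
    · intro j _ hj
      simp [hj]
    · simp
  have hmon : ∀ m : TT 4, toN 4 (monomial m.1 1) ∈ LinearMap.range M := by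
    rintro ⟨m, hm⟩
    have hdeg := mem_TT.1 hm
    have hk : ∀ k : Fin 4, 2 ≤ m k → ∃ r : R4, r.IsHomogeneous 2 ∧ monomial m 1 = X k ^ 2 * r := by
      intro k hk
      have hle : Finsupp.single k 2 ≤ m := Finsupp.single_le_iff.2 hk
      have hadd : m = Finsupp.single k 2 + (m - Finsupp.single k 2) :=
        (add_tsub_cancel_of_le hle).symm
      refine ⟨monomial (m - Finsupp.single k 2) 1, isHomogeneous_monomial _ ?_, ?_⟩
      · have := congrArg Finsupp.degree hadd
        rw [map_add, Finsupp.degree_single, hdeg] at this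
        omega
      · rw [X_pow_eq_monomial, monomial_mul, ← hadd, one_mul]
    by_cases h : ∃ k, 2 ≤ m k
    · obtain ⟨k, hk2⟩ := h
      obtain ⟨r, hr, he⟩ := hk k hk2
      simp only [he]
      fin_cases k
      exacts [hS 0 r hr, hS 1 r hr, hS 2 r hr, hS 3 r hr]
    · push Not at h
      have h11 : ∀ k, m k = 1 := by
        rw [Finsupp.degree_eq_sum, Fin.sum_univ_four] at hdeg
        have := h 0
        have := h 1
        have := h 2
        have := h 3
        intro k
        fin_cases k <;> simp <;> omega
      have he : (monomial m 1 : R4) = start 4 * (X 0 * X 1) - start 0 * (X 1 ^ 2) := by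
        have : (monomial m 1 : R4) = X 0 * X 1 * X 2 * X 3 := by
          rw [monomial_eq, Finsupp.prod_fintype _ _ (by simp), Fin.prod_univ_four]
          simp [h11]
        rw [this]
        simp only [start, Matrix.cons_val]
        ring
      simp only [he, map_sub]
      exact Submodule.sub_mem _ (hS 4 _ ((isHomogeneous_X ℝ 0).mul (isHomogeneous_X ℝ 1)))
        (hS 0 _ ((isHomogeneous_X ℝ 1).pow 2))
  have ha : a ∈ LinearMap.range M := by
    rw [← toN_toP 4 a, toP_apply, map_sum]
    refine Submodule.sum_mem _ fun m _ => ?_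
    have : (monomial m.1 (a m) : R4) = a m • monomial m.1 1 := by
      rw [smul_monomial, smul_eq_mul, mul_one]
    rw [this, map_smul]
    exact Submodule.smul_mem _ _ (hmon m)
  obtain ⟨h, hh⟩ := ha
  exact ⟨h, by rw [← hM, hh]⟩

end Coordinates

section BadSet

/-- The base point. -/
def w0 : Fin 4 → ℂ := ![1, Complex.I, 0, 0]

/-- The gradient at the base point. -/
def Phi : NN 4 →ₗ[ℝ] (Fin 4 → ℂ) :=
  LinearMap.pi fun k => (aeval w0 : R4 →ₐ[ℝ] ℂ).toLinearMap ∘ₗ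
    (pderiv k : Derivation ℝ R4 R4).toLinearMap ∘ₗ toP 4

lemma Phi_apply (u : NN 4) (k : Fin 4) : Phi u k = aeval w0 (pderiv k (toP 4 u)) := rfl

lemma Phi_surj : Function.Surjective Phi := by
  intro y
  have hX : ∀ k : Fin 4, (X k : R4).IsHomogeneous 1 := fun k => isHomogeneous_X ℝ k
  have hC : ∀ (t : ℝ) (b : R4), b.IsHomogeneous 4 → (C t * b).IsHomogeneous 4 := by
    intro t b hb
    simpa using (isHomogeneous_C (Fin 4) t).mul hb
  let f : R4 := C ((y 0).re / 4) * (X 0 * X 0 * X 0 * X 0)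
    + C ((y 0).im / 8) * (C 3 * (X 0 * X 0 * X 0 * X 1) + X 0 * X 1 * X 1 * X 1)
    + C (-(y 1).im / 4) * (X 1 * X 1 * X 1 * X 1)
    + C (-(y 1).re / 8) * (X 0 * X 0 * X 0 * X 1 + C 3 * (X 0 * X 1 * X 1 * X 1))
    + C (y 2).re * (X 0 * X 0 * X 0 * X 2) + C (y 2).im * (X 0 * X 0 * X 1 * X 2)
    + C (y 3).re * (X 0 * X 0 * X 0 * X 3) + C (y 3).im * (X 0 * X 0 * X 1 * X 3)
  have h4 : ∀ i j k l : Fin 4, (X i * X j * X k * X l : R4).IsHomogeneous 4 := fun i j k l =>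
    (((hX i).mul (hX j)).mul (hX k)).mul (hX l)
  have hf : f.IsHomogeneous 4 := by
    refine IsHomogeneous.add (IsHomogeneous.add (IsHomogeneous.add (IsHomogeneous.add
      (IsHomogeneous.add (IsHomogeneous.add (IsHomogeneous.add ?_ ?_) ?_) ?_) ?_) ?_) ?_) ?_
    · exact hC _ _ (h4 _ _ _ _)
    · exact hC _ _ ((hC _ _ (h4 _ _ _ _)).add (h4 _ _ _ _))
    · exact hC _ _ (h4 _ _ _ _)
    · exact hC _ _ ((h4 _ _ _ _).add (hC _ _ (h4 _ _ _ _)))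
    all_goals exact hC _ _ (h4 _ _ _ _)
  refine ⟨toN 4 f, ?_⟩
  ext k
  rw [Phi_apply, toP_toN 4 hf]
  have hI := Complex.I_mul_I
  fin_cases k
  all_goals
    simp [f, w0, Derivation.leibniz, pderiv_X]
    try (apply Complex.ext <;> simp <;> ring)

/-- The change of variables. -/
def chg (s : Equiv.Perm (Fin 4)) (θ : Fin 6 → ℝ) : Fin 4 → R4 :=
  ![X (s 0), C (θ 0) * X (s 0) + C (θ 1) * X (s 1),
    C (θ 2) * X (s 0) + C (θ 3) * X (s 1) + X (s 2),
    C (θ 4) * X (s 0) + C (θ 5) * X (s 1) + X (s 3)]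

lemma coeff_contDiff {Y : Type*} [NormedAddCommGroup Y] [NormedSpace ℝ Y] (y : Y → Fin 4 → R4)
    (hy : ∀ i m, ContDiff ℝ 1 fun x => coeff m (y x i)) (b : R4) :
    ∀ m, ContDiff ℝ 1 fun x => coeff m (aeval (y x) b) := by
  induction b using MvPolynomial.induction_on with
  | C a => intro m; simp [algebraMap_eq]; exact contDiff_const
  | add p q hp hq =>
    intro m
    simp only [map_add, coeff_add]
    exact (hp m).add (hq m)
  | mul_X p i hp =>
    intro m
    simp only [map_mul, aeval_X, coeff_mul]
    exact ContDiff.sum fun k _ => (hp _).mul (hy i _)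

lemma chg_contDiff (s : Equiv.Perm (Fin 4)) (i : Fin 4) (m : Fin 4 →₀ ℕ) :
    ContDiff ℝ 1 fun θ => coeff m (chg s θ i) := by
  fin_cases i <;> simp [chg, coeff_C_mul] <;> fun_prop

lemma smul_zero_of_hom {d : ℕ} (u : NN d) (c : ℂ) (z : Fin 4 → ℂ) :
    aeval (fun j => c * z j) (toP d u) = c ^ d * aeval z (toP d u) := by
  rw [toP_apply, map_sum, map_sum, Finset.mul_sum]
  refine Finset.sum_congr rfl fun m _ => ?_
  rw [aeval_monomial, aeval_monomial, Finsupp.prod_fintype _ _ (by simp),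
    Finsupp.prod_fintype _ _ (by simp)]
  simp only [mul_pow, Finset.prod_mul_distrib, Finset.prod_pow_eq_pow_sum]
  rw [← Finsupp.degree_eq_sum, mem_TT.1 m.2]
  ring

lemma perm_exists : ∀ i j : Fin 4, i ≠ j → ∃ s : Equiv.Perm (Fin 4), s 0 = i ∧ s 1 = j := by
  decide

lemma aeval_chg (s : Equiv.Perm (Fin 4)) (g : Fin 6 → ℝ) {A : Type*} [CommRing A] [Algebra ℝ A]
    (v : Fin 4 → A) (i : Fin 4) : aeval v (chg s g i) = ![v (s 0), 
      algebraMap ℝ A (g 0) * v (s 0) + algebraMap ℝ A (g 1) * v (s 1),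
      algebraMap ℝ A (g 2) * v (s 0) + algebraMap ℝ A (g 3) * v (s 1) + v (s 2),
      algebraMap ℝ A (g 4) * v (s 0) + algebraMap ℝ A (g 5) * v (s 1) + v (s 3)] i := by
  fin_cases i <;> simp [chg]

lemma aeval_two {A : Type*} [CommRing A] [Algebra ℝ A] (v : Fin 4 → A) (b : Fin 4 → R4)
    (y : Fin 4 → A) (h : ∀ j, aeval v (b j) = y j) (f : R4) :
    aeval v (aeval b f) = aeval y f := by
  rw [← AlgHom.comp_apply, comp_aeval]
  simp only [h]

lemma bad_param (p : Fin 5 → NN 2) (hinn : sqMap BB 5 p ∈ interior (SA BB)) (z : Fin 4 → ℂ)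
    (hz0 : z ≠ 0) (hz : ∀ i, aeval z (toP 2 (p i)) = 0) :
    ∃ (s : Equiv.Perm (Fin 4)) (θ : Fin 6 → ℝ) (u : LinearMap.ker Phi),
      sqMap BB 5 p = toN 4 (aeval (chg s θ) (toP 4 u.1)) := by
  obtain ⟨j0, hj0⟩ := Function.ne_iff.1 hz0
  replace hj0 : z j0 ≠ 0 := hj0
  -- normalise
  obtain ⟨y, hy1, hy⟩ : ∃ y : Fin 4 → ℂ, y j0 = 1 ∧ ∀ i, aeval y (toP 2 (p i)) = 0 := by
    refine ⟨fun j => (z j0)⁻¹ * z j, inv_mul_cancel₀ hj0, fun i => ?_⟩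
    rw [smul_zero_of_hom, hz i, mul_zero]
  -- the zero is not real
  obtain ⟨j1, hj1⟩ : ∃ j1, (y j1).im ≠ 0 := by
    by_contra hcon
    push Not at hcon
    let x : Fin 4 → ℝ := fun j => (y j).re
    have hyx : y = algebraMap ℝ ℂ ∘ x := by
      ext j
      apply Complex.ext <;> simp [x, hcon]
    have hx : ∀ i, eval x (toP 2 (p i)) = 0 := by
      intro i
      have := hy i
      rw [hyx, aeval_algebraMap_apply] at this
      simpa [aeval_eq_eval] using this
    let q : NN 4 := toN 4 (X j0 ^ 4)
    have hq : toP 4 q = X j0 ^ 4 := toP_toN 4 ((isHomogeneous_X ℝ j0).pow 4)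
    have hev : ∀ᶠ t : ℝ in nhds 0, sqMap BB 5 p + t • q ∈ SA BB := by
      have hcont : Continuous fun t : ℝ => sqMap BB 5 p + t • q := by fun_prop
      have := hcont.tendsto 0
      simp only [zero_smul, add_zero] at this
      exact this (mem_interior_iff_mem_nhds.1 hinn)
    obtain ⟨δ, hδ, hball⟩ := Metric.eventually_nhds_iff.1 hev
    obtain ⟨r, v, hv⟩ := hball (y := -(δ / 2)) (by simp [abs_of_pos hδ]; linarith)
    have h1 := congrArg (fun a => eval x (toP 4 a)) hv
    simp only [map_add, map_smul, toP_sqMap, hq, map_sum, map_pow, hx, smul_eval, eval_X] at h1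
    have h2 : 0 ≤ ∑ i, eval x (toP 2 (v i)) ^ 2 := Finset.sum_nonneg fun i _ => sq_nonneg _
    rw [h1] at h2
    simp [x, hy1] at h2
    linarith
  have hne : j0 ≠ j1 := by
    rintro rfl
    simp [hy1] at hj1
  obtain ⟨s, hs0, hs1⟩ := perm_exists j0 j1 hne
  let g : Fin 6 → ℝ := ![(y (s 1)).re, (y (s 1)).im, (y (s 2)).re, (y (s 2)).im,
    (y (s 3)).re, (y (s 3)).im]
  have ht : (y (s 1)).im ≠ 0 := by rw [hs1]; exact hj1
  let s' : ℝ := -(y (s 1)).re / (y (s 1)).im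
  let t' : ℝ := 1 / (y (s 1)).im
  let θ : Fin 6 → ℝ := ![s', t', -(y (s 2)).re - (y (s 2)).im * s', -((y (s 2)).im * t'),
    -(y (s 3)).re - (y (s 3)).im * s', -((y (s 3)).im * t')]
  let back : Fin 4 → R4 := fun j => chg 1 g (s.symm j)
  have hback : ∀ j, aeval w0 (back j) = y j := by
    intro j
    obtain ⟨k, rfl⟩ := s.surjective j
    simp only [back, Equiv.symm_apply_apply]
    rw [aeval_chg]
    fin_cases k
    · simp [w0, hs0, hy1]
    all_goals
      simp [w0, g, Complex.re_add_im]
  have hinv : ∀ j, aeval (chg s θ) (back j) = X j := by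
    intro j
    obtain ⟨k, rfl⟩ := s.surjective j
    simp only [back, Equiv.symm_apply_apply]
    rw [aeval_chg]
    have c1 : (C (y (s 1)).re + C (y (s 1)).im * C s' : R4) = 0 := by
      rw [← C_mul, ← C_add]
      simp only [s']
      field_simp
      simp
    have c2 : (C (y (s 1)).im * C t' : R4) = 1 := by
      rw [← C_mul]
      simp only [t']
      field_simp
      simp
    fin_cases k
    · simp [chg]
    · simp [chg, g, θ, algebraMap_eq]
      linear_combination c1 * X (s 0) + c2 * X (s 1)
    · simp [chg, g, θ, algebraMap_eq]
      ring
    · simp [chg, g, θ, algebraMap_eq]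
      ring
  have hbhom : ∀ j, (back j).IsHomogeneous 1 := by
    intro j
    have hX : ∀ k : Fin 4, (X k : R4).IsHomogeneous 1 := fun k => isHomogeneous_X ℝ k
    have hC : ∀ (t : ℝ) (k : Fin 4), (C t * X k : R4).IsHomogeneous 1 := by
      intro t k
      simpa using (isHomogeneous_C (Fin 4) t).mul (hX k)
    simp only [back]
    generalize s.symm j = k
    fin_cases k
    · exact hX _
    · exact (hC _ _).add (hC _ _)
    · exact ((hC _ _).add (hC _ _)).add (hX _)
    · exact ((hC _ _).add (hC _ _)).add (hX _)
  let f : R4 := toP 4 (sqMap BB 5 p)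
  have hf : f.IsHomogeneous 4 := toP_hom 4 _
  let h : R4 := aeval back f
  have hh : h.IsHomogeneous 4 := by
    have := hf.aeval back hbhom
    rwa [one_mul] at this
  have hcomp : aeval (chg s θ) h = f := by
    have := aeval_two (chg s θ) back X hinv f
    rwa [aeval_X_left_apply] at this
  have hker : toN 4 h ∈ LinearMap.ker Phi := by
    rw [LinearMap.mem_ker]
    ext k
    rw [Phi_apply, toP_toN 4 hh]
    have hsum : h = ∑ i, (aeval back (toP 2 (p i))) ^ 2 := by
      simp only [h, f, toP_sqMap, map_sum, map_pow]
    have hzero : ∀ i, aeval w0 (aeval back (toP 2 (p i))) = 0 := by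
      intro i
      rw [aeval_two w0 back y hback]
      exact hy i
    rw [hsum]
    generalize hc : (fun i => aeval back (toP 2 (p i))) = c at *
    have hc' : ∀ i, aeval back (toP 2 (p i)) = c i := fun i => congrFun hc i
    simp only [hc'] at hzero ⊢
    simp [map_sum, Derivation.leibniz_pow, hzero]
  refine ⟨s, θ, ⟨toN 4 h, hker⟩, ?_⟩
  rw [toP_toN 4 hh, hcomp, toN_toP]

lemma finrank_ker_Phi : Module.finrank ℝ (LinearMap.ker Phi) = 27 := by
  have h1 := LinearMap.finrank_range_add_finrank_ker Phi
  rw [LinearMap.range_eq_top.2 Phi_surj, finrank_top, finrank_NN] at h1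
  have h2 : Module.finrank ℝ (Fin 4 → ℂ) = 8 := by
    rw [Module.finrank_pi_fintype]
    simp [Complex.finrank_real_complex]
  rw [h2] at h1
  have h3 : (4 + 4 - 1).choose 4 = 35 := by decide
  omega

/-- The cone over the bad set. -/
def coneMap (f0 : NN 4) (s : Equiv.Perm (Fin 4)) (x : (Fin 6 → ℝ) × LinearMap.ker Phi × ℝ) : NN 4 :=
  f0 + x.2.2 • (toN 4 (aeval (chg s x.1) (toP 4 x.2.1.1)) - f0)

lemma coneMap_contDiff (f0 : NN 4) (s : Equiv.Perm (Fin 4)) : ContDiff ℝ 1 (coneMap f0 s) := by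
  refine contDiff_const.add ((contDiff_snd.comp contDiff_snd).smul (ContDiff.sub ?_ contDiff_const))
  refine contDiff_pi.2 fun m => ?_
  have he : ∀ x : (Fin 6 → ℝ) × LinearMap.ker Phi × ℝ,
      toN 4 (aeval (chg s x.1) (toP 4 x.2.1.1)) m =
      ∑ k : TT 4, x.2.1.1 k * coeff m.1 (aeval (chg s x.1) (monomial k.1 (1 : ℝ))) := by
    intro x
    rw [toN_apply, toP_apply, map_sum, coeff_sum]
    refine Finset.sum_congr rfl fun k _ => ?_
    have : (monomial k.1 (x.2.1.1 k) : R4) = x.2.1.1 k • monomial k.1 1 := by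
      rw [smul_monomial, smul_eq_mul, mul_one]
    rw [this, map_smul, coeff_smul, smul_eq_mul]
  simp only [he]
  refine ContDiff.sum fun k _ => ContDiff.mul ?_ ?_
  · have h1 : ContDiff ℝ 1 fun u : LinearMap.ker Phi => u.1 k :=
      (contDiff_apply ℝ ℝ k).comp (LinearMap.ker Phi).subtypeL.contDiff
    exact h1.comp (contDiff_fst.comp contDiff_snd)
  · exact (coeff_contDiff (fun θ => chg s θ) (chg_contDiff s) _ m.1).comp contDiff_fst

lemma bad_dense (f0 : NN 4) : Dense {g : NN 4 | ∀ t : ℝ, 0 < t → ∀ p : Fin 5 → NN 2,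
    sqMap BB 5 p = f0 + t • (g - f0) → sqMap BB 5 p ∈ interior (SA BB) →
    ∀ z : Fin 4 → ℂ, (∀ i, aeval z (toP 2 (p i)) = 0) → z = 0} := by
  have hdim : dimH (⋃ s, Set.range (coneMap f0 s)) < (Module.finrank ℝ (NN 4) : ENNReal) := by
    rw [dimH_iUnion, finrank_NN]
    refine lt_of_le_of_lt (b := ((34 : ℕ) : ENNReal)) (iSup_le fun s => ?_) ?_
    · refine (coneMap_contDiff f0 s).dimH_range_le.trans ?_
      rw [Module.finrank_prod, Module.finrank_prod, finrank_ker_Phi]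
      simp
    · have h3 : (4 + 4 - 1).choose 4 = 35 := by decide
      rw [h3]
      exact_mod_cast (by norm_num : 34 < 35)
  refine (dense_compl_of_dimH_lt_finrank hdim).mono ?_
  intro g hg t ht p hp hinn z hz
  by_contra hz0
  obtain ⟨s, θ, u, he⟩ := bad_param p hinn z hz0 hz
  refine hg (Set.mem_iUnion.2 ⟨s, (θ, u, t⁻¹), ?_⟩)
  simp only [coneMap]
  rw [← he, hp, add_sub_cancel_left, smul_smul, inv_mul_cancel₀ ht.ne']
  simp

end BadSet

lemma sigma_main : (interior (SA BB)).Nonempty ∧ SA BB ⊆ SS BB 5 :=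
  main_abs BB BB_symm (sqMap_zero 5)
    (fun p => ∀ z : Fin 4 → ℂ, (∀ i, aeval z (toP 2 (p i)) = 0) → z = 0)
    (fun p hp L hL0 hL => good_alg p hp L hL0 hL) (fun i => toN 2 (start i)) start_surj bad_dense

lemma length_iff {f : R4} (hf : f.IsHomogeneous 4) (hS : toN 4 f ∈ SA BB) :
    sosLength 4 2 f = 5 ↔ toN 4 f ∉ SS BB 4 := by
  have h5 : toN 4 f ∈ SS BB 5 := sigma_main.2 hS
  have he : sosLength 4 2 f = sInf {r | toN 4 f ∈ SS BB r} := by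
    unfold sosLength
    congr 1
    ext r
    exact isSOS_iff r hf
  rw [he]
  constructor
  · intro h h4
    have := Nat.sInf_le (s := {r | toN 4 f ∈ SS BB r}) h4
    omega
  · intro h4
    refine le_antisymm (Nat.sInf_le h5) ?_
    by_contra hlt
    push Not at hlt
    have hmem := Nat.sInf_mem (s := {r | toN 4 f ∈ SS BB r}) ⟨5, h5⟩
    exact h4 (SS_mono BB (by omega) hmem)

/-- The set of sums of squares of quaternary quartics of sos length exactly `5`
is open and dense in `Σ_{4,4}` (with the subspace topology from `ℝ[x₁,…,x₄]₄`). -/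
theorem length_five_open_dense_in_sigma44 :
    IsOpen {g : SigmaSet44 | sosLength 4 2 ((g : MvPolynomial.homogeneousSubmodule (Fin 4) ℝ 4) : MvPolynomial (Fin 4) ℝ) = 5} ∧
    Dense {g : SigmaSet44 | sosLength 4 2 ((g : MvPolynomial.homogeneousSubmodule (Fin 4) ℝ 4) : MvPolynomial (Fin 4) ℝ) = 5} := by
  have hcl4 : IsClosed (SS BB 4) := SS_closed BB 4 (sqMap_zero 4)
  have hset : {g : SigmaSet44 | sosLength 4 2 ((g : MvPolynomial.homogeneousSubmodule (Fin 4) ℝ 4) : MvPolynomial (Fin 4) ℝ) = 5}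
      = (fun g : SigmaSet44 => homeo4 g.1) ⁻¹' (SS BB 4)ᶜ := by
    ext g
    exact length_iff g.1.2 ((inSigma_iff g.1.2).1 g.2)
  have hcont : Continuous (fun g : SigmaSet44 => homeo4 g.1) :=
    homeo4.continuous.comp continuous_subtype_val
  rw [hset]
  refine ⟨hcl4.isOpen_compl.preimage hcont, ?_⟩
  have hthin : Dense (SS BB 4)ᶜ := thin_four BB (by rw [finrank_NN]; decide)
    (by rw [finrank_NN]; decide)
  have hclos : SA BB ⊆ closure (interior (SA BB)) := by
    rw [(SA_convex BB).closure_interior_eq_closure_of_nonempty_interior sigma_main.1]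
    exact subset_closure
  intro g
  rw [mem_closure_iff]
  intro U hU hgU
  obtain ⟨V, hV, rfl⟩ := isOpen_induced_iff.1 hU
  have hV' : IsOpen (homeo4.symm ⁻¹' V) := hV.preimage homeo4.symm.continuous
  have hgS : homeo4 g.1 ∈ SA BB := (inSigma_iff g.1.2).1 g.2
  obtain ⟨y, hyV, hyi⟩ := mem_closure_iff.1 (hclos hgS) _ hV' (by simpa using hgU)
  obtain ⟨x, ⟨hxV, hxi⟩, hx4⟩ := hthin.inter_open_nonempty _ (hV'.inter isOpen_interior) ⟨y, hyV, hyi⟩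
  have hxS : homeo4.symm x ∈ SigmaSet44 := by
    refine (inSigma_iff (homeo4.symm x).2).2 ?_
    have : toN 4 (homeo4.symm x).1 = x := homeo4.apply_symm_apply x
    rw [this]
    exact interior_subset hxi
  refine ⟨⟨homeo4.symm x, hxS⟩, hxV, ?_⟩
  simpa using hx4
end
end

section
/- Let k be a field of characteristic zero and let p_1, …, p_r ∈ k[x_1,x_2,x_3] be linearly independent homogeneous polynomials of degree 3 such that the ideal ⟨p_1,…,p_r⟩ does not contain the ideal ⟨x_1,x_2,x_3⟩⁶ (equivalently, some monomial of degree 6 lies outside ⟨p_1,…,p_r⟩). If r ≠ 3, then p_1, …, p_r have a common nontrivial zero in the algebraic closure of k; that is, there exists 0 ≠ ξ ∈ (k̄)³ with p_i(ξ) = 0 for all i = 1, …, r. -/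
open MvPolynomial

namespace CubicsAux

section Koszul
variable {R : Type*} [CommRing R] [IsDomain R]

/-- Weakly regular sequence of length two in a domain. -/
def Reg2 (f1 f2 : R) : Prop :=
  f1 ≠ 0 ∧ ∀ g, f2 * g ∈ Ideal.span {f1} → g ∈ Ideal.span {f1}

/-- Weakly regular sequence of length three in a domain. -/
def Reg3 (f1 f2 f3 : R) : Prop :=
  Reg2 f1 f2 ∧ ∀ g, f3 * g ∈ Ideal.span {f1, f2} → g ∈ Ideal.span {f1, f2}

lemma koszul2 {f1 f2 : R} (h : Reg2 f1 f2) {c1 c2 : R} (hc : c1 * f1 + c2 * f2 = 0) :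
    ∃ s, c1 = - s * f2 ∧ c2 = s * f1 := by
  obtain ⟨h1, h2⟩ := h
  have : c2 ∈ Ideal.span {f1} := by
    apply h2
    rw [Ideal.mem_span_singleton]
    exact ⟨-c1, by linear_combination hc⟩
  obtain ⟨s, hs⟩ := Ideal.mem_span_singleton.1 this
  refine ⟨s, ?_, by rw [hs]; ring⟩
  apply mul_right_cancel₀ h1
  rw [hs] at hc
  linear_combination hc

lemma koszul3 {f1 f2 f3 : R} (h : Reg3 f1 f2 f3) {c1 c2 c3 : R}
    (hc : c1 * f1 + c2 * f2 + c3 * f3 = 0) :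
    ∃ s1 s2 s3, c1 = s2 * f3 - s3 * f2 ∧ c2 = s3 * f1 - s1 * f3 ∧ c3 = s1 * f2 - s2 * f1 := by
  obtain ⟨h1, h2⟩ := h
  have : c3 ∈ Ideal.span {f1, f2} := by
    apply h2
    rw [Ideal.mem_span_pair]
    exact ⟨-c1, -c2, by linear_combination -hc⟩
  obtain ⟨α, β, hs⟩ := Ideal.mem_span_pair.1 this
  obtain ⟨s, hs1, hs2⟩ := koszul2 h1 (c1 := c1 + α * f3) (c2 := c2 + β * f3)
    (by linear_combination hc + f3 * hs)
  exact ⟨β, -α, s, by linear_combination hs1, by linear_combination hs2,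
    by linear_combination -hs⟩

lemma cross3 {f1 f2 f3 : R} (h : Reg2 f1 f2) {s1 s2 s3 : R}
    (h2 : s1 * f2 = s2 * f1) (h3 : s1 * f3 = s3 * f1) :
    ∃ t, s1 = t * f1 ∧ s2 = t * f2 ∧ s3 = t * f3 := by
  obtain ⟨s, hs1, hs2⟩ := koszul2 h (c1 := - s2) (c2 := s1) (by linear_combination h2)
  refine ⟨s, hs2, by linear_combination -hs1, ?_⟩
  apply mul_right_cancel₀ h.1
  linear_combination -h3 + f3 * hs2

/-- Socle of the quotient by a length one sequence. -/
lemma socle1 {x0 x1 x2 f : R} (hx : Reg3 x0 x1 x2) {u : R}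
    (h0 : x0 * u ∈ Ideal.span {f}) (h1 : x1 * u ∈ Ideal.span {f}) 
    (h2 : x2 * u ∈ Ideal.span {f}) (hf : f ≠ 0) : u ∈ Ideal.span {f} := by
  rw [Ideal.mem_span_singleton] at *
  obtain ⟨a0, h0⟩ := h0
  obtain ⟨a1, h1⟩ := h1
  obtain ⟨a2, h2⟩ := h2
  obtain ⟨t, ht, -, -⟩ := cross3 (s1 := a0) (s2 := a1) (s3 := a2) (f3 := x2) hx.1
    (mul_left_cancel₀ hf (by linear_combination x0 * h1 - x1 * h0))
    (mul_left_cancel₀ hf (by linear_combination x0 * h2 - x2 * h0))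
  refine ⟨t, mul_left_cancel₀ hx.1.1 ?_⟩
  linear_combination h0 + f * ht

/-- Socle of the quotient by a length two sequence. -/
lemma socle2 {x0 x1 x2 f g : R} (hx : Reg3 x0 x1 x2) (hf : Reg2 f g) {u : R}
    (h0 : x0 * u ∈ Ideal.span {f, g}) (h1 : x1 * u ∈ Ideal.span {f, g})
    (h2 : x2 * u ∈ Ideal.span {f, g}) : u ∈ Ideal.span {f, g} := by
  rw [Ideal.mem_span_pair] at *
  obtain ⟨a0, b0, h0⟩ := h0
  obtain ⟨a1, b1, h1⟩ := h1
  obtain ⟨a2, b2, h2⟩ := h2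
  obtain ⟨s01, hs01, hs01'⟩ := koszul2 hf (c1 := x1 * a0 - x0 * a1) (c2 := x1 * b0 - x0 * b1)
    (by linear_combination x1 * h0 - x0 * h1)
  obtain ⟨s12, hs12, hs12'⟩ := koszul2 hf (c1 := x2 * a1 - x1 * a2) (c2 := x2 * b1 - x1 * b2)
    (by linear_combination x2 * h1 - x1 * h2)
  obtain ⟨s20, hs20, hs20'⟩ := koszul2 hf (c1 := x0 * a2 - x2 * a0) (c2 := x0 * b2 - x2 * b0)
    (by linear_combination x0 * h2 - x2 * h0)
  have hS : s12 * x0 + s20 * x1 + s01 * x2 = 0 := by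
    apply mul_right_cancel₀ hf.1
    linear_combination -x0 * hs12' - x1 * hs20' - x2 * hs01'
  obtain ⟨w0, w1, w2, e12, e20, e01⟩ := koszul3 hx hS
  obtain ⟨v, hv, -, -⟩ := cross3 (s1 := a0 + w0 * g) (s2 := a1 + w1 * g) (s3 := a2 + w2 * g)
    (f3 := x2) hx.1 (by linear_combination hs01 - g * e01) (by linear_combination -hs20 + g * e20)
  obtain ⟨v', hv', -, -⟩ := cross3 (s1 := b0 - w0 * f) (s2 := b1 - w1 * f) (s3 := b2 - w2 * f)
    (f3 := x2) hx.1 (by linear_combination hs01' + f * e01) (by linear_combination -hs20' - f * e20)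
  refine ⟨v, v', mul_left_cancel₀ hx.1.1 ?_⟩
  linear_combination h0 - f * hv - g * hv'

end Koszul

section Trunc
variable {k : Type*} [Field k]

/-- Truncation of a polynomial to its part of degree less than `N`. -/
noncomputable def T (N : ℕ) : MvPolynomial (Fin 3) k →ₗ[k] MvPolynomial (Fin 3) k :=
  ∑ i ∈ Finset.range N, homogeneousComponent i

lemma coeff_T (N : ℕ) (g : MvPolynomial (Fin 3) k) (d : Fin 3 →₀ ℕ) :
    coeff d (T N g) = if d.degree < N then coeff d g else 0 := by
  classical
  simp [T, LinearMap.sum_apply, coeff_sum, coeff_homogeneousComponent]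

lemma T_of_lt {N n : ℕ} (h : n < N) {g : MvPolynomial (Fin 3) k} (hg : g.IsHomogeneous n) :
    T N g = g := by
  ext d
  rw [coeff_T]
  split_ifs with hd
  · rfl
  · exact (hg.coeff_eq_zero (by omega)).symm

lemma T_of_le {N n : ℕ} (h : N ≤ n) {g : MvPolynomial (Fin 3) k} (hg : g.IsHomogeneous n) :
    T N g = 0 := by
  ext d
  rw [coeff_T]
  split_ifs with hd
  · exact (hg.coeff_eq_zero (by omega))
  · simp

lemma T_mul (N : ℕ) {e : ℕ} {f : MvPolynomial (Fin 3) k} (hf : f.IsHomogeneous e)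
    (g : MvPolynomial (Fin 3) k) : T (N + e) (g * f) = T N g * f := by
  conv_lhs => rw [← sum_homogeneousComponent g]
  conv_rhs => rw [← sum_homogeneousComponent g]
  simp only [Finset.sum_mul, map_sum]
  refine Finset.sum_congr rfl fun i _ => ?_
  have hi := homogeneousComponent_isHomogeneous i g
  rcases lt_or_ge i N with h | h
  · rw [T_of_lt h hi, T_of_lt (by omega) (hi.mul hf)]
  · rw [T_of_le h hi, T_of_le (by omega) (hi.mul hf), zero_mul]

lemma T_one (g : MvPolynomial (Fin 3) k) : T 1 g = C (coeff 0 g) := by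
  simp [T]

lemma T_zero (g : MvPolynomial (Fin 3) k) : T 0 g = 0 := by
  simp [T]

lemma T_T (N : ℕ) (g : MvPolynomial (Fin 3) k) : T N (T N g) = T N g := by
  ext d
  simp only [coeff_T]
  split_ifs <;> rfl

end Trunc

section Main
variable {k : Type*} [Field k]


lemma regX : Reg3 (X 0 : MvPolynomial (Fin 3) k) (X 1) (X 2) := by
  have e1 : ({X 0} : Set (MvPolynomial (Fin 3) k)) = X '' {0} := by simp
  have e2 : ({X 0, X 1} : Set (MvPolynomial (Fin 3) k)) = X '' {0, 1} := by simp [Set.image_pair]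
  refine ⟨⟨X_ne_zero _, fun g hg => ?_⟩, fun g hg => ?_⟩
  · rw [e1, mem_ideal_span_X_image] at *
    intro m hm
    obtain ⟨i, hi, h⟩ := hg (Finsupp.single 1 1 + m) (by
      rw [mem_support_iff, coeff_X_mul]; exact mem_support_iff.1 hm)
    refine ⟨i, hi, ?_⟩
    obtain rfl : i = 0 := hi
    simpa using h
  · rw [e2, mem_ideal_span_X_image] at *
    intro m hm
    obtain ⟨i, hi, h⟩ := hg (Finsupp.single 2 1 + m) (by
      rw [mem_support_iff, coeff_X_mul]; exact mem_support_iff.1 hm)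
    refine ⟨i, hi, ?_⟩
    obtain rfl | rfl : i = 0 ∨ i = 1 := hi
    · simpa using h
    · simpa using h

/-- Homogeneous version of Koszul exactness with truncated coefficients. -/
lemma koszulT {f1 f2 f3 : MvPolynomial (Fin 3) k} (h : Reg3 f1 f2 f3) (hf1 : f1.IsHomogeneous 3)
    (hf2 : f2.IsHomogeneous 3) (hf3 : f3.IsHomogeneous 3) (N : ℕ)
    {c1 c2 c3 : MvPolynomial (Fin 3) k} (h1 : T (N + 3) c1 = c1) (h2 : T (N + 3) c2 = c2)
    (h3 : T (N + 3) c3 = c3)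
    (hc : c1 * f1 + c2 * f2 + c3 * f3 = 0) :
    ∃ s1 s2 s3, T N s1 = s1 ∧ T N s2 = s2 ∧ T N s3 = s3 ∧
      c1 = s2 * f3 - s3 * f2 ∧ c2 = s3 * f1 - s1 * f3 ∧ c3 = s1 * f2 - s2 * f1 := by
  obtain ⟨s1, s2, s3, e1, e2, e3⟩ := koszul3 h hc
  refine ⟨T N s1, T N s2, T N s3, T_T _ _, T_T _ _, T_T _ _, ?_, ?_, ?_⟩
  · rw [← T_mul N hf2, ← T_mul N hf3, ← map_sub, ← e1, h1]
  · rw [← T_mul N hf1, ← T_mul N hf3, ← map_sub, ← e2, h2]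
  · rw [← T_mul N hf1, ← T_mul N hf2, ← map_sub, ← e3, h3]

lemma mem_span3 {A : Type*} [CommRing A] {f g h u : A} :
    u ∈ Ideal.span {f, g, h} ↔ ∃ a b c, a * f + b * g + c * h = u := by
  rw [Ideal.mem_span_insert]
  constructor
  · rintro ⟨a, z, hz, rfl⟩
    obtain ⟨b, c, rfl⟩ := Ideal.mem_span_pair.1 hz
    exact ⟨a, b, c, by ring⟩
  · rintro ⟨a, b, c, rfl⟩
    exact ⟨a, b * g + c * h, Ideal.mem_span_pair.2 ⟨b, c, rfl⟩, by ring⟩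

/-- An element of degree at most `5` is not a nonzero socle element. -/
lemma socle3 {f1 f2 f3 : MvPolynomial (Fin 3) k} (hf : Reg3 f1 f2 f3) (hf1 : f1.IsHomogeneous 3)
    (hf2 : f2.IsHomogeneous 3) (hf3 : f3.IsHomogeneous 3) {u : MvPolynomial (Fin 3) k}
    (hu : T 6 u = u) (h : ∀ i, X i * u ∈ Ideal.span {f1, f2, f3}) :
    u ∈ Ideal.span {f1, f2, f3} := by
  have hX := regX (k := k)
  have key : ∀ i, ∃ a b c, T 4 a = a ∧ T 4 b = b ∧ T 4 c = c ∧
      a * f1 + b * f2 + c * f3 = X i * u := by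
    intro i
    obtain ⟨a, b, c, e⟩ := mem_span3.1 (h i)
    refine ⟨T 4 a, T 4 b, T 4 c, T_T _ _, T_T _ _, T_T _ _, ?_⟩
    rw [← T_mul 4 hf1, ← T_mul 4 hf2, ← T_mul 4 hf3, ← map_add, ← map_add, e, mul_comm,
      T_mul 6 (isHomogeneous_X k i), hu]
  have lin : ∀ (N : ℕ) (i j : Fin 3) (a b : MvPolynomial (Fin 3) k), T N a = a → T N b = b →
      T (N + 1) (a * X i - b * X j) = a * X i - b * X j := by
    intro N i j a b ha hb
    rw [map_sub, T_mul N (isHomogeneous_X k i), T_mul N (isHomogeneous_X k j), ha, hb]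
  obtain ⟨a0, b0, c0, ha0, hb0, hc0, h0⟩ := key 0
  obtain ⟨a1, b1, c1, ha1, hb1, hc1, h1⟩ := key 1
  obtain ⟨a2, b2, c2, ha2, hb2, hc2, h2⟩ := key 2
  obtain ⟨p1, p2, p3, tp1, tp2, tp3, ep1, ep2, ep3⟩ := koszulT hf hf1 hf2 hf3 2
    (lin 4 1 0 a0 a1 ha0 ha1) (lin 4 1 0 b0 b1 hb0 hb1) (lin 4 1 0 c0 c1 hc0 hc1)
    (by linear_combination X 1 * h0 - X 0 * h1)
  obtain ⟨q1, q2, q3, tq1, tq2, tq3, eq1, eq2, eq3⟩ := koszulT hf hf1 hf2 hf3 2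
    (lin 4 2 1 a1 a2 ha1 ha2) (lin 4 2 1 b1 b2 hb1 hb2) (lin 4 2 1 c1 c2 hc1 hc2)
    (by linear_combination X 2 * h1 - X 1 * h2)
  obtain ⟨r1, r2, r3, tr1, tr2, tr3, er1, er2, er3⟩ := koszulT hf hf1 hf2 hf3 2
    (lin 4 0 2 a2 a0 ha2 ha0) (lin 4 0 2 b2 b0 hb2 hb0) (lin 4 0 2 c2 c0 hc2 hc0)
    (by linear_combination X 0 * h2 - X 2 * h0)
  have lin3 : ∀ (a b c : MvPolynomial (Fin 3) k), T 2 a = a → T 2 b = b → T 2 c = c →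
      T 3 (a * X 0 + b * X 1 + c * X 2) = a * X 0 + b * X 1 + c * X 2 := by
    intro a b c ha hb hc
    rw [map_add, map_add, T_mul 2 (isHomogeneous_X k 0), T_mul 2 (isHomogeneous_X k 1),
      T_mul 2 (isHomogeneous_X k 2), ha, hb, hc]
  obtain ⟨t, t1, t2, t3⟩ := cross3 (s1 := q1 * X 0 + r1 * X 1 + p1 * X 2)
    (s2 := q2 * X 0 + r2 * X 1 + p2 * X 2) (s3 := q3 * X 0 + r3 * X 1 + p3 * X 2) (f3 := f3) hf.1
    (by linear_combination -X 0 * eq3 - X 1 * er3 - X 2 * ep3)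
    (by linear_combination X 0 * eq2 + X 1 * er2 + X 2 * ep2)
  rw [← lin3 _ _ _ tq1 tr1 tp1] at t1
  rw [← lin3 _ _ _ tq2 tr2 tp2] at t2
  rw [← lin3 _ _ _ tq3 tr3 tp3] at t3
  have z : ∀ g f : MvPolynomial (Fin 3) k, f.IsHomogeneous 3 → T 3 g = t * f → T 3 g = 0 := by
    intro g f hf hg
    rw [← T_T, hg]
    have := T_mul 0 hf t
    rw [T_zero, zero_mul] at this
    exact this
  have z1 := z _ _ hf1 t1
  have z2 := z _ _ hf2 t2
  have z3 := z _ _ hf3 t3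
  rw [lin3 _ _ _ tq1 tr1 tp1] at z1
  rw [lin3 _ _ _ tq2 tr2 tp2] at z2
  rw [lin3 _ _ _ tq3 tr3 tp3] at z3
  obtain ⟨u0, u1, u2, eu12, eu20, eu01⟩ := koszul3 hX z1
  obtain ⟨v0, v1, v2, ev12, ev20, ev01⟩ := koszul3 hX z2
  obtain ⟨w0, w1, w2, ew12, ew20, ew01⟩ := koszul3 hX z3
  obtain ⟨A, hA, -, -⟩ := cross3 (s1 := a0 - (v0 * f3 - w0 * f2))
    (s2 := a1 - (v1 * f3 - w1 * f2)) (s3 := a2 - (v2 * f3 - w2 * f2)) (f3 := X 2) hX.1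
    (by linear_combination ep1 + f3 * ev01 - f2 * ew01)
    (by linear_combination -er1 - f3 * ev20 + f2 * ew20)
  obtain ⟨B, hB, -, -⟩ := cross3 (s1 := b0 - (w0 * f1 - u0 * f3))
    (s2 := b1 - (w1 * f1 - u1 * f3)) (s3 := b2 - (w2 * f1 - u2 * f3)) (f3 := X 2) hX.1
    (by linear_combination ep2 + f1 * ew01 - f3 * eu01)
    (by linear_combination -er2 - f1 * ew20 + f3 * eu20)
  obtain ⟨C', hC, -, -⟩ := cross3 (s1 := c0 - (u0 * f2 - v0 * f1))
    (s2 := c1 - (u1 * f2 - v1 * f1)) (s3 := c2 - (u2 * f2 - v2 * f1)) (f3 := X 2) hX.1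
    (by linear_combination ep3 + f2 * eu01 - f1 * ev01)
    (by linear_combination -er3 - f2 * eu20 + f1 * ev20)
  refine mem_span3.2 ⟨A, B, C', mul_left_cancel₀ hX.1.1 ?_⟩
  linear_combination h0 - f1 * hA - f2 * hB - f3 * hC

lemma finrank_homog (n : ℕ) :
    Module.finrank k (homogeneousSubmodule (Fin 3) k n) = (n + 2).choose 2 := by
  rw [homogeneousSubmodule_eq_finsupp_supported,
    (AddMonoidAlgebra.supportedEquivFinsupp (R := k) (S := k) {d : Fin 3 →₀ ℕ | d.degree = n}).finrank_eq]
  have e : {d : Fin 3 →₀ ℕ | d.degree = n} =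
      ((Finset.finsuppAntidiag (Finset.univ : Finset (Fin 3)) n : Finset _) : Set (Fin 3 →₀ ℕ)) := by
    ext d
    simp [Finsupp.degree_eq_sum]
  rw [e, Module.finrank_finsupp_self]
  simp only [Finset.coe_sort_coe, Fintype.card_coe, Finset.card_finsuppAntidiag_nat_eq_choose]
  simp only [Finset.card_univ, Fintype.card_fin]
  rw [show 3 + n - 1 = n + 2 by omega, Nat.choose_symm_add]

/-- Avoidance of associated primes inside a linear space. -/
lemma exists_regular [Infinite k] (J : Ideal (MvPolynomial (Fin 3) k))
    (hJ : ∀ u, (∀ i, X i * u ∈ J) → u ∈ J) (V : Submodule k (MvPolynomial (Fin 3) k))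
    (hV : ∀ i, X i ∈ (Ideal.span (V : Set (MvPolynomial (Fin 3) k))).radical) :
    ∃ f ∈ V, ∀ g, f * g ∈ J → g ∈ J := by
  by_contra! hcon
  have hfin := associatedPrimes.finite (MvPolynomial (Fin 3) k) (MvPolynomial (Fin 3) k ⧸ J)
  have : Finite (associatedPrimes (MvPolynomial (Fin 3) k) (MvPolynomial (Fin 3) k ⧸ J)) := hfin
  obtain ⟨P, hP⟩ := Subspace.exists_eq_top_of_iUnion_eq_univ (k := k) (E := V)
    (p := fun P : associatedPrimes (MvPolynomial (Fin 3) k) (MvPolynomial (Fin 3) k ⧸ J) =>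
      (P.1.restrictScalars k).comap V.subtype) (by
      rw [Set.eq_univ_iff_forall]
      rintro ⟨f, hf⟩
      obtain ⟨g, hg, hg'⟩ := hcon f hf
      have : f ∈ ⋃ p ∈ associatedPrimes (MvPolynomial (Fin 3) k) (MvPolynomial (Fin 3) k ⧸ J),
          (p : Set (MvPolynomial (Fin 3) k)) := by
        rw [biUnion_associatedPrimes_eq_zero_divisors]
        refine ⟨Ideal.Quotient.mk J g, fun h => hg' (Ideal.Quotient.eq_zero_iff_mem.1 h), ?_⟩
        rw [← Ideal.Quotient.mk_eq_mk, ← Submodule.Quotient.mk_smul]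
        exact Ideal.Quotient.eq_zero_iff_mem.2 hg
      simp only [Set.mem_iUnion] at this ⊢
      obtain ⟨P, hP, h⟩ := this
      exact ⟨⟨P, hP⟩, h⟩)
  obtain ⟨hprime, x, hx⟩ := isAssociatedPrime_iff.1 P.2
  have hVP : Ideal.span (V : Set (MvPolynomial (Fin 3) k)) ≤ P.1 := by
    rw [Ideal.span_le]
    intro f hf
    have : (⟨f, hf⟩ : V) ∈ (P.1.restrictScalars k).comap V.subtype := by
      have hP' : (P.1.restrictScalars k).comap V.subtype = ⊤ := hP
      rw [hP']; trivial
    exact this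
  have hXP : ∀ i, X i ∈ P.1 := fun i => (hprime.radical_le_iff.2 hVP) (hV i)
  obtain ⟨u, rfl⟩ := Ideal.Quotient.mk_surjective x
  have hu : u ∈ J := by
    apply hJ
    intro i
    have := hXP i
    rw [hx, Submodule.mem_colon_singleton, Submodule.mem_bot, ← Ideal.Quotient.mk_eq_mk,
      ← Submodule.Quotient.mk_smul] at this
    exact Ideal.Quotient.eq_zero_iff_mem.1 this
  apply hprime.ne_top
  rw [hx, Ideal.Quotient.eq_zero_iff_mem.2 hu, Ideal.eq_top_iff_one, Submodule.mem_colon_singleton]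
  simp

/-- The degree six part of a complete intersection of three cubics has codimension one. -/
lemma codim_one {f1 f2 f3 : MvPolynomial (Fin 3) k} (hf : Reg3 f1 f2 f3) (hf1 : f1.IsHomogeneous 3)
    (hf2 : f2.IsHomogeneous 3) (hf3 : f3.IsHomogeneous 3) {w : MvPolynomial (Fin 3) k}
    (hw : w.IsHomogeneous 6) (hwF : w ∉ Ideal.span {f1, f2, f3})
    {q : MvPolynomial (Fin 3) k} (hq : q.IsHomogeneous 6) :
    q ∈ Ideal.span {f1, f2, f3} ⊔ Ideal.span {w} := by
  let H := homogeneousSubmodule (Fin 3) k 3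
  have fin : ∀ n, Module.Finite k (homogeneousSubmodule (Fin 3) k n) := fun n =>
    Module.Finite.iff_fg.2 (homogeneousSubmodule_fg (Fin 3) k n)
  have finH : Module.Finite k H := fin 3
  have fin6 := fin 6
  let μ : MvPolynomial (Fin 3) k → (H →ₗ[k] MvPolynomial (Fin 3) k) := fun f =>
    (LinearMap.mulRight k f).comp H.subtype
  let φ : (H × H × H) →ₗ[k] MvPolynomial (Fin 3) k := (μ f1).coprod ((μ f2).coprod (μ f3))
  have hφ : ∀ a b c : H, φ (a, b, c) = a.1 * f1 + (b.1 * f2 + c.1 * f3) := fun a b c => by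
    simp [φ, μ]
  let F1 : H := ⟨f1, hf1⟩
  let F2 : H := ⟨f2, hf2⟩
  let F3 : H := ⟨f3, hf3⟩
  let e : Fin 3 → H × H × H := ![(0, -F3, F2), (F3, 0, -F1), (-F2, F1, 0)]
  have hker : LinearMap.ker φ ≤ Submodule.span k (Set.range e) := by
    rintro ⟨⟨a, ha⟩, ⟨b, hb⟩, ⟨c, hc⟩⟩ h
    rw [LinearMap.mem_ker, hφ] at h
    obtain ⟨s1, s2, s3, t1, t2, t3, e1, e2, e3⟩ := koszulT hf hf1 hf2 hf3 1
      (T_of_lt (by norm_num) ha) (T_of_lt (by norm_num) hb) (T_of_lt (by norm_num) hc)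
      (by rw [← h]; ring)
    rw [T_one] at t1 t2 t3
    rw [Submodule.mem_span_range_iff_exists_fun]
    refine ⟨![coeff 0 s1, coeff 0 s2, coeff 0 s3], ?_⟩
    rw [← t1, ← t2] at e3
    rw [← t2, ← t3] at e1
    rw [← t1, ← t3] at e2
    ext1
    · ext1
      simp [Fin.sum_univ_three, e, F1, F2, F3, e1, smul_eq_C_mul]
      ring
    ext1
    · ext1
      simp [Fin.sum_univ_three, e, F1, F2, F3, e2, smul_eq_C_mul]
      ring
    · ext1
      simp [Fin.sum_univ_three, e, F1, F2, F3, e3, smul_eq_C_mul]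
      ring
  have hk3 : Module.finrank k (LinearMap.ker φ) ≤ 3 :=
    (Submodule.finrank_mono hker).trans ((finrank_range_le_card e).trans (by simp))
  have hrn := LinearMap.finrank_range_add_finrank_ker φ
  have hH : Module.finrank k H = 10 := finrank_homog 3
  have hH6 : Module.finrank k (homogeneousSubmodule (Fin 3) k 6) = 28 := finrank_homog 6
  rw [Module.finrank_prod, Module.finrank_prod, hH] at hrn
  have hrange : ∀ x ∈ LinearMap.range φ, x ∈ Ideal.span {f1, f2, f3} := by
    rintro x ⟨⟨a, b, c⟩, rfl⟩
    exact mem_span3.2 ⟨a, b, c, by rw [hφ]; ring⟩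
  have hle : LinearMap.range φ ⊔ Submodule.span k {w} ≤ homogeneousSubmodule (Fin 3) k 6 := by
    refine sup_le ?_ ?_
    · rintro x ⟨⟨⟨a, ha⟩, ⟨b, hb⟩, ⟨c, hc⟩⟩, rfl⟩
      rw [hφ]
      exact (IsHomogeneous.mul ha hf1).add ((IsHomogeneous.mul hb hf2).add
        (IsHomogeneous.mul hc hf3))
    · rw [Submodule.span_le, Set.singleton_subset_iff]
      exact hw
  have finS : Module.Finite k ↥(LinearMap.range φ ⊔ Submodule.span k {w}) :=
    inferInstance
  have hlt : LinearMap.range φ < LinearMap.range φ ⊔ Submodule.span k {w} := by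
    refine lt_of_le_of_ne le_sup_left fun h => hwF (hrange w ?_)
    rw [h]
    exact Submodule.mem_sup_right (Submodule.mem_span_singleton_self w)
  have h1 := Submodule.finrank_lt_finrank_of_lt hlt
  have heq := Submodule.eq_of_le_of_finrank_le hle (by omega)
  have hq' : q ∈ LinearMap.range φ ⊔ Submodule.span k {w} := by rw [heq]; exact hq
  obtain ⟨y, hy, z, hz, rfl⟩ := Submodule.mem_sup.1 hq'
  refine Submodule.add_mem_sup (hrange y hy) ?_
  obtain ⟨c, rfl⟩ := Submodule.mem_span_singleton.1 hz
  rw [smul_eq_C_mul]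
  exact Ideal.mul_mem_left _ _ (Ideal.mem_span_singleton_self w)

/-- A cubic outside the ideal has a degree six multiple outside the ideal. -/
lemma exists_mul {f1 f2 f3 : MvPolynomial (Fin 3) k} (hf : Reg3 f1 f2 f3) (hf1 : f1.IsHomogeneous 3)
    (hf2 : f2.IsHomogeneous 3) (hf3 : f3.IsHomogeneous 3) {p : MvPolynomial (Fin 3) k}
    (hp : p.IsHomogeneous 3) (hpF : p ∉ Ideal.span {f1, f2, f3}) :
    ∃ g : MvPolynomial (Fin 3) k, (g * p).IsHomogeneous 6 ∧ g * p ∉ Ideal.span {f1, f2, f3} := by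
  have step : ∀ n, n ≤ 5 → ∀ g : MvPolynomial (Fin 3) k, (g * p).IsHomogeneous n →
      g * p ∉ Ideal.span {f1, f2, f3} → ∃ g' : MvPolynomial (Fin 3) k,
      (g' * p).IsHomogeneous (n + 1) ∧ g' * p ∉ Ideal.span {f1, f2, f3} := by
    intro n hn g hg hgF
    by_contra! hcon
    refine hgF (socle3 hf hf1 hf2 hf3 (T_of_lt (by omega) hg) fun i => ?_)
    rw [← mul_assoc]
    apply hcon
    rw [mul_assoc, add_comm]
    exact (isHomogeneous_X k i).mul hg
  obtain ⟨g, h, h'⟩ := step 3 (by norm_num) 1 (by simpa using hp) (by simpa using hpF)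
  obtain ⟨g, h, h'⟩ := step 4 (by norm_num) g h h'
  exact step 5 (by norm_num) g h h'

open scoped Pointwise in
/-- An ideal containing all forms of degree six contains the sixth power of the maximal ideal. -/
lemma pow_le {I : Ideal (MvPolynomial (Fin 3) k)}
    (h : ∀ x : MvPolynomial (Fin 3) k, x.IsHomogeneous 6 → x ∈ I) :
    (Ideal.span (Set.range (X : Fin 3 → MvPolynomial (Fin 3) k))) ^ 6 ≤ I := by
  have hpow : (Ideal.span (Set.range (X : Fin 3 → MvPolynomial (Fin 3) k))) ^ 6 =
      Ideal.span ((Set.range (X : Fin 3 → MvPolynomial (Fin 3) k)) ^ 6) :=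
    Submodule.span_pow _ _
  rw [hpow, Ideal.span_le]
  intro x hx
  have hind : ∀ n, ∀ x ∈ (Set.range (X : Fin 3 → MvPolynomial (Fin 3) k)) ^ n,
      x.IsHomogeneous n := by
    intro n
    induction n with
    | zero =>
      intro x hx
      simp only [pow_zero, Set.mem_one] at hx
      rw [hx]
      exact isHomogeneous_one _ _
    | succ n ih =>
      intro x hx
      rw [pow_succ] at hx
      obtain ⟨y, hy, z, ⟨i, rfl⟩, rfl⟩ := Set.mem_mul.1 hx
      exact (ih y hy).mul (isHomogeneous_X k i)
  exact h x (hind 6 x hx)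

end Main

end CubicsAux

theorem cubics_common_zero (k : Type*) [Field k] [CharZero k] (r : ℕ)
    (p : Fin r → MvPolynomial (Fin 3) k)
    (hli : LinearIndependent k p)
    (hdeg : ∀ i, (p i).IsHomogeneous 3)
    (hnc : ¬ ((Ideal.span (Set.range (X : Fin 3 → MvPolynomial (Fin 3) k))) ^ 6 ≤
        Ideal.span (Set.range p)))
    (hr : r ≠ 3) :
    ∃ ξ : Fin 3 → AlgebraicClosure k, ξ ≠ 0 ∧ ∀ i, aeval ξ (p i) = 0 := by
  by_contra! hcon
  apply hnc
  have hX := CubicsAux.regX (k := k)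
  let V := Submodule.span k (Set.range p)
  have hVI : Ideal.span (V : Set (MvPolynomial (Fin 3) k)) = Ideal.span (Set.range p) := by
    apply le_antisymm
    · rw [Ideal.span_le]
      intro x hx
      exact (Submodule.span_le_restrictScalars k (MvPolynomial (Fin 3) k) (Set.range p)) hx
    · exact Ideal.span_mono Submodule.subset_span
  have hVh : ∀ f ∈ V, f.IsHomogeneous 3 := by
    have : V ≤ homogeneousSubmodule (Fin 3) k 3 := by
      rw [Submodule.span_le]
      rintro _ ⟨i, rfl⟩
      exact hdeg i
    exact this
  have hrad : ∀ i, X i ∈ (Ideal.span (V : Set (MvPolynomial (Fin 3) k))).radical := by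
    intro i
    rw [hVI, ← vanishingIdeal_zeroLocus_eq_radical (K := AlgebraicClosure k),
      mem_vanishingIdeal_iff]
    intro ξ hξ
    rw [mem_zeroLocus_iff] at hξ
    have h0 : ξ = 0 := by
      by_contra h
      obtain ⟨j, hj⟩ := hcon ξ h
      exact hj (hξ _ (Ideal.subset_span ⟨j, rfl⟩))
    simp [h0]
  obtain ⟨f1, hf1, r1⟩ := CubicsAux.exists_regular ⊥ (fun u h => by
    have := h 0
    rw [Ideal.mem_bot] at this ⊢
    exact (mul_eq_zero.1 this).resolve_left (X_ne_zero _)) V hrad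
  have hf10 : f1 ≠ 0 := by
    rintro rfl
    simpa using r1 1 (by simp)
  obtain ⟨f2, hf2, r2⟩ := CubicsAux.exists_regular (Ideal.span {f1}) (fun u h =>
    CubicsAux.socle1 hX (h 0) (h 1) (h 2) hf10) V hrad
  have R2 : CubicsAux.Reg2 f1 f2 := ⟨hf10, r2⟩
  obtain ⟨f3, hf3, r3⟩ := CubicsAux.exists_regular (Ideal.span {f1, f2}) (fun u h =>
    CubicsAux.socle2 hX R2 (h 0) (h 1) (h 2)) V hrad
  have R3 : CubicsAux.Reg3 f1 f2 f3 := ⟨R2, r3⟩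
  have h1 := hVh f1 hf1
  have h2 := hVh f2 hf2
  have h3 := hVh f3 hf3
  have hfr : Module.finrank k V = r := by
    simpa using finrank_span_eq_card hli
  have finV : Module.Finite k V := Module.Finite.span_of_finite k (Set.finite_range p)
  have hFV : Submodule.span k (Set.range ![f1, f2, f3]) ≤ V := by
    rw [Submodule.span_le]
    rintro _ ⟨i, rfl⟩
    fin_cases i <;> assumption
  have hlif : LinearIndependent k ![f1, f2, f3] := by
    rw [Fintype.linearIndependent_iff]
    intro c hc
    simp only [Fin.sum_univ_three, smul_eq_C_mul] at hc
    obtain ⟨s1, s2, s3, e1, e2, e3⟩ := CubicsAux.koszul3 R3 hc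
    have z : ∀ f : MvPolynomial (Fin 3) k, f.IsHomogeneous 3 → constantCoeff f = 0 := by
      intro f hf
      exact hf.coeff_eq_zero (by simp)
    have e1 := congrArg constantCoeff e1
    have e2 := congrArg constantCoeff e2
    have e3 := congrArg constantCoeff e3
    simp only [constantCoeff_C, map_sub, map_mul, z _ h1, z _ h2, z _ h3, mul_zero, sub_zero]
      at e1 e2 e3
    intro i
    fin_cases i <;> assumption
  have hfr3 : Module.finrank k (Submodule.span k (Set.range ![f1, f2, f3])) = 3 := by
    simpa using finrank_span_eq_card hlif
  have hlt : Submodule.span k (Set.range ![f1, f2, f3]) < V := by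
    refine lt_of_le_of_ne hFV fun h => hr ?_
    rw [← hfr, ← h, hfr3]
  obtain ⟨q, hqV, hq⟩ := SetLike.exists_of_lt hlt
  have hqh := hVh q hqV
  have hqF : q ∉ Ideal.span {f1, f2, f3} := by
    intro h
    obtain ⟨a, b, c, e⟩ := CubicsAux.mem_span3.1 h
    apply hq
    have := congrArg (CubicsAux.T (1 + 3)) e
    rw [map_add, map_add, CubicsAux.T_mul 1 h1, CubicsAux.T_mul 1 h2, CubicsAux.T_mul 1 h3,
      CubicsAux.T_of_lt (by norm_num) hqh] at this
    simp only [CubicsAux.T_one] at this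
    rw [Submodule.mem_span_range_iff_exists_fun]
    refine ⟨![coeff 0 a, coeff 0 b, coeff 0 c], ?_⟩
    rw [← this]
    simp [Fin.sum_univ_three, smul_eq_C_mul]
  obtain ⟨g, hg, hgF⟩ := CubicsAux.exists_mul R3 h1 h2 h3 hqh hqF
  have hmem : ∀ x ∈ V, x ∈ Ideal.span (Set.range p) := by
    intro x hx
    rw [← hVI]
    exact Ideal.subset_span hx
  have hfin : Ideal.span {f1, f2, f3} ⊔ Ideal.span {g * q} ≤ Ideal.span (Set.range p) := by
    refine sup_le ?_ ?_
    · rw [Ideal.span_le]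
      rintro x (rfl | rfl | rfl)
      · exact hmem _ hf1
      · exact hmem _ hf2
      · exact hmem _ hf3
    · rw [Ideal.span_le, Set.singleton_subset_iff]
      exact Ideal.mul_mem_left _ _ (hmem _ hqV)
  refine CubicsAux.pow_le fun x hx => hfin ?_
  exact CubicsAux.codim_one R3 h1 h2 h3 hg hgF hx
end

section
/- Let k be a field of characteristic zero and let p_1, …, p_r ∈ k[x_1,x_2,x_3,x_4] be linearly independent homogeneous polynomials of degree 2 such that the ideal ⟨p_1,…,p_r⟩ does not contain the ideal ⟨x_1,x_2,x_3,x_4⟩⁴. If r ≠ 4, then p_1, …, p_r have a common nontrivial zero in the algebraic closure of k; that is, there exists 0 ≠ ξ ∈ (k̄)⁴ with p_i(ξ) = 0 for all i = 1, …, r. -/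
open MvPolynomial
attribute [local instance] MvPolynomial.gradedAlgebra


theorem hc_mul_s17 {k : Type*} [Field k] {m n : ℕ} {q g : MvPolynomial (Fin 4) k}
    (hq : q.IsHomogeneous m) :
    homogeneousComponent (m + n) (q * g) = q * homogeneousComponent n g := by
  have h := DirectSum.coe_decompose_mul_add_of_left_mem (homogeneousSubmodule (Fin 4) k)
    (i := m) (j := n) (a := q) (b := g) hq
  rw [← decomposition.decompose'_apply, ← decomposition.decompose'_apply]
  exact h

def Nzd {k : Type*} [Field k] (I : Ideal (MvPolynomial (Fin 4) k)) (a : MvPolynomial (Fin 4) k) :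
    Prop := ∀ f, a * f ∈ I → f ∈ I

def SocGen {k : Type*} [Field k] (I : Ideal (MvPolynomial (Fin 4) k)) (s : MvPolynomial (Fin 4) k) :
    Prop := (∀ i, X i * s ∈ I) ∧ ∀ f, (∀ i, X i * f ∈ I) → ∃ c : k, f - C c * s ∈ I

theorem mem_sup_sing {R : Type*} [CommRing R] {I : Ideal R} {a f : R} :
    f ∈ I ⊔ Ideal.span {a} ↔ ∃ g, f - a * g ∈ I := by
  rw [Submodule.mem_sup]
  constructor
  · rintro ⟨y, hy, z, hz, rfl⟩
    obtain ⟨g, rfl⟩ := Ideal.mem_span_singleton'.1 hz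
    exact ⟨g, by convert hy using 1; ring⟩
  · rintro ⟨g, hg⟩
    exact ⟨_, hg, a * g, Ideal.mem_span_singleton'.2 ⟨g, mul_comm _ _⟩, by ring⟩

theorem Nzd.perm {k : Type*} [Field k] {I : Ideal (MvPolynomial (Fin 4) k)}
    {a b : MvPolynomial (Fin 4) k} (ha : Nzd I a) (hb : Nzd (I ⊔ Ideal.span {a}) b) :
    Nzd (I ⊔ Ideal.span {b}) a := by
  intro f hf
  obtain ⟨g, hg⟩ := mem_sup_sing.1 hf
  have h1 : g ∈ I ⊔ Ideal.span {a} := hb _ (mem_sup_sing.2 ⟨f, by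
    have := I.neg_mem hg
    convert this using 1; ring⟩)
  obtain ⟨h, hh⟩ := mem_sup_sing.1 h1
  refine mem_sup_sing.2 ⟨h, ha _ ?_⟩
  have := I.add_mem hg (I.mul_mem_left b hh)
  convert this using 1; ring

theorem mul_mem_of_soc {k : Type*} [Field k] {I : Ideal (MvPolynomial (Fin 4) k)}
    {b f : MvPolynomial (Fin 4) k} (hf : ∀ i, X i * f ∈ I)
    (hb : b ∈ Ideal.span (Set.range (X : Fin 4 → MvPolynomial (Fin 4) k))) : b * f ∈ I := by
  induction hb using Submodule.span_induction with
  | mem x hx => obtain ⟨i, rfl⟩ := hx; exact hf i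
  | zero => simp
  | add x y _ _ hx hy => rw [add_mul]; exact I.add_mem hx hy
  | smul a x _ hx => rw [smul_eq_mul, mul_assoc]; exact I.mul_mem_left _ hx

theorem mem_m {k : Type*} [Field k] {n : ℕ} {f : MvPolynomial (Fin 4) k}
    (hf : f.IsHomogeneous (n + 1)) :
    f ∈ Ideal.span (Set.range (X : Fin 4 → MvPolynomial (Fin 4) k)) := by
  rw [← Set.image_univ, mem_ideal_span_X_image]
  intro d hd
  have := hf.degree_eq_sum_deg_support hd
  by_contra hcon
  push Not at hcon
  have : d = 0 := by ext i; simpa using hcon i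
  subst this
  simp at *

theorem exchange {k : Type*} [Field k] {I : Ideal (MvPolynomial (Fin 4) k)}
    (hI : I.IsHomogeneous (homogeneousSubmodule (Fin 4) k))
    {a b s : MvPolynomial (Fin 4) k} (ha : Nzd I a) (hb : Nzd I b) (ha1 : a.IsHomogeneous 1)
    (hb2 : b.IsHomogeneous 2) {e : ℕ} (hs : s.IsHomogeneous e)
    (h : SocGen (I ⊔ Ideal.span {a}) s) :
    ∃ s' : MvPolynomial (Fin 4) k, s'.IsHomogeneous (e + 1) ∧ SocGen (I ⊔ Ideal.span {b}) s' := by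
  obtain ⟨t, ht⟩ := mem_sup_sing.1 (mul_mem_of_soc h.1 (mem_m (n := 1) hb2))
  have ht' : b * s - a * homogeneousComponent (e + 1) t ∈ I := by
    have := homogeneousComponent_mem_of_mem hI ht (1 + (e + 1))
    rw [map_sub, hc_mul_s17 ha1, homogeneousComponent_eq_self] at this
    · exact this
    · have := hb2.mul hs
      convert this using 1; ring
  refine ⟨homogeneousComponent (e + 1) t, homogeneousComponent_isHomogeneous _ _, ?_, ?_⟩
  · intro i
    obtain ⟨u, hu⟩ := mem_sup_sing.1 (h.1 i)
    refine mem_sup_sing.2 ⟨u, ha _ ?_⟩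
    have := I.sub_mem (I.mul_mem_left b hu) (I.mul_mem_left (X i) ht')
    convert this using 1; ring
  · intro f hf
    obtain ⟨f', hf'⟩ := mem_sup_sing.1 (mul_mem_of_soc hf (mem_m (n := 0) ha1))
    obtain ⟨c, hc⟩ := h.2 f' (fun i => by
      obtain ⟨u, hu⟩ := mem_sup_sing.1 (hf i)
      refine mem_sup_sing.2 ⟨u, hb _ ?_⟩
      have := I.sub_mem (I.mul_mem_left a hu) (I.mul_mem_left (X i) hf')
      convert this using 1; ring)
    obtain ⟨u, hu⟩ := mem_sup_sing.1 hc
    refine ⟨c, mem_sup_sing.2 ⟨u, ha _ ?_⟩⟩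
    have := I.add_mem hf' (I.add_mem (I.mul_mem_left b hu) (I.mul_mem_left (C c) ht'))
    convert this using 1; ring

theorem avoid_s17 {k : Type*} [Field k] [CharZero k] (V : Submodule k (MvPolynomial (Fin 4) k))
    (hV : ∀ P : Ideal (MvPolynomial (Fin 4) k), P.IsPrime → (∀ v ∈ V, v ∈ P) → ∀ i, X i ∈ P)
    (n : ℕ) (J : ℕ → Ideal (MvPolynomial (Fin 4) k))
    (hJ : ∀ j < n, ∃ i, Nzd (J j) (X i)) :
    ∃ q : V, ∀ j < n, Nzd (J j) (q : MvPolynomial (Fin 4) k) := by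
  classical
  let s : Set (Ideal (MvPolynomial (Fin 4) k)) :=
    ⋃ j ∈ Set.Iio n, associatedPrimes (MvPolynomial (Fin 4) k) (MvPolynomial (Fin 4) k ⧸ J j)
  have hs : s.Finite := (Set.finite_Iio n).biUnion fun j _ => associatedPrimes.finite _ _
  let F : Ideal (MvPolynomial (Fin 4) k) → Subspace k V :=
    fun P => (P.restrictScalars k).comap V.subtype
  have htop : ⊤ ∉ hs.toFinset.image F := by
    intro h
    obtain ⟨P, hP, hPt⟩ := Finset.mem_image.1 h
    rw [Set.Finite.mem_toFinset] at hP
    obtain ⟨j, hj, hP⟩ := Set.mem_iUnion₂.1 hP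
    have hVP : ∀ v ∈ V, v ∈ P := by
      intro v hv
      have : (⟨v, hv⟩ : V) ∈ F P := hPt ▸ Submodule.mem_top
      exact this
    have hX := hV P hP.isPrime hVP
    obtain ⟨i, hi⟩ := hJ j hj
    have : X i ∈ {r : MvPolynomial (Fin 4) k |
        ∃ x : MvPolynomial (Fin 4) k ⧸ J j, x ≠ 0 ∧ r • x = 0} := by
      rw [← biUnion_associatedPrimes_eq_zero_divisors]
      exact Set.mem_iUnion₂.2 ⟨P, hP, hX i⟩
    obtain ⟨x, hx, hx0⟩ := this
    obtain ⟨g, rfl⟩ := Ideal.Quotient.mk_surjective x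
    apply hx
    rw [Ideal.Quotient.eq_zero_iff_mem]
    apply hi
    rw [← Ideal.Quotient.eq_zero_iff_mem]
    exact hx0
  have := Subspace.biUnion_ne_univ_of_top_notMem htop
  obtain ⟨q, hq⟩ := (Set.ne_univ_iff_exists_notMem _).1 this
  refine ⟨q, fun j hj f hf => ?_⟩
  by_contra hfJ
  apply hq
  have : (q : MvPolynomial (Fin 4) k) ∈
      ⋃ p ∈ associatedPrimes (MvPolynomial (Fin 4) k) (MvPolynomial (Fin 4) k ⧸ J j),
        (p : Set (MvPolynomial (Fin 4) k)) := by
    rw [biUnion_associatedPrimes_eq_zero_divisors]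
    refine ⟨Ideal.Quotient.mk (J j) f, ?_, ?_⟩
    · rwa [Ne, Ideal.Quotient.eq_zero_iff_mem]
    · exact (Ideal.Quotient.eq_zero_iff_mem (I := J j)).2 hf
  obtain ⟨P, hP, hqP⟩ := Set.mem_iUnion₂.1 this
  refine Set.mem_iUnion₂.2 ⟨F P, Finset.mem_image.2 ⟨P, ?_, rfl⟩, hqP⟩
  rw [Set.Finite.mem_toFinset]
  exact Set.mem_iUnion₂.2 ⟨j, hj, hP⟩

theorem one_notMem_m {k : Type*} [Field k] :
    (1 : MvPolynomial (Fin 4) k) ∉ Ideal.span (Set.range (X : Fin 4 → MvPolynomial (Fin 4) k)) := by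
  rw [← Set.image_univ, mem_ideal_span_X_image]
  intro h
  obtain ⟨i, -, hi⟩ := h 0 (by simp)
  simp at hi

theorem nzd_base {k : Type*} [Field k] (j : Fin 4) :
    Nzd (Ideal.span (X '' {i : Fin 4 | i.val < j.val})) (X j : MvPolynomial (Fin 4) k) := by
  intro f hf
  rw [mem_ideal_span_X_image] at hf ⊢
  intro d hd
  obtain ⟨i, hi, hid⟩ := hf (Finsupp.single j 1 + d) (by
    rw [MvPolynomial.mem_support_iff, coeff_X_mul]
    exact MvPolynomial.mem_support_iff.1 hd)
  refine ⟨i, hi, ?_⟩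
  have : j ≠ i := by rintro rfl; exact absurd hi (by simp)
  simpa [Finsupp.single_apply, this] using hid

theorem span_base_succ {k : Type*} [Field k] (j : ℕ) (h : j < 4) :
    Ideal.span ((X : Fin 4 → MvPolynomial (Fin 4) k) '' {i : Fin 4 | i.val < j + 1}) =
    Ideal.span (X '' {i : Fin 4 | i.val < j}) ⊔ Ideal.span {X ⟨j, h⟩} := by
  rw [← Ideal.span_union]
  congr 1
  rw [← Set.image_singleton, ← Set.image_union]
  congr 1
  ext i
  simp only [Set.mem_ofPred_eq, Set.mem_union, Set.mem_singleton_iff, Fin.ext_iff]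
  omega

theorem krull_step {k : Type*} [Field k] {I : Ideal (MvPolynomial (Fin 4) k)}
    {q : MvPolynomial (Fin 4) k} (hq : Nzd I q) :
    ringKrullDim (MvPolynomial (Fin 4) k ⧸ (I ⊔ Ideal.span {q})) + 1 ≤
      ringKrullDim (MvPolynomial (Fin 4) k ⧸ I) := by
  have h := ringKrullDim_quotient_succ_le_of_nonZeroDivisor
    (r := Ideal.Quotient.mk I q) (by
      rw [mem_nonZeroDivisors_iff_right]
      intro x hx
      obtain ⟨g, rfl⟩ := Ideal.Quotient.mk_surjective x
      rw [← map_mul, Ideal.Quotient.eq_zero_iff_mem] at hx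
      rw [Ideal.Quotient.eq_zero_iff_mem]
      exact hq _ (by rwa [mul_comm]))
  have e := ringKrullDim_eq_of_ringEquiv
    (R := (MvPolynomial (Fin 4) k ⧸ I) ⧸ Ideal.map (Ideal.Quotient.mk I) (Ideal.span {q}))
    (S := MvPolynomial (Fin 4) k ⧸ (I ⊔ Ideal.span {q})) (DoubleQuot.quotQuotEquivQuotSup I (Ideal.span {q}))
  rw [Ideal.map_span, Set.image_singleton] at e
  rwa [← e]

theorem krull_end {k : Type*} [Field k] {I : Ideal (MvPolynomial (Fin 4) k)}
    (hI : I.IsHomogeneous (homogeneousSubmodule (Fin 4) k))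
    (hd : ringKrullDim (MvPolynomial (Fin 4) k ⧸ I) ≤ 0) :
    ∃ N, Ideal.span (Set.range (X : Fin 4 → MvPolynomial (Fin 4) k)) ^ N ≤ I := by
  classical
  apply Ideal.exists_pow_le_of_le_radical_of_fg _ ⟨Finset.univ.image X, by simp⟩
  rw [Ideal.radical_eq_sInf]
  refine le_sInf ?_
  rintro P ⟨hIP, hP⟩
  set Q := (P.homogeneousCore (homogeneousSubmodule (Fin 4) k)).toIdeal with hQ
  have hQP : Q ≤ P := Ideal.toIdeal_homogeneousCore_le _ _
  have hQprime : Q.IsPrime := hP.homogeneousCore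
  have hIQ : I ≤ Q := by
    have := Ideal.homogeneousCore_mono (homogeneousSubmodule (Fin 4) k) hIP
    rw [← hI.toIdeal_homogeneousCore_eq_self]
    exact this
  have hmax : Q.IsMaximal := by
    have h0 : Ring.KrullDimLE 0 (MvPolynomial (Fin 4) k ⧸ I) := Ring.krullDimLE_iff.2 hd
    rw [Ring.krullDimLE_zero_iff] at h0
    have hp : (Q.map (Ideal.Quotient.mk I)).IsPrime :=
      Ideal.map_isPrime_of_surjective Ideal.Quotient.mk_surjective (by simpa using hIQ)
    have := h0 _ hp
    have h2 := Ideal.comap_isMaximal_of_surjective (Ideal.Quotient.mk I)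
      Ideal.Quotient.mk_surjective (K := Q.map (Ideal.Quotient.mk I))
    rwa [Ideal.comap_map_of_surjective _ Ideal.Quotient.mk_surjective, ← RingHom.ker_eq_comap_bot,
      Ideal.mk_ker, sup_eq_left.2 hIQ] at h2
  have hQm : Q ≤ Ideal.span (Set.range (X : Fin 4 → MvPolynomial (Fin 4) k)) := by
    intro f hf
    rw [← sum_homogeneousComponent f]
    refine Ideal.sum_mem _ fun n _ => ?_
    have hn : homogeneousComponent n f ∈ Q := homogeneousComponent_mem_of_mem
      (HomogeneousIdeal.isHomogeneous _) hf n
    cases n with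
    | succ n => exact mem_m (homogeneousComponent_isHomogeneous _ _)
    | zero =>
      rw [homogeneousComponent_zero] at hn ⊢
      by_cases hc : coeff 0 f = 0
      · simp [hc]
      · exfalso
        apply hQprime.ne_top
        exact Ideal.eq_top_of_isUnit_mem _ hn ((Ne.isUnit hc).map C)
  rw [← hmax.eq_of_le (fun h => one_notMem_m (h ▸ Submodule.mem_top)) hQm]
  exact hQP

/-- The inductive invariant after choosing `i` quadrics in `V`. -/
structure QInv {k : Type*} [Field k] (V : Submodule k (MvPolynomial (Fin 4) k)) (i : ℕ)
    (U : Submodule k V) (J : ℕ → Ideal (MvPolynomial (Fin 4) k))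
    (s : MvPolynomial (Fin 4) k) : Prop where
  rank : Module.finrank k U = i
  leV : J 0 ≤ Ideal.span (V : Set (MvPolynomial (Fin 4) k))
  memU : ∀ f ∈ J 0, homogeneousComponent 2 f ∈ U.map V.subtype
  memJ : ∀ u ∈ U, (u : MvPolynomial (Fin 4) k) ∈ J 0
  hom : ∀ j, (J j).IsHomogeneous (homogeneousSubmodule (Fin 4) k)
  nzd : ∀ j (h : j < 4), j + i < 4 → Nzd (J j) (X ⟨j, h⟩)
  succ : ∀ j (h : j < 4), J (j + 1) = J j ⊔ Ideal.span {X ⟨j, h⟩}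
  shom : s.IsHomogeneous i
  soc : SocGen (J (4 - i)) s
  dim : ringKrullDim (MvPolynomial (Fin 4) k ⧸ J 0) + (i : ℕ) ≤ 4

theorem qinv_zero {k : Type*} [Field k] (V : Submodule k (MvPolynomial (Fin 4) k)) :
    QInv V 0 ⊥ (fun j => Ideal.span (X '' {i : Fin 4 | i.val < j})) 1 where
  rank := by simp
  leV := by simp
  memU := by
    intro f hf
    simp at hf
    simp [hf]
  memJ := by
    intro u hu
    simp at hu
    simp [hu]
  hom := by
    intro j
    apply Ideal.homogeneous_span
    rintro x ⟨i, -, rfl⟩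
    exact ⟨1, isHomogeneous_X _ _⟩
  nzd := fun j h _ => nzd_base ⟨j, h⟩
  succ := fun j h => span_base_succ j h
  shom := isHomogeneous_one _ _
  soc := by
    refine ⟨fun i => ?_, fun f _ => ⟨coeff 0 f, ?_⟩⟩
    · rw [mul_one]
      exact Ideal.subset_span ⟨i, by simp, rfl⟩
    · rw [mem_ideal_span_X_image]
      intro d hd
      by_contra hcon
      push Not at hcon
      have : d = 0 := by ext i; exact hcon i (by simp)
      subst this
      rw [MvPolynomial.mem_support_iff] at hd
      simp at hd
  dim := by
    have e : Ideal.span (X '' {i : Fin 4 | i.val < 0}) = (⊥ : Ideal (MvPolynomial (Fin 4) k)) := by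
      simp
    rw [e]
    have h := ringKrullDim_eq_of_ringEquiv (RingEquiv.quotientBot (MvPolynomial (Fin 4) k))
    rw [h, MvPolynomial.ringKrullDim_of_isNoetherianRing, ringKrullDim_eq_zero_of_field]
    simp

theorem span_le_m {k : Type*} [Field k] {V : Submodule k (MvPolynomial (Fin 4) k)}
    (hV2 : ∀ v ∈ V, v.IsHomogeneous 2) :
    Ideal.span (V : Set (MvPolynomial (Fin 4) k)) ≤
      Ideal.span (Set.range (X : Fin 4 → MvPolynomial (Fin 4) k)) := by
  rw [Ideal.span_le]
  intro v hv
  exact mem_m (n := 1) (hV2 v hv)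

theorem qinv_succ {k : Type*} [Field k] [CharZero k] {V : Submodule k (MvPolynomial (Fin 4) k)}
    [FiniteDimensional k V]
    (hV : ∀ P : Ideal (MvPolynomial (Fin 4) k), P.IsPrime → (∀ v ∈ V, v ∈ P) → ∀ i, X i ∈ P)
    (hV2 : ∀ v ∈ V, v.IsHomogeneous 2) {i : ℕ} (hi : i < 4)
    (h : ∃ U J s, QInv V i U J s) : ∃ U J s, QInv V (i + 1) U J s := by
  obtain ⟨U, J, s, h⟩ := h
  obtain ⟨q, hq⟩ := avoid_s17 V hV (4 - i) J
    (fun j hj => ⟨⟨j, by omega⟩, h.nzd j (by omega) (by omega)⟩)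
  have hq2 := hV2 _ q.2
  have hqU : q ∉ U := by
    intro hqU
    have h1 : (1 : MvPolynomial (Fin 4) k) ∈ J 0 :=
      hq 0 (by omega) _ (by rw [mul_one]; exact h.memJ q hqU)
    exact one_notMem_m (span_le_m hV2 (h.leV h1))
  obtain ⟨n, hn⟩ : ∃ n, 4 - i = n + 1 := ⟨3 - i, by omega⟩
  have hsoc := h.soc
  rw [hn, h.succ n (by omega)] at hsoc
  obtain ⟨s', hs', hsoc'⟩ := exchange (h.hom n) (h.nzd n (by omega) (by omega))
    (hq n (by omega)) (isHomogeneous_X _ _) hq2 h.shom hsoc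
  refine ⟨U ⊔ Submodule.span k {q}, fun j => J j ⊔ Ideal.span {(q : MvPolynomial (Fin 4) k)}, s', ?_⟩
  constructor
  · rw [Submodule.finrank_sup_span_singleton hqU, h.rank]
  · refine sup_le h.leV ?_
    rw [Ideal.span_le, Set.singleton_subset_iff]
    exact Ideal.subset_span q.2
  · intro f hf
    obtain ⟨g, hg⟩ := mem_sup_sing.1 hf
    have h1 := h.memU _ hg
    have h2 : homogeneousComponent 2 ((q : MvPolynomial (Fin 4) k) * g) =
        (q : MvPolynomial (Fin 4) k) * homogeneousComponent 0 g := hc_mul_s17 (n := 0) hq2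
    rw [map_sub, h2, homogeneousComponent_zero, mul_comm, ← smul_eq_C_mul] at h1
    rw [Submodule.map_sup]
    have h3 : coeff 0 g • (q : MvPolynomial (Fin 4) k) ∈
        (Submodule.span k {q}).map V.subtype :=
      ⟨coeff 0 g • q, Submodule.smul_mem _ _ (Submodule.mem_span_singleton_self q), rfl⟩
    have := Submodule.add_mem_sup h1 h3
    rwa [sub_add_cancel] at this
  · intro u hu
    obtain ⟨a, ha, b, hb, rfl⟩ := Submodule.mem_sup.1 hu
    obtain ⟨c, rfl⟩ := Submodule.mem_span_singleton.1 hb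
    refine Submodule.add_mem_sup (h.memJ a ha) ?_
    rw [Submodule.coe_smul, smul_eq_C_mul]
    exact Ideal.mul_mem_left _ _ (Ideal.mem_span_singleton_self _)
  · intro j
    refine (h.hom j).sup (Ideal.homogeneous_span _ _ ?_)
    rintro x rfl
    exact ⟨2, hq2⟩
  · intro j hj hji
    apply (h.nzd j hj (by omega)).perm
    rw [← h.succ]
    exact hq _ (by omega)
  · intro j hj
    rw [h.succ j hj, sup_right_comm]
  · exact hs'
  · have : 4 - (i + 1) = n := by omega
    rw [this]
    exact hsoc'
  · refine le_trans ?_ h.dim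
    have := krull_step (hq 0 (by omega))
    refine le_trans (le_of_eq ?_) (add_le_add_left this (i : WithBot ℕ∞))
    push_cast
    rw [add_assoc, add_comm (1 : WithBot ℕ∞)]

theorem final {k : Type*} [Field k] [CharZero k] {V : Submodule k (MvPolynomial (Fin 4) k)}
    [FiniteDimensional k V]
    (hV : ∀ P : Ideal (MvPolynomial (Fin 4) k), P.IsPrime → (∀ v ∈ V, v ∈ P) → ∀ i, X i ∈ P)
    (hV2 : ∀ v ∈ V, v.IsHomogeneous 2) (hr : Module.finrank k V ≠ 4) :
    (Ideal.span (Set.range (X : Fin 4 → MvPolynomial (Fin 4) k))) ^ 4 ≤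
      Ideal.span (V : Set (MvPolynomial (Fin 4) k)) := by
  obtain ⟨U, J, s, h⟩ := qinv_succ hV hV2 (i := 3) (by omega) <|
    qinv_succ hV hV2 (i := 2) (by omega) <| qinv_succ hV hV2 (i := 1) (by omega) <|
    qinv_succ hV hV2 (i := 0) (by omega) ⟨_, _, _, qinv_zero V⟩
  have hUtop : U ≠ ⊤ := by
    rintro rfl
    apply hr
    have := h.rank
    rwa [finrank_top] at this
  obtain ⟨f, -, hfU⟩ := SetLike.exists_of_lt (lt_top_iff_ne_top.2 hUtop)
  have hf2 := hV2 _ f.2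
  have hfJ : (f : MvPolynomial (Fin 4) k) ∉ J 0 := by
    intro hf
    have := h.memU _ hf
    rw [homogeneousComponent_eq_self hf2] at this
    obtain ⟨u, hu, huf⟩ := this
    exact hfU ((Subtype.ext huf : u = f) ▸ hu)
  have hsoc : SocGen (J 0) s := h.soc
  have hs4 : s.IsHomogeneous 4 := h.shom
  -- the socle is concentrated in degree four
  have key : ∀ (d : ℕ) (g : MvPolynomial (Fin 4) k), g.IsHomogeneous d → d ≠ 4 →
      (∀ i, X i * g ∈ J 0) → g ∈ J 0 := by
    intro d g hg hd hgs
    obtain ⟨c, hc⟩ := hsoc.2 g hgs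
    have := homogeneousComponent_mem_of_mem (h.hom 0) hc d
    rwa [map_sub, homogeneousComponent_eq_self hg, homogeneousComponent_C_mul,
      homogeneousComponent_of_mem hs4, if_neg hd, mul_zero, sub_zero] at this
  have hdim : ringKrullDim (MvPolynomial (Fin 4) k ⧸ J 0) ≤ 0 := by
    have : ringKrullDim (MvPolynomial (Fin 4) k ⧸ J 0) + ((4 : ℕ) : WithBot ℕ∞) ≤ 4 := h.dim
    generalize ringKrullDim (MvPolynomial (Fin 4) k ⧸ J 0) = x at this
    induction x using WithBot.recBotCoe with
    | bot => simp
    | coe x =>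
      induction x using ENat.recTopCoe with
      | top => simp at this; exact absurd this (by decide)
      | coe x =>
        have h5 : ((x + 4 : ℕ) : WithBot ℕ∞) ≤ ((4 : ℕ) : WithBot ℕ∞) := by
          push_cast; exact this
        have h6 : x + 4 ≤ 4 := (Nat.cast_le (α := WithBot ℕ∞)).1 h5
        have h7 : x = 0 := by omega
        simp [h7]
  obtain ⟨N, hN⟩ := krull_end (h.hom 0) hdim
  have hbig : ∀ (t d : ℕ) (g : MvPolynomial (Fin 4) k), g.IsHomogeneous d → 5 ≤ d → N ≤ d + t →
      g ∈ J 0 := by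
    intro t
    induction t with
    | zero =>
      intro d g hg _ hd
      apply hN
      apply Ideal.pow_le_pow_right hd
      rw [Ideal.mem_span_pow_iff_exists_isHomogeneous]
      refine ⟨map C g, hg.map C, ?_⟩
      rw [eval_map, eval₂_eta]
    | succ t ih =>
      intro d g hg h5 hd
      refine key d g hg (by omega) fun i => ih (1 + d) _ ((isHomogeneous_X _ i).mul hg)
        (by omega) (by omega)
  have hsoc4 : ∀ g : MvPolynomial (Fin 4) k, g.IsHomogeneous 4 → ∃ c : k, g - C c * s ∈ J 0 :=
    fun g hg => hsoc.2 g fun i => hbig N 5 _ ((isHomogeneous_X _ i).mul hg) le_rfl (by omega)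
  -- `f` multiplies nontrivially into degree four
  have hs : s ∈ J 0 ⊔ Ideal.span {(f : MvPolynomial (Fin 4) k)} := by
    obtain ⟨i, hi⟩ : ∃ i, X i * (f : MvPolynomial (Fin 4) k) ∉ J 0 := by
      by_contra! hcon
      exact hfJ (key 2 _ hf2 (by omega) hcon)
    have hf3 : (X i * (f : MvPolynomial (Fin 4) k)).IsHomogeneous 3 := (isHomogeneous_X _ i).mul hf2
    obtain ⟨j, hj⟩ : ∃ j, X j * (X i * (f : MvPolynomial (Fin 4) k)) ∉ J 0 := by
      by_contra! hcon
      exact hi (key 3 _ hf3 (by omega) hcon)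
    obtain ⟨c, hc⟩ := hsoc4 _ ((isHomogeneous_X _ j).mul hf3)
    have hc0 : c ≠ 0 := by
      rintro rfl
      apply hj
      simpa using hc
    have := (J 0).mul_mem_left (C (-c⁻¹)) hc
    refine mem_sup_sing.2 ⟨C c⁻¹ * (X j * X i), ?_⟩
    have e : (C c⁻¹ : MvPolynomial (Fin 4) k) * C c = 1 := by
      rw [← C_mul, inv_mul_cancel₀ hc0, C_1]
    convert this using 1
    rw [C_neg]
    linear_combination (-s) * e
  have hle : J 0 ⊔ Ideal.span {(f : MvPolynomial (Fin 4) k)} ≤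
      Ideal.span (V : Set (MvPolynomial (Fin 4) k)) := by
    refine sup_le h.leV ?_
    rw [Ideal.span_le, Set.singleton_subset_iff]
    exact Ideal.subset_span f.2
  refine le_trans ?_ hle
  rw [Ideal.span, Submodule.span_pow, Submodule.span_le]
  intro g hg
  have hg4 : g.IsHomogeneous 4 := by
    have h1 : Set.range (X : Fin 4 → MvPolynomial (Fin 4) k) ⊆
        (homogeneousSubmodule (Fin 4) k 1 : Set (MvPolynomial (Fin 4) k)) := by
      rintro _ ⟨i, rfl⟩
      exact isHomogeneous_X _ i
    have h2 := Submodule.pow_subset_pow _ (Set.pow_subset_pow_left h1 hg)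
    rw [homogeneousSubmodule_one_pow] at h2
    exact h2
  obtain ⟨c, hc⟩ := hsoc4 g hg4
  have := Ideal.add_mem _ (Ideal.mem_sup_left (T := Ideal.span {(f : MvPolynomial (Fin 4) k)}) hc)
    (Ideal.mul_mem_left _ (C c) hs)
  rwa [sub_add_cancel] at this

theorem quadrics_common_zero (k : Type*) [Field k] [CharZero k] (r : ℕ)
    (p : Fin r → MvPolynomial (Fin 4) k)
    (hli : LinearIndependent k p)
    (hdeg : ∀ i, (p i).IsHomogeneous 2)
    (hnc : ¬ ((Ideal.span (Set.range (X : Fin 4 → MvPolynomial (Fin 4) k))) ^ 4 ≤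
        Ideal.span (Set.range p)))
    (hr : r ≠ 4) :
    ∃ ξ : Fin 4 → AlgebraicClosure k, ξ ≠ 0 ∧ ∀ i, aeval ξ (p i) = 0 := by
  by_contra! hcon
  apply hnc
  let V : Submodule k (MvPolynomial (Fin 4) k) := Submodule.span k (Set.range p)
  have hV2 : ∀ v ∈ V, v.IsHomogeneous 2 := by
    intro v hv
    have : V ≤ homogeneousSubmodule (Fin 4) k 2 := by
      rw [Submodule.span_le]
      rintro _ ⟨i, rfl⟩
      exact hdeg i
    exact this hv
  have hfd : FiniteDimensional k V := FiniteDimensional.span_of_finite k (Set.finite_range p)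
  have hrank : Module.finrank k V = r := by
    rw [finrank_span_eq_card hli, Fintype.card_fin]
  have := final (V := V) ?_ hV2 (by rw [hrank]; exact hr)
  · refine this.trans (Ideal.span_le.2 fun v hv => ?_)
    have : V ≤ (Ideal.span (Set.range p)).restrictScalars k := by
      rw [Submodule.span_le]
      exact Ideal.subset_span
    exact this hv
  · intro P hP hVP i
    rw [← MvPolynomial.IsPrime.vanishingIdeal_zeroLocus (K := AlgebraicClosure k) P,
      mem_vanishingIdeal_iff]
    intro x hx
    have hx0 : x = 0 := by
      by_contra hx0
      obtain ⟨j, hj⟩ := hcon x hx0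
      exact hj (hx _ (hVP _ (Submodule.subset_span ⟨j, rfl⟩)))
    simp [hx0]
end

section
/- Every positive definite form f of degree 6 in ℝ[x_1,x_2,x_3] (i.e. f(x) > 0 for all 0 ≠ x ∈ ℝ³) that lies in the boundary of the cone Σ_{3,6} (i.e. f ∈ Σ_{3,6} but f is not in the interior of Σ_{3,6} inside ℝ[x_1,x_2,x_3]_6) is a sum of three squares of cubic forms. -/
open MvPolynomial

noncomputable section

abbrev VV (d : ℕ) := MvPolynomial.homogeneousSubmodule (Fin 3) ℝ d

lemma finrank_VV (d : ℕ) : Module.finrank ℝ (VV d) = (Finset.Nat.antidiagonalTuple 3 d).card := by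
  have h1 : VV d = MvPolynomial.restrictSupport ℝ {m : Fin 3 →₀ ℕ | m.degree = d} := by
    rw [VV, homogeneousSubmodule_eq_finsupp_supported]; rfl
  rw [h1, Module.finrank_eq_nat_card_basis (MvPolynomial.basisRestrictSupport ℝ _)]
  have e : {m : Fin 3 →₀ ℕ | m.degree = d} ≃ {x : Fin 3 → ℕ // x ∈ Finset.Nat.antidiagonalTuple 3 d} :=
    Finsupp.equivFunOnFinite.subtypeEquiv (fun m => by
      rw [Finset.Nat.mem_antidiagonalTuple, Set.mem_ofPred_eq, Finsupp.degree_eq_sum]; rfl)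
  rw [Nat.card_congr e]
  simp

instance (d : ℕ) : Module.Finite ℝ (VV d) :=
  Module.Finite.iff_fg.2 (homogeneousSubmodule_fg _ _ d)

lemma ext_hom {M : Type*} [AddCommGroup M] [Module ℝ M] (φ φ' : MvPolynomial (Fin 3) ℝ →ₗ[ℝ] M)
    (n : ℕ) (h : ∀ m : Fin 3 →₀ ℕ, m.degree = n → φ (monomial m 1) = φ' (monomial m 1))
    {p : MvPolynomial (Fin 3) ℝ} (hp : p.IsHomogeneous n) : φ p = φ' p := by
  rw [p.as_sum, map_sum, map_sum]
  refine Finset.sum_congr rfl fun m hm => ?_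
  have hd : m.degree = n := by
    by_contra hne
    exact (mem_support_iff.1 hm) (hp.coeff_eq_zero hne)
  have : monomial m (coeff m p) = (coeff m p) • monomial m (1 : ℝ) := by simp [smul_monomial]
  rw [this, map_smul, map_smul, h m hd]

lemma split_mon (m : Fin 3 →₀ ℕ) (n : ℕ) (h : m.degree = n + 1) :
    ∃ i m', Finsupp.degree m' = n ∧ m = Finsupp.single i 1 + m' := by
  have : m ≠ 0 := by rintro rfl; simp at h
  obtain ⟨i, hi⟩ := Finsupp.ne_iff.1 this
  have hle : Finsupp.single i 1 ≤ m := by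
    rw [Finsupp.single_le_iff]; exact Nat.one_le_iff_ne_zero.2 hi
  refine ⟨i, m - Finsupp.single i 1, ?_, (add_tsub_cancel_of_le hle).symm⟩
  have h2 := congrArg Finsupp.degree (add_tsub_cancel_of_le hle)
  rw [map_add, Finsupp.degree_single, h] at h2
  omega

lemma split_mon' (k n : ℕ) : ∀ (m : Fin 3 →₀ ℕ) (_ : m.degree = k + n),
    ∃ m₁ m₂ : Fin 3 →₀ ℕ, m₁.degree = k ∧ m₂.degree = n ∧ m = m₁ + m₂ := by
  induction k with
  | zero => intro m h; exact ⟨0, m, by simp, by simpa using h, by simp⟩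
  | succ k ih =>
    intro m h
    obtain ⟨i, m', h1, rfl⟩ := split_mon m (k + n) (by omega)
    obtain ⟨a, b, ha, hb, rfl⟩ := ih m' h1
    refine ⟨Finsupp.single i 1 + a, b, ?_, hb, by rw [add_assoc]⟩
    rw [map_add, Finsupp.degree_single, ha]; omega

lemma mon_hom {m : Fin 3 →₀ ℕ} {n : ℕ} (h : m.degree = n) :
    (monomial m (1:ℝ)).IsHomogeneous n := isHomogeneous_monomial _ h

lemma lemZ_mon (ψ : MvPolynomial (Fin 3) ℝ →ₗ[ℝ] ℝ) (w : MvPolynomial (Fin 3) ℝ)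
    (hw : w.IsHomogeneous 1) (x : Fin 3 → ℝ)
    (h : ∀ i q, q.IsHomogeneous 2 → ψ (X i * q) = x i * ψ (w * q)) (n : ℕ) :
    ∀ (k : ℕ) (_ : n + k = 3) (m : Fin 3 →₀ ℕ) (_ : m.degree = n) (s : MvPolynomial (Fin 3) ℝ)
      (_ : s.IsHomogeneous k), ψ (monomial m 1 * s) = eval x (monomial m 1) * ψ (w ^ n * s) := by
  induction n with
  | zero =>
    intro k hk m hm s hs
    have : m = 0 := (Finsupp.degree_eq_zero_iff m).1 hm
    subst this
    simp
  | succ n ih =>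
    intro k hk m hm s hs
    obtain ⟨i, m', h1, rfl⟩ := split_mon m n hm
    have e1 : monomial (Finsupp.single i 1 + m') (1:ℝ) = X i * monomial m' 1 := by
      rw [X, monomial_mul]; simp
    rw [e1, mul_assoc, h i _ (by have := (mon_hom h1).mul hs; rwa [show n + k = 2 by omega] at this)]
    have := ih (k+1) (by omega) m' h1 (w * s) (by rw [add_comm]; exact hw.mul hs)
    rw [show w * (monomial m' 1 * s) = monomial m' 1 * (w * s) by ring, this, (eval x).map_mul, eval_X,
      pow_succ, mul_assoc (w ^ n)]
    ring

lemma lemZ (ψ : MvPolynomial (Fin 3) ℝ →ₗ[ℝ] ℝ) (w : MvPolynomial (Fin 3) ℝ)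
    (hw : w.IsHomogeneous 1) (x : Fin 3 → ℝ)
    (h : ∀ i q, q.IsHomogeneous 2 → ψ (X i * q) = x i * ψ (w * q))
    (hne : ∃ p, p.IsHomogeneous 3 ∧ ψ p ≠ 0) :
    x ≠ 0 ∧ ∀ p, p.IsHomogeneous 3 → ψ p = 0 → eval x p = 0 := by
  have key : ∀ p, p.IsHomogeneous 3 → ψ p = eval x p * ψ (w ^ 3) := by
    intro p hp
    have := ext_hom ψ ((ψ (w ^ 3)) • (aeval x : MvPolynomial (Fin 3) ℝ →ₐ[ℝ] ℝ).toLinearMap) 3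
      (fun m hm => by
        have := lemZ_mon ψ w hw x h 3 0 rfl m hm 1 (isHomogeneous_one _ _)
        simp only [mul_one] at this
        rw [this]; simp [mul_comm, aeval_eq_eval]) hp
    rw [this]; simp [mul_comm, aeval_eq_eval]
  obtain ⟨p0, hp0, hp0'⟩ := hne
  have hc : ψ (w ^ 3) ≠ 0 := fun h0 => hp0' (by rw [key p0 hp0, h0, mul_zero])
  refine ⟨?_, fun p hp h0 => ?_⟩
  · rintro rfl
    apply hc
    rw [key _ (by simpa using hw.pow 3)]
    have : constantCoeff w = 0 := hw.coeff_eq_zero (by simp)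
    simp [this]
  · rw [key p hp] at h0
    exact (mul_eq_zero.1 h0).resolve_right hc

lemma generic_rank {E V A : Type*} [AddCommGroup E] [Module ℝ E] [AddCommGroup V] [Module ℝ V]
    [NormedAddCommGroup A] [InnerProductSpace ℝ A] [FiniteDimensional ℝ A]
    (L : E →ₗ[ℝ] V →ₗ[ℝ] A) :
    ∃ a, ∀ m q, L a q = 0 → L m q ∈ LinearMap.range (L a) := by
  obtain ⟨a, ha⟩ : ∃ a, ∀ b, Module.finrank ℝ (LinearMap.range (L b)) ≤
      Module.finrank ℝ (LinearMap.range (L a)) := by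
    have hb : BddAbove (Set.range fun b => Module.finrank ℝ (LinearMap.range (L b))) :=
      ⟨Module.finrank ℝ A, by rintro _ ⟨b, rfl⟩; exact Submodule.finrank_le _⟩
    obtain ⟨a, ha⟩ := Nat.sSup_mem (Set.range_nonempty _) hb
    refine ⟨a, fun b => ?_⟩
    have := le_csSup hb ⟨b, rfl⟩
    rw [← ha] at this
    exact this
  refine ⟨a, fun m q hq => ?_⟩
  by_contra hnot
  set n := Module.finrank ℝ (LinearMap.range (L a)) with hn
  let B := Module.finBasis ℝ (LinearMap.range (L a))
  choose c hc using fun i => (B i).2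
  have hli : LinearIndependent ℝ (fun i => ((B i : LinearMap.range (L a)) : A)) :=
    B.linearIndependent.map' _ (Submodule.ker_subtype _)
  have hli2 : LinearIndependent ℝ (Fin.cons (L m q) (fun i => L a (c i)) : Fin (n+1) → A) := by
    rw [linearIndependent_finCons]
    simp only [hc]
    refine ⟨hli, fun h => hnot ?_⟩
    refine Submodule.span_le.2 ?_ h
    rintro _ ⟨i, rfl⟩
    exact (B i).2
  let F : ℝ → Fin (n+1) → A := fun t => Fin.cons (L m q) (fun i => L (a + t • m) (c i))
  have hF : Continuous F := by
    refine continuous_pi fun i => ?_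
    refine Fin.cases ?_ (fun i => ?_) i
    · simp only [F, Fin.cons_zero]; exact continuous_const
    · simp only [F, Fin.cons_succ, map_add, map_smul, LinearMap.add_apply, LinearMap.smul_apply]
      fun_prop
  have hopen := (isOpen_setOfPred_linearIndependent (𝕜 := ℝ) (E := A) (ι := Fin (n+1))).preimage hF
  have h0 : (0:ℝ) ∈ F ⁻¹' {f | LinearIndependent ℝ f} := by
    simpa [F] using hli2
  obtain ⟨t, ht, ht0⟩ : ∃ t, LinearIndependent ℝ (F t) ∧ t ≠ 0 := by
    have h1 := hopen.mem_nhds h0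
    have h2 : ∀ᶠ t in nhdsWithin (0:ℝ) {0}ᶜ, LinearIndependent ℝ (F t) := nhdsWithin_le_nhds h1
    obtain ⟨t, ht⟩ := (h2.and self_mem_nhdsWithin).exists
    exact ⟨t, ht.1, ht.2⟩
  have hmem : ∀ i, F t i ∈ LinearMap.range (L (a + t • m)) := by
    intro i
    refine Fin.cases ?_ (fun i => ?_) i
    · refine ⟨t⁻¹ • q, ?_⟩
      simp [F, hq, ht0]
    · exact ⟨c i, by simp [F]⟩
  have hli3 : LinearIndependent ℝ (fun i => (⟨F t i, hmem i⟩ : LinearMap.range (L (a + t • m)))) :=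
    LinearIndependent.of_comp (Submodule.subtype _) ht
  have := hli3.fintype_card_le_finrank
  have h5 := ha (a + t • m)
  simp at this
  omega

lemma exists_ginv {V A : Type*} [AddCommGroup V] [Module ℝ V] [AddCommGroup A] [Module ℝ A]
    (L : V →ₗ[ℝ] A) : ∃ S : A →ₗ[ℝ] V, ∀ q, L (S (L q)) = L q := by
  obtain ⟨g, hg⟩ := L.rangeRestrict.exists_rightInverse_of_surjective L.range_rangeRestrict
  obtain ⟨S, hS⟩ := g.exists_extend
  refine ⟨S, fun q => ?_⟩
  have h1 : S (L q) = g (L.rangeRestrict q) := by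
    rw [← hS]; rfl
  rw [h1]
  have := congrArg Subtype.val (LinearMap.congr_fun hg (L.rangeRestrict q))
  simpa using this

lemma joint_eig {A : Type*} [NormedAddCommGroup A] [InnerProductSpace ℝ A] [FiniteDimensional ℝ A]
    [Nontrivial A] (S T : A →ₗ[ℝ] A) (hS : S.IsSymmetric) (hT : T.IsSymmetric)
    (h : ∀ a, S (T a) = T (S a)) : ∃ (v : A) (α β : ℝ), v ≠ 0 ∧ S v = α • v ∧ T v = β • v := by
  have hc : Commute S T := LinearMap.ext h
  have := LinearMap.IsSymmetric.iSup_iSup_eigenspace_inf_eigenspace_eq_top_of_commute hS hT hc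
  by_contra hcon
  push Not at hcon
  have h2 : (⨆ α, ⨆ γ, Module.End.eigenspace S α ⊓ Module.End.eigenspace T γ) = ⊥ := by
    simp only [iSup_eq_bot]
    intro α β
    rw [Submodule.eq_bot_iff]
    rintro v ⟨h1, h2⟩
    by_contra hv
    exact hcon v α β hv (Module.End.mem_eigenspace_iff.1 h1) (Module.End.mem_eigenspace_iff.1 h2)
  rw [h2] at this
  exact bot_ne_top this

open scoped MatrixOrder Matrix.Norms.L2Operator in
lemma psd_factor {n : ℕ} {M : Matrix (Fin n) (Fin n) ℝ} (hM : M.PosSemidef) :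
    ∃ C : Matrix (Fin n) (Fin n) ℝ, M = C.conjTranspose * C :=
  CStarAlgebra.nonneg_iff_eq_star_mul_self.mp hM.nonneg

lemma exists_proj {V : Type*} [AddCommGroup V] [Module ℝ V] [FiniteDimensional ℝ V]
    (B : V →ₗ[ℝ] V →ₗ[ℝ] ℝ) (hs : ∀ u v, B u v = B v u) (hp : ∀ u, 0 ≤ B u u) :
    ∃ (n : ℕ) (W : Submodule ℝ (EuclideanSpace ℝ (Fin n))) (π : V →ₗ[ℝ] W),
      Function.Surjective π ∧ ∀ u v, inner ℝ (π u) (π v) = B u v := by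
  let n := Module.finrank ℝ V
  let b := Module.finBasis ℝ V
  let M : Matrix (Fin n) (Fin n) ℝ := LinearMap.toMatrix₂ b b B
  have hM : M.PosSemidef := by
    refine Matrix.PosSemidef.of_dotProduct_mulVec_nonneg ?_ ?_
    · ext i j; simp [M, LinearMap.toMatrix₂_apply, hs (b j)]
    · intro x
      have := hp (b.equivFun.symm x)
      rw [← dotProduct_toMatrix₂_mulVec b b B] at this
      simpa using this
  obtain ⟨C, hC⟩ : ∃ C : Matrix (Fin n) (Fin n) ℝ, M = C.conjTranspose * C := by
    exact psd_factor hM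
  let π0 : V →ₗ[ℝ] EuclideanSpace ℝ (Fin n) :=
    (WithLp.linearEquiv 2 ℝ (Fin n → ℝ)).symm.toLinearMap ∘ₗ Matrix.toLin' C ∘ₗ b.equivFun.toLinearMap
  refine ⟨n, LinearMap.range π0, π0.rangeRestrict, π0.surjective_rangeRestrict, fun u v => ?_⟩
  have h1 := dotProduct_toMatrix₂_mulVec b b B (b.equivFun u) (b.equivFun v)
  simp only [LinearEquiv.symm_apply_apply] at h1
  rw [← h1]
  change inner ℝ (π0 u) (π0 v) = _
  have h2 : (LinearMap.toMatrix₂ b b B) = C.conjTranspose * C := hC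
  rw [h2, EuclideanSpace.inner_eq_star_dotProduct]
  simp only [π0, LinearMap.comp_apply, Matrix.toLin'_apply, LinearEquiv.coe_coe,
    WithLp.linearEquiv_symm_apply, star_trivial]
  rw [← Matrix.mulVec_mulVec, Matrix.dotProduct_mulVec, Matrix.conjTranspose_eq_transpose_of_trivial,
    Matrix.vecMul_transpose, dotProduct_comm]
  rfl

lemma gram3 {R : Type*} [CommRing R] [Algebra ℝ R] (K : Submodule ℝ R) [FiniteDimensional ℝ K]
    (hK : Module.finrank ℝ K ≤ 3) {r : ℕ} (p : Fin r → R) (hp : ∀ i, p i ∈ K) :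
    ∃ p' : Fin 3 → R, (∀ i, p' i ∈ K) ∧ ∑ i, p i ^ 2 = ∑ i, p' i ^ 2 := by
  obtain ⟨k, hkK, hk⟩ : ∃ k : Fin 3 → R, (∀ j, k j ∈ K) ∧ ∀ x ∈ K, ∃ c : Fin 3 → ℝ, x = ∑ j, c j • k j := by
    let b := Module.finBasis ℝ K
    let e := Fin.castLE hK
    have he : Function.Injective e := Fin.castLE_injective hK
    refine ⟨Function.extend e (fun i => (b i : R)) 0, fun j => ?_, fun x hx => ?_⟩
    · by_cases hj : ∃ i, e i = j
      · obtain ⟨i, rfl⟩ := hj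
        rw [he.extend_apply]; exact (b i).2
      · rw [Function.extend_apply' _ _ _ hj]; exact K.zero_mem
    · refine ⟨Function.extend e (b.repr ⟨x, hx⟩) 0, ?_⟩
      have h1 := congrArg Subtype.val (b.sum_repr ⟨x, hx⟩)
      simp only [Submodule.coe_sum, Submodule.coe_smul] at h1
      refine h1.symm.trans ?_
      refine Finset.sum_of_injOn e he.injOn (by simp) (fun j _ hj => ?_) (fun i _ => ?_)
      · rw [Function.extend_apply' _ _ _ (by simpa using hj)]; simp
      · rw [he.extend_apply, he.extend_apply]
  choose c hc using fun i => hk (p i) (hp i)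
  let C : Matrix (Fin r) (Fin 3) ℝ := Matrix.of c
  have hG : (C.conjTranspose * C).PosSemidef := Matrix.posSemidef_conjTranspose_mul_self C
  obtain ⟨D, hD⟩ : ∃ D : Matrix (Fin 3) (Fin 3) ℝ, C.conjTranspose * C = D.conjTranspose * D := by
    exact psd_factor hG
  refine ⟨fun i => ∑ j, D i j • k j, fun i => K.sum_mem fun j _ => K.smul_mem _ (hkK j), ?_⟩
  have key : ∀ {s : ℕ} (M : Matrix (Fin s) (Fin 3) ℝ), ∑ i, (∑ j, M i j • k j) ^ 2 =
      ∑ j, ∑ l, (M.conjTranspose * M) j l • (k j * k l) := by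
    intro s M
    simp only [sq, Finset.sum_mul_sum, Matrix.mul_apply, Finset.sum_smul]
    rw [Finset.sum_comm]
    refine Finset.sum_congr rfl fun j _ => ?_
    rw [Finset.sum_comm]
    refine Finset.sum_congr rfl fun l _ => Finset.sum_congr rfl fun i _ => ?_
    rw [smul_mul_smul_comm]; rfl
  rw [key D, ← hD, ← key C]
  exact Finset.sum_congr rfl fun i _ => by rw [hc i]; rfl

lemma sep_normed {E : Type*} [NormedAddCommGroup E] [NormedSpace ℝ E] [FiniteDimensional ℝ E]
    (C : Set E) (h0 : (0 : E) ∈ C) (hadd : ∀ x ∈ C, ∀ y ∈ C, x + y ∈ C)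
    (hsm : ∀ x ∈ C, ∀ t : ℝ, 0 ≤ t → t • x ∈ C) (f : E) (hf : f ∈ C) (hfi : f ∉ interior C) :
    ∃ g : E →ₗ[ℝ] ℝ, g ≠ 0 ∧ (∀ c ∈ C, 0 ≤ g c) ∧ g f = 0 := by
  have hconv : Convex ℝ C := by
    intro x hx y hy a b ha hb _
    exact hadd _ (hsm x hx a ha) _ (hsm y hy b hb)
  by_cases hne : (interior C).Nonempty
  · obtain ⟨g, hg⟩ := geometric_hahn_banach_point_open hconv.interior isOpen_interior hfi
    have hcl : ∀ c ∈ C, g f ≤ g c := by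
      intro c hc
      have h1 : c ∈ closure (interior C) := by
        rw [hconv.closure_interior_eq_closure_of_nonempty_interior hne]; exact subset_closure hc
      have h2 : closure (interior C) ⊆ {x | g f ≤ g x} :=
        closure_minimal (fun x hx => (hg x hx).le) (isClosed_le continuous_const g.continuous)
      exact h2 h1
    have hf0 : g f ≤ 0 := by simpa using hcl 0 h0
    have hge : ∀ c ∈ C, 0 ≤ g c := by
      intro c hc
      by_contra hlt
      push Not at hlt
      have := hcl _ (hsm c hc (g f / g c + 1) (by
        have := div_nonneg_of_nonpos hf0 hlt.le
        linarith))
      rw [map_smul, smul_eq_mul, add_mul, div_mul_cancel₀ _ hlt.ne] at this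
      linarith
    refine ⟨g.toLinearMap, ?_, hge, le_antisymm hf0 (hge f hf)⟩
    rintro h
    obtain ⟨x, hx⟩ := hne
    have h1 := hg x hx
    have h2 : ∀ y, g y = 0 := fun y => LinearMap.congr_fun h y
    rw [h2, h2] at h1
    exact lt_irrefl _ h1
  · have h1 : Submodule.span ℝ C ≠ ⊤ := by
      intro h
      apply hne
      rw [hconv.interior_nonempty_iff_affineSpan_eq_top]
      have : (affineSpan ℝ C : Set E) = Submodule.span ℝ C := by
        have := affineSpan_insert_zero (k := ℝ) C
        rwa [Set.insert_eq_of_mem h0] at this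
      apply SetLike.coe_injective
      rw [this, h]; rfl
    obtain ⟨g, hg, hg2⟩ := Submodule.exists_le_ker_of_lt_top _ (lt_top_iff_ne_top.2 h1)
    have hz : ∀ c ∈ C, g c = 0 := fun c hc => hg2 (Submodule.subset_span hc)
    exact ⟨g, hg, fun c hc => (hz c hc).ge, hz f hf⟩

lemma sep_tvs {E : Type*} [AddCommGroup E] [Module ℝ E] [TopologicalSpace E]
    [IsTopologicalAddGroup E] [ContinuousSMul ℝ E] [T2Space E] [FiniteDimensional ℝ E]
    (C : Set E) (h0 : (0 : E) ∈ C) (hadd : ∀ x ∈ C, ∀ y ∈ C, x + y ∈ C)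
    (hsm : ∀ x ∈ C, ∀ t : ℝ, 0 ≤ t → t • x ∈ C) (f : E) (hf : f ∈ C) (hfi : f ∉ interior C) :
    ∃ g : E →ₗ[ℝ] ℝ, g ≠ 0 ∧ (∀ c ∈ C, 0 ≤ g c) ∧ g f = 0 := by
  let e : E ≃L[ℝ] (Fin (Module.finrank ℝ E) → ℝ) :=
    (Module.finBasis ℝ E).equivFun.toContinuousLinearEquiv
  obtain ⟨g, hg1, hg2, hg3⟩ := sep_normed (e.symm ⁻¹' C) (by simpa using h0)
    (fun x hx y hy => by simpa using hadd _ hx _ hy)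
    (fun x hx t ht => by simpa using hsm _ hx t ht) (e f) (by simpa using hf)
    (by
      have := e.symm.toHomeomorph.preimage_interior C
      intro h
      apply hfi
      have h' : e f ∈ e.symm ⁻¹' interior C := by
        have h2 : (e.symm : _ → E) ⁻¹' interior C = interior (e.symm ⁻¹' C) := this
        rw [h2]; exact h
      simpa using h')
  refine ⟨g ∘ₗ e.toLinearEquiv.toLinearMap, ?_, fun c hc => hg2 _ (by simpa using hc), hg3⟩
  intro h
  apply hg1
  ext1 x
  ext
  have := LinearMap.congr_fun h (e.symm (LinearMap.single ℝ (fun _ => ℝ) x 1))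
  simpa using this

instance tvs1 : IsTopologicalAddGroup (MvPolynomial (Fin 3) ℝ) :=
  topologicalAddGroup_induced
    (LinearMap.pi (fun m => MvPolynomial.lcoeff ℝ m) : MvPolynomial (Fin 3) ℝ →ₗ[ℝ] ((Fin 3 →₀ ℕ) → ℝ))

instance tvs2 : ContinuousSMul ℝ (MvPolynomial (Fin 3) ℝ) :=
  continuousSMul_induced
    (LinearMap.pi (fun m => MvPolynomial.lcoeff ℝ m) : MvPolynomial (Fin 3) ℝ →ₗ[ℝ] ((Fin 3 →₀ ℕ) → ℝ))

instance tvs3 : T2Space (MvPolynomial (Fin 3) ℝ) :=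
  T2Space.of_injective_continuous (f := fun (f : MvPolynomial (Fin 3) ℝ) (m : Fin 3 →₀ ℕ) => MvPolynomial.coeff m f)
    (fun p q h => MvPolynomial.ext _ _ (fun m => congrFun h m)) continuous_induced_dom

lemma exists_coords (a : Fin 3 → ℝ) (ha : a ≠ 0) :
    ∃ x y : Fin 3 → ℝ, ∀ m : Fin 3 → ℝ, ∃ c d e : ℝ, m = c • a + d • x + e • y := by
  obtain ⟨i, hi⟩ := Function.ne_iff.1 ha
  simp only [Pi.zero_apply] at hi
  refine ⟨Pi.single (i+1) 1, Pi.single (i+2) 1, fun m => ⟨m i / a i, m (i+1) - m i / a i * a (i+1),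
    m (i+2) - m i / a i * a (i+2), ?_⟩⟩
  ext k
  fin_cases i <;> fin_cases k <;> simp_all

lemma finish {V A : Type*} [AddCommGroup V] [Module ℝ V]
    [NormedAddCommGroup A] [InnerProductSpace ℝ A] [FiniteDimensional ℝ A] [Nontrivial A]
    (L : (Fin 3 → ℝ) →ₗ[ℝ] V →ₗ[ℝ] A) (a x y : Fin 3 → ℝ)
    (hc : ∀ m : Fin 3 → ℝ, ∃ c d e : ℝ, m = c • a + d • x + e • y)
    (S T : A →ₗ[ℝ] A) (hS : S.IsSymmetric) (hT : T.IsSymmetric)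
    (hST : ∀ u v, inner ℝ (T u) (S v) = inner ℝ (S u) (T v))
    (hSx : ∀ q, S (L a q) = L x q) (hTy : ∀ q, T (L a q) = L y q) :
    ∃ ψ : A →ₗ[ℝ] ℝ, ψ ≠ 0 ∧ ∃ (w : Fin 3 → ℝ) (lam : (Fin 3 → ℝ) → ℝ),
      ∀ m q, ψ (L m q) = lam m * ψ (L w q) := by
  obtain ⟨v, α, β, hv, h1, h2⟩ := joint_eig S T hS hT (fun u => by
    refine ext_inner_right ℝ fun v => ?_
    rw [hS (T u) v, hT (S u) v, hST])
  choose c d e hcde using hc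
  refine ⟨innerₛₗ ℝ v, fun h => hv ?_, a, fun m => c m + d m * α + e m * β, fun m q => ?_⟩
  · have := LinearMap.congr_fun h v
    simpa using this
  · have e1 : inner ℝ v (L x q) = α * inner ℝ v (L a q) := by
      rw [← hSx, ← hS, h1, real_inner_smul_left]
    have e2 : inner ℝ v (L y q) = β * inner ℝ v (L a q) := by
      rw [← hTy, ← hT, h2, real_inner_smul_left]
    conv_lhs => rw [hcde m]
    simp only [map_add, map_smul, LinearMap.add_apply, LinearMap.smul_apply, innerₛₗ_apply_apply,
      smul_eq_mul, e1, e2]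
    ring

theorem core_abs {V A : Type*} [AddCommGroup V] [Module ℝ V] [FiniteDimensional ℝ V]
    [NormedAddCommGroup A] [InnerProductSpace ℝ A] [FiniteDimensional ℝ A] [Nontrivial A]
    (hV : Module.finrank ℝ V = 6) (hA : Module.finrank ℝ A ≤ 6)
    (L : (Fin 3 → ℝ) →ₗ[ℝ] V →ₗ[ℝ] A) (μ : (Fin 3 → ℝ) →ₗ[ℝ] (Fin 3 → ℝ) →ₗ[ℝ] V)
    (hμ : ∀ m b c, L m (μ b c) = L b (μ m c)) (hμs : ∀ b c, μ b c = μ c b)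
    (hμi : ∀ a, a ≠ 0 → ∀ c, μ a c = 0 → c = 0)
    (hμspan : ∀ φ : V →ₗ[ℝ] A, (∀ b c, φ (μ b c) = 0) → φ = 0)
    (hswap : ∀ m m' q q', inner ℝ (L m q) (L m' q') = inner ℝ (L m' q) (L m q'))
    (hLspan : ∀ φ : A →ₗ[ℝ] ℝ, (∀ m q, φ (L m q) = 0) → φ = 0) :
    ∃ ψ : A →ₗ[ℝ] ℝ, ψ ≠ 0 ∧ ∃ (w : Fin 3 → ℝ) (lam : (Fin 3 → ℝ) → ℝ),
      ∀ m q, ψ (L m q) = lam m * ψ (L w q) := by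
  obtain ⟨a, ha⟩ := generic_rank L
  have hker : ∀ q, L a q = 0 → ∀ m, L m q = 0 := by
    intro q hq m
    obtain ⟨s, hs⟩ := ha m q hq
    have : inner ℝ (L m q) (L m q) = (0:ℝ) := by
      nth_rewrite 2 [← hs]
      rw [hswap, hq, inner_zero_left]
    exact inner_self_eq_zero.1 this
  have hLa : L a ≠ 0 := by
    intro h
    obtain ⟨v, hv⟩ := exists_ne (0 : A)
    apply hv
    have := hLspan (innerₛₗ ℝ v) (fun m q => by rw [hker q (by rw [h]; rfl) m]; simp)
    simpa using LinearMap.congr_fun this v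
  have ha0 : a ≠ 0 := by rintro rfl; exact hLa (map_zero L)
  obtain ⟨x, y, hxy⟩ := exists_coords a ha0
  obtain ⟨S, hS⟩ := exists_ginv (L a)
  have hT : ∀ m q, (L m ∘ₗ S) (L a q) = L m q := by
    intro m q
    have := hker (S (L a q) - q) (by rw [map_sub, hS, sub_self]) m
    rw [map_sub, sub_eq_zero] at this
    exact this
  by_cases hsurj : LinearMap.range (L a) = ⊤
  · rw [LinearMap.range_eq_top] at hsurj
    refine finish L a x y hxy (L x ∘ₗ S) (L y ∘ₗ S) ?_ ?_ ?_ (hT x) (hT y)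
    · intro u v
      obtain ⟨q, rfl⟩ := hsurj u
      obtain ⟨q', rfl⟩ := hsurj v
      rw [hT, hT, hswap]
    · intro u v
      obtain ⟨q, rfl⟩ := hsurj u
      obtain ⟨q', rfl⟩ := hsurj v
      rw [hT, hT, hswap]
    · intro u v
      obtain ⟨q, rfl⟩ := hsurj u
      obtain ⟨q', rfl⟩ := hsurj v
      rw [hT, hT, hT, hT, hswap]
  by_contra hcon
  set R := LinearMap.range (L a) with hR
  obtain ⟨e, heR, hen⟩ : ∃ e ∈ Rᗮ, ‖e‖ = 1 := by
    have : Rᗮ ≠ ⊥ := fun h => hsurj (Submodule.orthogonal_eq_bot_iff.1 h)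
    obtain ⟨e, he, he0⟩ := Submodule.exists_mem_ne_zero_of_ne_bot this
    exact ⟨(‖e‖)⁻¹ • e, Rᗮ.smul_mem _ he, by simp [norm_smul, he0]⟩
  have hee : inner ℝ e e = (1:ℝ) := by rw [real_inner_self_eq_norm_sq, hen]; norm_num
  have he0 : innerₛₗ ℝ e ≠ 0 := fun h => by
    have := LinearMap.congr_fun h e
    rw [innerₛₗ_apply_apply, hee] at this
    simp at this
  have hea : ∀ q, inner ℝ e (L a q) = (0:ℝ) := fun q =>
    Submodule.inner_left_of_mem_orthogonal (K := R) ⟨q, rfl⟩ heR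
  -- no linear dependence
  have hP : ∀ β γ : ℝ, (∀ q, β * inner ℝ e (L x q) + γ * inner ℝ e (L y q) = (0:ℝ)) →
      β = 0 ∧ γ = 0 := by
    intro β γ h
    choose c d f hcdf using hxy
    by_contra hne
    apply hcon
    by_cases hβ : β = 0
    · have hγ : γ ≠ 0 := fun h => hne ⟨hβ, h⟩
      refine ⟨innerₛₗ ℝ e, he0, x, d, fun m q => ?_⟩
      have h1 : inner ℝ e (L y q) = (0:ℝ) := by
        have := h q
        rw [hβ, zero_mul, zero_add] at this
        exact (mul_eq_zero.1 this).resolve_left hγ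
      conv_lhs => rw [hcdf m]
      simp [inner_add_right, real_inner_smul_right, hea, h1]
    · refine ⟨innerₛₗ ℝ e, he0, y, fun m => f m - d m * γ / β, fun m q => ?_⟩
      have h1 : inner ℝ e (L x q) = - γ / β * inner ℝ e (L y q) := by
        have := h q
        field_simp
        linarith
      conv_lhs => rw [hcdf m]
      simp only [map_add, map_smul, LinearMap.add_apply, LinearMap.smul_apply, innerₛₗ_apply_apply,
        smul_eq_mul, h1, hea]
      ring
  let ξ : V →ₗ[ℝ] ℝ := innerₛₗ ℝ e ∘ₗ L x
  let η : V →ₗ[ℝ] ℝ := innerₛₗ ℝ e ∘ₗ L y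
  have hξ : ∀ q, ξ q = inner ℝ e (L x q) := fun q => rfl
  have hη : ∀ q, η q = inner ℝ e (L y q) := fun q => rfl
  let N := LinearMap.ker (ξ.prod η)
  have hN : Module.finrank ℝ N = 4 := by
    have hr : LinearMap.range (ξ.prod η) = ⊤ := by
      by_contra hne
      obtain ⟨g, hg, hg2⟩ := Submodule.exists_le_ker_of_lt_top _ (lt_top_iff_ne_top.2 hne)
      have key : ∀ s t : ℝ, g (s, t) = s * g (1, 0) + t * g (0, 1) := by
        intro s t
        have : (s, t) = s • ((1:ℝ), (0:ℝ)) + t • ((0:ℝ), (1:ℝ)) := by simp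
        rw [this, map_add, map_smul, map_smul]; rfl
      have := hP (g (1, 0)) (g (0, 1)) (fun q => by
        have h1 : g (ξ q, η q) = 0 := hg2 ⟨q, rfl⟩
        rw [key, hξ, hη] at h1
        linarith)
      apply hg
      ext
      · simpa using this.1
      · simpa using this.2
    have := (ξ.prod η).finrank_range_add_finrank_ker
    rw [hr, hV, finrank_top, Module.finrank_prod, Module.finrank_self] at this
    change _ + Module.finrank ℝ N = _ at this
    omega
  let I2 := LinearMap.ker (L a)
  let J := LinearMap.range (μ a)
  have hI2N : I2 ≤ N := by
    intro q hq
    have h1 := hker q hq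
    simp [N, hξ, hη, h1]
  have hJN : J ≤ N := by
    rintro _ ⟨c, rfl⟩
    simp [N, hξ, hη, hμ x a, hμ y a, hea]
  have hIJ : I2 ⊓ J = ⊥ := by
    rw [Submodule.eq_bot_iff]
    rintro _ ⟨h1, u, rfl⟩
    have h2 : ∀ m m', L m' (μ m u) = 0 := fun m => hker _ (by rw [hμ]; exact hker _ h1 m)
    have h3 : L u = 0 := hμspan _ (fun b c => by
      rw [hμ, hμs]; exact h2 c b)
    obtain ⟨c, d, f, hcdf⟩ := hxy u
    have h4 := hP d f (fun q => by
      have h5 : inner ℝ e (L u q) = (0:ℝ) := by rw [h3]; simp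
      rw [hcdf] at h5
      simpa [inner_add_right, real_inner_smul_right, hea] using h5)
    rw [h4.1, h4.2] at hcdf
    simp only [zero_smul, add_zero] at hcdf
    have h6 : c = 0 := by
      by_contra hc
      apply hLa
      rw [hcdf, map_smul] at h3
      exact (smul_eq_zero.1 h3).resolve_left hc
    rw [hcdf, h6]; simp
  have hJ : Module.finrank ℝ J = 3 := by
    have hinj : Function.Injective (μ a) :=
      (injective_iff_map_eq_zero _).2 (hμi a ha0)
    rw [LinearMap.finrank_range_of_inj hinj]; simp
  have hRI : Module.finrank ℝ R + Module.finrank ℝ I2 = 6 := by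
    rw [← hV]; exact (L a).finrank_range_add_finrank_ker
  have hRA : Module.finrank ℝ R < Module.finrank ℝ A := Submodule.finrank_lt hsurj
  have hsup : Module.finrank ℝ ↥(I2 ⊔ J) = Module.finrank ℝ I2 + 3 := by
    have := Submodule.finrank_sup_add_finrank_inf_eq I2 J
    rw [hIJ, hJ] at this
    simpa using this
  have hle : I2 ⊔ J ≤ N := sup_le hI2N hJN
  have hNeq : I2 ⊔ J = N := Submodule.eq_of_le_of_finrank_le hle (by omega)
  have hI1 : Module.finrank ℝ I2 + 3 ≤ 4 := by
    rw [← hsup, ← hN]; exact Submodule.finrank_mono hle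
  have hRe : ∀ u, u - (inner ℝ e u : ℝ) • e ∈ R := by
    have h1 : Module.finrank ℝ Rᗮ = 1 := by
      have := R.finrank_add_finrank_orthogonal
      omega
    have h2 : Submodule.span ℝ {e} = Rᗮ := by
      refine Submodule.eq_of_le_of_finrank_le ?_ ?_
      · rw [Submodule.span_singleton_le_iff_mem]; exact heR
      · rw [h1, finrank_span_singleton]
        rintro rfl; simp at hen
    intro u
    rw [← Submodule.orthogonal_orthogonal R, ← h2, Submodule.mem_orthogonal_singleton_iff_inner_right,
      inner_sub_right, real_inner_smul_right, hee]
    ring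
  set Tx := L x ∘ₗ S with hTx
  set Ty := L y ∘ₗ S with hTy
  let F : V →ₗ[ℝ] ℝ := innerₛₗ ℝ e ∘ₗ Tx ∘ₗ L y - innerₛₗ ℝ e ∘ₗ Ty ∘ₗ L x
  have hF : ∀ q, F q = inner ℝ e (Tx (L y q)) - inner ℝ e (Ty (L x q)) := fun q => rfl
  have hFN : N ≤ LinearMap.ker F := by
    rw [← hNeq]
    refine sup_le (fun q hq => ?_) ?_
    · have h1 := hker q hq
      simp [hF, h1]
    · rintro _ ⟨c, rfl⟩
      rw [LinearMap.mem_ker, hF, hμ x a, hμ y a, hT, hT, hμ, sub_self]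
  obtain ⟨αy, αx, hα⟩ : ∃ αy αx : ℝ, ∀ q, F q = αy * ξ q - αx * η q := by
    have := mem_span_of_iInf_ker_le_ker (L := ![ξ, η]) (K := F) (by
      intro q hq
      apply hFN
      simp only [Submodule.mem_iInf, Fin.forall_fin_two] at hq
      have h1 : ξ q = 0 := hq.1
      have h2 : η q = 0 := hq.2
      simp [N, h1, h2])
    rw [Matrix.range_cons, Matrix.range_cons, Matrix.range_empty, Set.union_empty,
      Set.singleton_union, Submodule.mem_span_pair] at this
    obtain ⟨s, t, hst⟩ := this
    refine ⟨s, -t, fun q => ?_⟩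
    rw [← hst]; simp
  let wx : A := LinearMap.adjoint Tx e + αx • e
  let wy : A := LinearMap.adjoint Ty e + αy • e
  have hwx : ∀ q, inner ℝ wx (L a q) = (inner ℝ e (L x q) : ℝ) := by
    intro q
    simp only [wx, inner_add_left, LinearMap.adjoint_inner_left, real_inner_smul_left, hea, mul_zero, add_zero]
    rw [hT]
  have hwy : ∀ q, inner ℝ wy (L a q) = (inner ℝ e (L y q) : ℝ) := by
    intro q
    simp only [wy, inner_add_left, LinearMap.adjoint_inner_left, real_inner_smul_left, hea, mul_zero, add_zero]
    rw [hT]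
  have hC : ∀ q, inner ℝ wy (L x q) = (inner ℝ wx (L y q) : ℝ) := by
    intro q
    have := hα q
    rw [hF, hξ, hη] at this
    simp only [wx, wy, inner_add_left, LinearMap.adjoint_inner_left, real_inner_smul_left]
    linarith
  let P : A →ₗ[ℝ] A := LinearMap.id - (innerₛₗ ℝ e).smulRight e
  have hPa : ∀ u, P u = u - (inner ℝ e u : ℝ) • e := fun u => rfl
  let X' : A →ₗ[ℝ] A := Tx ∘ₗ P + (innerₛₗ ℝ e).smulRight wx
  let Y' : A →ₗ[ℝ] A := Ty ∘ₗ P + (innerₛₗ ℝ e).smulRight wy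
  have hdec : ∀ u, ∃ (q : V) (s : ℝ), u = L a q + s • e := by
    intro u
    obtain ⟨q, hq⟩ := hRe u
    exact ⟨q, inner ℝ e u, by rw [hq]; simp⟩
  have hie : ∀ q (s : ℝ), inner ℝ e (L a q + s • e) = s := by
    intro q s
    rw [inner_add_right, hea, real_inner_smul_right, hee]; ring
  have hX' : ∀ q (s : ℝ), X' (L a q + s • e) = L x q + s • wx := by
    intro q s
    have : X' (L a q + s • e) = Tx (P (L a q + s • e)) + (inner ℝ e (L a q + s • e) : ℝ) • wx := rfl
    rw [this, hPa, hie, add_sub_cancel_right, hT]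
  have hY' : ∀ q (s : ℝ), Y' (L a q + s • e) = L y q + s • wy := by
    intro q s
    have : Y' (L a q + s • e) = Ty (P (L a q + s • e)) + (inner ℝ e (L a q + s • e) : ℝ) • wy := rfl
    rw [this, hPa, hie, add_sub_cancel_right, hT]
  apply hcon
  refine finish L a x y hxy X' Y' ?_ ?_ ?_ (fun q => by simpa using hX' q 0)
    (fun q => by simpa using hY' q 0)
  · intro u v
    obtain ⟨q, s, rfl⟩ := hdec u
    obtain ⟨q', t, rfl⟩ := hdec v
    rw [hX', hX']
    simp only [inner_add_left, inner_add_right, real_inner_smul_left, real_inner_smul_right, hwx]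
    rw [hswap x a, real_inner_comm wx (L a q), hwx, real_inner_comm e (L x q), real_inner_comm e wx]
  · intro u v
    obtain ⟨q, s, rfl⟩ := hdec u
    obtain ⟨q', t, rfl⟩ := hdec v
    rw [hY', hY']
    simp only [inner_add_left, inner_add_right, real_inner_smul_left, real_inner_smul_right, hwy]
    rw [hswap y a, real_inner_comm wy (L a q), hwy, real_inner_comm e (L y q), real_inner_comm e wy]
  · intro u v
    obtain ⟨q, s, rfl⟩ := hdec u
    obtain ⟨q', t, rfl⟩ := hdec v
    rw [hX', hX', hY', hY']
    simp only [inner_add_left, inner_add_right, real_inner_smul_left, real_inner_smul_right, hC]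
    rw [hswap y x, real_inner_comm wx (L y q), real_inner_comm wy (L x q), hC, real_inner_comm wy wx]

/-- The projection of polynomials onto forms of degree `d`. -/
def cr (d : ℕ) : MvPolynomial (Fin 3) ℝ →ₗ[ℝ] VV d :=
  LinearMap.codRestrict (VV d) (homogeneousComponent d) (fun p => homogeneousComponent_isHomogeneous d p)

lemma cr_of {d : ℕ} {p : MvPolynomial (Fin 3) ℝ} (hp : p.IsHomogeneous d) : cr d p = ⟨p, hp⟩ := by
  apply Subtype.ext
  change homogeneousComponent d p = p
  rw [homogeneousComponent_of_mem hp, if_pos rfl]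

/-- The linear form with given coefficients. -/
def lin : (Fin 3 → ℝ) →ₗ[ℝ] MvPolynomial (Fin 3) ℝ :=
  Fintype.linearCombination ℝ (fun i => (X i : MvPolynomial (Fin 3) ℝ))

lemma lin_hom (a : Fin 3 → ℝ) : (lin a).IsHomogeneous 1 := by
  rw [lin, Fintype.linearCombination_apply]
  exact IsHomogeneous.sum _ _ _ fun i _ => (VV 1).smul_mem _ (isHomogeneous_X ℝ i)

lemma lin_single (i : Fin 3) : lin (Pi.single i 1) = X i := by
  rw [lin, Fintype.linearCombination_apply_single, one_smul]

lemma lin_inj {a : Fin 3 → ℝ} (h : lin a = 0) : a = 0 := by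
  funext j
  have := congrArg (coeff (Finsupp.single j 1)) h
  rw [lin, Fintype.linearCombination_apply, coeff_sum] at this
  simpa [coeff_smul, coeff_X', Finsupp.single_left_inj] using this

lemma low_rank_zero (l : MvPolynomial (Fin 3) ℝ →ₗ[ℝ] ℝ) {A : Type*}
    [NormedAddCommGroup A] [InnerProductSpace ℝ A] [FiniteDimensional ℝ A] [Nontrivial A]
    (hA : Module.finrank ℝ A ≤ 6) (P : MvPolynomial (Fin 3) ℝ →ₗ[ℝ] A)
    (hsurj : ∀ a, ∃ p, p.IsHomogeneous 3 ∧ P p = a)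
    (hin : ∀ p q, p.IsHomogeneous 3 → q.IsHomogeneous 3 → inner ℝ (P p) (P q) = l (p * q)) :
    ∃ x : Fin 3 → ℝ, x ≠ 0 ∧ ∀ p, p.IsHomogeneous 3 → P p = 0 → eval x p = 0 := by
  let L : (Fin 3 → ℝ) →ₗ[ℝ] VV 2 →ₗ[ℝ] A :=
    ((LinearMap.mul ℝ (MvPolynomial (Fin 3) ℝ)).compl₁₂ lin (VV 2).subtype).compr₂ P
  let M : (Fin 3 → ℝ) →ₗ[ℝ] (Fin 3 → ℝ) →ₗ[ℝ] VV 2 :=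
    ((LinearMap.mul ℝ (MvPolynomial (Fin 3) ℝ)).compl₁₂ lin lin).compr₂ (cr 2)
  have hL : ∀ m q, L m q = P (lin m * (q : MvPolynomial (Fin 3) ℝ)) := fun m q => rfl
  have hh2 : ∀ b c, (lin b * lin c).IsHomogeneous 2 := fun b c => (lin_hom b).mul (lin_hom c)
  have hh3 : ∀ m (q : VV 2), (lin m * (q : MvPolynomial (Fin 3) ℝ)).IsHomogeneous 3 :=
    fun m q => (lin_hom m).mul q.2
  have hM : ∀ b c, M b c = ⟨lin b * lin c, hh2 b c⟩ := fun b c => cr_of (hh2 b c)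
  have hV : Module.finrank ℝ (VV 2) = 6 := by rw [finrank_VV]; rfl
  obtain ⟨ψ, hψ, w, lam, hlam⟩ := core_abs hV hA L M
    (by intro m b c; rw [hL, hL, hM, hM]; congr 1; ring)
    (by intro b c; rw [hM, hM]; apply Subtype.ext; exact mul_comm _ _)
    (by
      intro a ha c h
      rw [hM] at h
      have h1 : lin a * lin c = 0 := congrArg Subtype.val h
      rcases mul_eq_zero.1 h1 with h2 | h2
      · exact absurd (lin_inj h2) ha
      · exact lin_inj h2)
    (by
      intro φ hφ
      apply LinearMap.ext
      intro q
      have := ext_hom (φ ∘ₗ cr 2) 0 2 (fun m hm => by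
        obtain ⟨i, m₁, h1, rfl⟩ := split_mon m 1 hm
        obtain ⟨j, m₂, h2, rfl⟩ := split_mon m₁ 0 h1
        have h3 : m₂ = 0 := (Finsupp.degree_eq_zero_iff m₂).1 h2
        subst h3
        have h4 := hφ (Pi.single i 1) (Pi.single j 1)
        have h5 : M (Pi.single i 1) (Pi.single j 1) = cr 2 (X i * X j) := by
          rw [← lin_single i, ← lin_single j]; rfl
        rw [h5] at h4
        have h6 : (monomial (Finsupp.single i 1 + (Finsupp.single j 1 + 0)) (1:ℝ)) = X i * X j := by
          rw [add_zero, X, X, monomial_mul, one_mul]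
        rw [h6]
        exact h4) q.2
      rw [LinearMap.comp_apply, cr_of q.2] at this
      exact this)
    (by
      intro m m' q q'
      rw [hL, hL, hL, hL, hin _ _ (hh3 _ _) (hh3 _ _), hin _ _ (hh3 _ _) (hh3 _ _)]
      congr 1; ring)
    (by
      intro φ hφ
      apply LinearMap.ext
      intro a
      obtain ⟨p, hp, rfl⟩ := hsurj a
      exact ext_hom (φ ∘ₗ P) 0 3 (fun m hm => by
        obtain ⟨i, m₁, h1, rfl⟩ := split_mon m 2 hm
        have h4 := hφ (Pi.single i 1) ⟨monomial m₁ 1, mon_hom h1⟩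
        rw [hL, lin_single] at h4
        have h6 : (monomial (Finsupp.single i 1 + m₁) (1:ℝ)) = X i * monomial m₁ 1 := by
          rw [X, monomial_mul, one_mul]
        rw [h6]
        exact h4) hp)
  obtain ⟨hx, hz⟩ := lemZ (ψ ∘ₗ P) (lin w) (lin_hom w) (fun i => lam (Pi.single i 1))
    (by
      intro i q hq
      have := hlam (Pi.single i 1) ⟨q, hq⟩
      rw [hL, hL, lin_single] at this
      exact this)
    (by
      by_contra hcon
      push Not at hcon
      apply hψ
      apply LinearMap.ext
      intro a
      obtain ⟨p, hp, rfl⟩ := hsurj a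
      exact hcon p hp)
  exact ⟨_, hx, fun p hp h => hz p hp (by rw [LinearMap.comp_apply, h, map_zero])⟩

/-- Blekherman's theorem, case `(3,6)`: every positive definite ternary sextic
in the boundary of the cone `Σ_{3,6}` is a sum of three squares of cubic forms. -/
theorem boundary_posdef_three_squares
    (f : MvPolynomial.homogeneousSubmodule (Fin 3) ℝ 6)
    (hsos : InSigma 3 3 (f : MvPolynomial (Fin 3) ℝ))
    (hpos : ∀ x : Fin 3 → ℝ, x ≠ 0 → 0 < eval x (f : MvPolynomial (Fin 3) ℝ))
    (hbd : f ∉ interior {g : MvPolynomial.homogeneousSubmodule (Fin 3) ℝ 6 |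
      InSigma 3 3 (g : MvPolynomial (Fin 3) ℝ)}) :
    IsSOS 3 3 3 (f : MvPolynomial (Fin 3) ℝ) := by
  obtain ⟨l0, hl0, hlC, hlf⟩ := sep_tvs
    {g : MvPolynomial.homogeneousSubmodule (Fin 3) ℝ 6 | InSigma 3 3 (g : MvPolynomial (Fin 3) ℝ)}
    ⟨0, Fin.elim0, fun i => i.elim0, by simp⟩
    (by
      rintro x ⟨r, p, hp, hx⟩ y ⟨s, q, hq, hy⟩
      refine ⟨r + s, Fin.append p q, fun i => ?_, ?_⟩
      · refine Fin.addCases (fun i => ?_) (fun i => ?_) i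
        · rw [Fin.append_left]; exact hp i
        · rw [Fin.append_right]; exact hq i
      · rw [Fin.sum_univ_add]
        simp only [Fin.append_left, Fin.append_right]
        rw [← hx, ← hy]; rfl)
    (by
      rintro x ⟨r, p, hp, hx⟩ t ht
      refine ⟨r, fun i => Real.sqrt t • p i, fun i => (VV 3).smul_mem _ (hp i), ?_⟩
      simp only [smul_pow, Real.sq_sqrt ht]
      rw [← Finset.smul_sum, ← hx]; rfl)
    f hsos hbd
  let l : MvPolynomial (Fin 3) ℝ →ₗ[ℝ] ℝ := l0 ∘ₗ cr 6
  have hl : ∀ p (hp : p.IsHomogeneous 6), l p = l0 ⟨p, hp⟩ := fun p hp => by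
    change l0 (cr 6 p) = _
    rw [cr_of hp]
  have hsq : ∀ p : MvPolynomial (Fin 3) ℝ, p.IsHomogeneous 3 → 0 ≤ l (p * p) := fun p hp => by
    rw [hl _ (hp.mul hp)]
    exact hlC _ ⟨1, fun _ => p, fun _ => hp, by simp [sq]⟩
  let B : VV 3 →ₗ[ℝ] VV 3 →ₗ[ℝ] ℝ :=
    ((LinearMap.mul ℝ (MvPolynomial (Fin 3) ℝ)).compl₁₂ (VV 3).subtype (VV 3).subtype).compr₂ l
  have hB : ∀ u v : VV 3, B u v = l ((u : MvPolynomial (Fin 3) ℝ) * v) := fun u v => rfl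
  obtain ⟨n, W, π, hπs, hπ⟩ := exists_proj B (fun u v => by rw [hB, hB, mul_comm])
    (fun u => hsq _ u.2)
  have hrank := LinearMap.finrank_range_add_finrank_ker π
  rw [LinearMap.range_eq_top.2 hπs, finrank_top, finrank_VV] at hrank
  have h10 : (Finset.Nat.antidiagonalTuple 3 3).card = 10 := rfl
  rw [h10] at hrank
  obtain ⟨r, p, hp, hfp⟩ := hsos
  have hker : ∀ i, π ⟨p i, hp i⟩ = 0 := by
    have h1 : l (f : MvPolynomial (Fin 3) ℝ) = 0 := by rw [hl _ f.2]; exact hlf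
    rw [hfp, map_sum] at h1
    have h2 := (Finset.sum_eq_zero_iff_of_nonneg
      (fun i _ => by rw [sq]; exact hsq _ (hp i))).1 h1
    intro i
    have h3 := h2 i (Finset.mem_univ i)
    rw [← inner_self_eq_zero (𝕜 := ℝ), hπ, hB, ← sq]
    exact h3
  by_cases hW : Module.finrank ℝ W ≤ 6
  · exfalso
    have hin : ∀ p q : MvPolynomial (Fin 3) ℝ, p.IsHomogeneous 3 → q.IsHomogeneous 3 →
        inner ℝ ((π ∘ₗ cr 3) p) ((π ∘ₗ cr 3) q) = l (p * q) := by
      intro p q hp hq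
      rw [LinearMap.comp_apply, LinearMap.comp_apply, cr_of hp, cr_of hq, hπ, hB]
    have : Nontrivial W := by
      by_contra hcon
      rw [not_nontrivial_iff_subsingleton] at hcon
      apply hl0
      apply LinearMap.ext
      intro g
      have h1 := ext_hom l 0 6 (fun m hm => by
        obtain ⟨m₁, m₂, h1, h2, rfl⟩ := split_mon' 3 3 m hm
        have h3 := hin _ _ (mon_hom h1) (mon_hom h2)
        rw [monomial_mul, one_mul] at h3
        rw [← h3, Subsingleton.elim ((π ∘ₗ cr 3) (monomial m₁ 1)) 0, inner_zero_left]
        rfl) g.2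
      rw [hl _ g.2] at h1
      exact h1
    obtain ⟨x, hx, hz⟩ := low_rank_zero l hW (π ∘ₗ cr 3)
      (fun a => by
        obtain ⟨u, rfl⟩ := hπs a
        exact ⟨u, u.2, by rw [LinearMap.comp_apply, cr_of u.2]⟩) hin
    have h1 := hpos x hx
    rw [hfp, map_sum, Finset.sum_eq_zero] at h1
    · exact lt_irrefl _ h1
    · intro i _
      rw [map_pow, hz _ (hp i) (by rw [LinearMap.comp_apply, cr_of (hp i)]; exact hker i)]
      norm_num
  · obtain ⟨p', hp', hs⟩ := gram3 ((LinearMap.ker π).map (VV 3).subtype)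
      (le_trans (Submodule.finrank_map_le _ _) (by omega)) p
      (fun i => ⟨⟨p i, hp i⟩, hker i, rfl⟩)
    refine ⟨p', fun i => ?_, by rw [hfp, hs]⟩
    obtain ⟨u, _, hu⟩ := hp' i
    rw [← hu]
    exact u.2
end
end
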